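/- For every prime power q and every integer n >= 7, there exists an element α in F_{q^n}* such that both α and α^{-1} are simultaneously primitive (i.e., of multiplicative order q^n - 1) and 1-normal over F_q. -/

import Mathlib

open Polynomial

noncomputable section

/-- The action `h ∘ β = Σ_i a_i β^{q^i}` of a polynomial `h = Σ_i a_i x^i` over `F_q`
on an element `β` of an extension field. -/
def polyAct {Fq F : Type*} [Field Fq] [Field F] [Algebra Fq F]
    (q : ℕ) (h : Fq[X]) (β : F) : F :=
  h.sum fun i a => algebraMap Fq F a * β ^ q ^ i

/-- `h` is the `F_q`-order of `β`: the monic divisor of `x^n - 1` of least degree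
annihilating `β`. -/
def IsFqOrder {Fq F : Type*} [Field Fq] [Field F] [Algebra Fq F]
    (q n : ℕ) (h : Fq[X]) (β : F) : Prop :=
  h.Monic ∧ h ∣ (X ^ n - 1 : Fq[X]) ∧ polyAct q h β = 0 ∧
    ∀ h' : Fq[X], h'.Monic → h' ∣ (X ^ n - 1 : Fq[X]) → polyAct q h' β = 0 →
      h.natDegree ≤ h'.natDegree

/-- `α` is `k`-normal over `F_q`: its `F_q`-order has degree `n - k`. -/
def IsKNormal (Fq : Type*) {F : Type*} [Field Fq] [Field F] [Algebra Fq F]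
    (q n k : ℕ) (α : F) : Prop :=
  ∃ h : Fq[X], IsFqOrder q n h α ∧ h.natDegree = n - k

/-- The monomial `X^j Y^i` has weight `p * j + c * i`; all monomials of `H` have weight at most
`w`. -/
def WeightLE {k : Type*} [Field k] (p c w : ℕ) (H : k[X][X]) : Prop :=
  ∀ i j, (H.coeff i).coeff j ≠ 0 → p * j + c * i ≤ w

/-- The substitution `X ↦ T^p`, `Y ↦ β T^c`. -/
def weightSubst {k : Type*} [Field k] (p c : ℕ) (β : k) : k[X][X] →+* k[X] :=
  eval₂RingHom (eval₂RingHom C (X ^ p)) (C β * X ^ c)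

namespace WeightLE

variable {k : Type*} [Field k] {p c w w' : ℕ} {H H' : k[X][X]}

theorem mono (h : WeightLE p c w H) (hw : w ≤ w') : WeightLE p c w' H :=
  fun i j hij => (h i j hij).trans hw

theorem zero : WeightLE p c w (0 : k[X][X]) := fun i j h => by simp at h

theorem add (h : WeightLE p c w H) (h' : WeightLE p c w H') : WeightLE p c w (H + H') := by
  intro i j hij
  by_cases h0 : (H.coeff i).coeff j = 0
  · refine h' i j fun h1 => hij ?_
    simp [h0, h1]
  · exact h i j h0

theorem neg (h : WeightLE p c w H) : WeightLE p c w (-H) := by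
  intro i j hij
  exact h i j (by simpa using hij)

theorem sub (h : WeightLE p c w H) (h' : WeightLE p c w H') : WeightLE p c w (H - H') := by
  rw [sub_eq_add_neg]
  exact h.add h'.neg

theorem sum {ι : Type*} {s : Finset ι} {f : ι → k[X][X]} (h : ∀ i ∈ s, WeightLE p c w (f i)) :
    WeightLE p c w (∑ i ∈ s, f i) :=
  Finset.sum_induction f (WeightLE p c w) (fun _ _ => add) zero h

theorem mul (h : WeightLE p c w H) (h' : WeightLE p c w' H') :
    WeightLE p c (w + w') (H * H') := by
  intro i j hij
  rw [coeff_mul, finsetSum_coeff] at hij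
  obtain ⟨⟨i₁, i₂⟩, hi, hij⟩ := Finset.exists_ne_zero_of_sum_ne_zero hij
  rw [coeff_mul] at hij
  obtain ⟨⟨j₁, j₂⟩, hj, hij⟩ := Finset.exists_ne_zero_of_sum_ne_zero hij
  have h1 := h _ _ (left_ne_zero_of_mul hij)
  have h2 := h' _ _ (right_ne_zero_of_mul hij)
  rw [Finset.HasAntidiagonal.mem_antidiagonal] at hi hj
  dsimp only at h1 h2 hi hj
  rw [← hi, ← hj, mul_add, mul_add]
  omega

theorem monomial (i j : ℕ) (a : k) (h : p * j + c * i ≤ w) :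
    WeightLE p c w (Polynomial.monomial i (Polynomial.monomial j a)) := by
  intro i' j' hij
  rw [coeff_monomial] at hij
  split_ifs at hij with h1
  · rw [coeff_monomial] at hij
    split_ifs at hij with h2
    · subst h1 h2; exact h
    · exact absurd rfl hij
  · simp at hij

theorem one : WeightLE p c 0 (1 : k[X][X]) := monomial 0 0 (1 : k) (by simp)

theorem pow (h : WeightLE p c w H) (n : ℕ) : WeightLE p c (w * n) (H ^ n) := by
  induction n with
  | zero => simpa using one
  | succ n ih => rw [pow_succ, mul_add, mul_one]; exact ih.mul h

end WeightLE

section weightSubst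

variable {k : Type*} [Field k] {p c w w' : ℕ} {H H' : k[X][X]} {β : k}

theorem weightSubst_monomial (i j : ℕ) (a : k) :
    weightSubst p c β (monomial i (monomial j a)) = monomial (p * j + c * i) (a * β ^ i) := by
  simp only [weightSubst, coe_eval₂RingHom, eval₂_monomial]
  rw [mul_pow, ← pow_mul, ← pow_mul, ← C_mul_X_pow_eq_monomial, C_mul, C_pow, pow_add]
  ring

theorem eq_sum_monomial_monomial (H : k[X][X]) :
    H = ∑ i ∈ H.support, ∑ j ∈ (H.coeff i).support,
      monomial i (monomial j ((H.coeff i).coeff j)) := by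
  conv_lhs => rw [H.as_sum_support]
  refine Finset.sum_congr rfl fun i _ => ?_
  conv_lhs => rw [(H.coeff i).as_sum_support]
  rw [map_sum]

theorem weightSubst_eq_sum (H : k[X][X]) :
    weightSubst p c β H = ∑ i ∈ H.support, ∑ j ∈ (H.coeff i).support,
      monomial (p * j + c * i) ((H.coeff i).coeff j * β ^ i) := by
  conv_lhs => rw [eq_sum_monomial_monomial H]
  simp only [map_sum, weightSubst_monomial]

theorem WeightLE.natDegree_weightSubst_le (h : WeightLE p c w H) :
    (weightSubst p c β H).natDegree ≤ w := by
  rw [weightSubst_eq_sum]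
  refine natDegree_sum_le_of_forall_le _ _ fun i _ => natDegree_sum_le_of_forall_le _ _ fun j hj => ?_
  exact (natDegree_monomial_le _).trans (h i j (mem_support_iff.1 hj))

theorem WeightLE.coeff_weightSubst_mul (h : WeightLE p c w H) (h' : WeightLE p c w' H') :
    (weightSubst p c β (H * H')).coeff (w + w') =
      (weightSubst p c β H).coeff w * (weightSubst p c β H').coeff w' := by
  rw [map_mul]
  exact coeff_mul_add_eq_of_natDegree_le h.natDegree_weightSubst_le h'.natDegree_weightSubst_le

theorem WeightLE.coeff_weightSubst_eq_zero (h : WeightLE p c w H) (hw : w < w') :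
    (weightSubst p c β H).coeff w' = 0 :=
  coeff_eq_zero_of_natDegree_lt (h.natDegree_weightSubst_le.trans_lt hw)

/-- Distinct monomials of degree less than `p` in `Y` have distinct weights. -/
theorem weight_injective (hpc : p.Coprime c) {i j i' j' : ℕ} (hi : i < p) (hi' : i' < p)
    (h : p * j + c * i = p * j' + c * i') : i = i' ∧ j = j' := by
  have hp : 0 < p := by omega
  have h1 : c * i ≡ c * i' [MOD p] := by
    have : p * j + c * i ≡ p * j' + c * i' [MOD p] := by rw [h]
    simpa [Nat.ModEq, Nat.add_mod] using this
  have h2 : i ≡ i' [MOD p] := Nat.ModEq.cancel_left_of_coprime hpc h1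
  have h3 : i = i' := Nat.ModEq.eq_of_lt_of_lt h2 hi hi'
  subst h3
  exact ⟨rfl, Nat.eq_of_mul_eq_mul_left hp (by omega)⟩

theorem exists_weightLE_coeff_ne_zero (hpc : p.Coprime c) (hβ : β ≠ 0) (hH : H ≠ 0)
    (hdeg : H.degree < p) :
    ∃ w, WeightLE p c w H ∧ (weightSubst p c β H).coeff w ≠ 0 ∧
      ∃ i j, (H.coeff i).coeff j ≠ 0 ∧ p * j + c * i = w := by
  classical
  set S : Finset (ℕ × ℕ) := H.support.biUnion fun i => (H.coeff i).support.image fun j => (i, j)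
    with hS
  have hmem : ∀ i j, (i, j) ∈ S ↔ (H.coeff i).coeff j ≠ 0 := by
    intro i j
    simp only [hS, Finset.mem_biUnion, mem_support_iff, Finset.mem_image, Prod.mk.injEq]
    constructor
    · rintro ⟨i', _, j', h2, rfl, rfl⟩
      exact h2
    · intro h
      exact ⟨i, fun h0 => h (by simp [h0]), j, h, rfl, rfl⟩
  have hne : S.Nonempty := by
    obtain ⟨i, hi⟩ := nonempty_support_iff.2 hH
    obtain ⟨j, hj⟩ := nonempty_support_iff.2 (mem_support_iff.1 hi)
    exact ⟨(i, j), (hmem i j).2 (mem_support_iff.1 hj)⟩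
  obtain ⟨⟨i, j⟩, hij, hmax⟩ := S.exists_max_image (fun x => p * x.2 + c * x.1) hne
  have hlt : ∀ i, H.coeff i ≠ 0 → i < p := fun i hi => by
    have := (le_degree_of_ne_zero hi).trans_lt hdeg
    exact_mod_cast this
  have hij' := (hmem i j).1 hij
  have hi : H.coeff i ≠ 0 := fun h => hij' (by simp [h])
  refine ⟨p * j + c * i, fun i' j' h => hmax (i', j') ((hmem _ _).2 h), ?_, i, j, hij', rfl⟩
  rw [weightSubst_eq_sum]
  simp only [finsetSum_coeff, coeff_monomial]
  rw [Finset.sum_eq_single i, Finset.sum_eq_single j]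
  · simp [hij', hβ]
  · intro j' _ hj'
    rw [if_neg]
    intro h
    exact hj' (weight_injective hpc (hlt i hi) (hlt i hi) h).2
  · intro h
    exact absurd (mem_support_iff.2 hij') h
  · intro i' hi' hne
    refine Finset.sum_eq_zero fun j' _ => if_neg fun h => hne ?_
    exact (weight_injective hpc (hlt i' (mem_support_iff.1 hi')) (hlt i hi) h).1
  · intro h
    exact absurd (mem_support_iff.2 hi) h

/-- Reduction modulo a relation whose leading form is killed by the substitution preserves
weights. -/
theorem WeightLE.modByMonic {rel : k[X][X]} (hmon : rel.Monic) (hdeg : rel.natDegree = p)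
    (hrel : WeightLE p c (c * p) rel) (hlead : (weightSubst p c β rel).coeff (c * p) = 0) :
    ∀ (H : k[X][X]), WeightLE p c w H → WeightLE p c w (H %ₘ rel) ∧
      (weightSubst p c β (H %ₘ rel)).coeff w = (weightSubst p c β H).coeff w := by
  intro H
  induction hN : H.degree using WellFoundedLT.induction generalizing H with
  | _ N ih =>
  intro hH
  subst hN
  by_cases hlt : H.degree < rel.degree
  · rw [(modByMonic_eq_self_iff hmon).2 hlt]
    exact ⟨hH, rfl⟩
  push Not at hlt
  have hH0 : H ≠ 0 := by
    rintro rfl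
    simp [hmon.ne_zero] at hlt
  have hpN : p ≤ H.natDegree := hdeg ▸ natDegree_le_natDegree hlt
  set D := C H.leadingCoeff * X ^ (H.natDegree - rel.natDegree) with hD
  have hw : c * p ≤ w := by
    obtain ⟨j, hj⟩ := nonempty_support_iff.2 (leadingCoeff_ne_zero.2 hH0)
    have h1 := hH H.natDegree j (mem_support_iff.1 hj)
    have h2 : c * p ≤ c * H.natDegree := Nat.mul_le_mul_left _ hpN
    omega
  have hDw : WeightLE p c (w - c * p) D := by
    intro i j hij
    rw [hD, coeff_C_mul, coeff_X_pow] at hij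
    split_ifs at hij with h
    · have h1 := hH H.natDegree j (by simpa using hij)
      have h2 : c * H.natDegree = c * p + c * i := by
        rw [← mul_add]; congr 1; omega
      omega
    · simp at hij
  have hRD : WeightLE p c w (rel * D) := by
    have := hrel.mul hDw
    rwa [Nat.add_sub_cancel' hw] at this
  have hRD0 : (weightSubst p c β (rel * D)).coeff w = 0 := by
    have := hrel.coeff_weightSubst_mul (β := β) hDw
    rwa [Nat.add_sub_cancel' hw, hlead, zero_mul] at this
  have hmod : H %ₘ rel = (H - rel * D) %ₘ rel :=
    modByMonic_eq_of_dvd_sub hmon ⟨D, by ring⟩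
  obtain ⟨h1, h2⟩ := ih _ (div_wf_lemma ⟨hlt, hH0⟩ hmon) (H - rel * D) rfl (hH.sub hRD)
  rw [hmod]
  refine ⟨h1, h2.trans ?_⟩
  rw [map_sub, coeff_sub, hRD0, sub_zero]

end weightSubst

/-- Exponents `(i, j)` of the monomials `X^j Y^i` with `i < p` and weight at most `w`. -/
def weightIndex (p c w : ℕ) : Finset (ℕ × ℕ) :=
  (Finset.range p ×ˢ Finset.range (w + 1)).filter fun x => p * x.2 + c * x.1 ≤ w

theorem mem_weightIndex {p c w : ℕ} (hp : 0 < p) {x : ℕ × ℕ} :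
    x ∈ weightIndex p c w ↔ x.1 < p ∧ p * x.2 + c * x.1 ≤ w := by
  simp only [weightIndex, Finset.mem_filter, Finset.mem_product, Finset.mem_range]
  constructor
  · rintro ⟨⟨h1, _⟩, h2⟩
    exact ⟨h1, h2⟩
  · rintro ⟨h1, h2⟩
    have : x.2 ≤ p * x.2 := Nat.le_mul_of_pos_left _ hp
    exact ⟨⟨h1, by omega⟩, h2⟩

theorem card_weightIndex_le {p c : ℕ} (w : ℕ) (hp : 0 < p) (hpc : p.Coprime c) :
    (weightIndex p c w).card ≤ w + 1 := by
  rw [← Finset.card_range (w + 1)]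
  refine Finset.card_le_card_of_injOn (fun x => p * x.2 + c * x.1) ?_ ?_
  · intro x hx
    have := ((mem_weightIndex hp).1 hx).2
    simp only [Finset.coe_range, Set.mem_Iio]
    omega
  · intro x hx y hy h
    obtain ⟨h1, h2⟩ := weight_injective hpc ((mem_weightIndex hp).1 hx).1
      ((mem_weightIndex hp).1 hy).1 h
    exact Prod.ext h1 h2

theorem le_card_weightIndex {p c : ℕ} (w : ℕ) (hp : 0 < p) :
    w ≤ (weightIndex p c w).card + c * p := by
  by_cases hw : w < c * p
  · omega
  push Not at hw
  have hcard : (weightIndex p c w).card = ∑ i ∈ Finset.range p, ((w - c * i) / p + 1) := by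
    rw [Finset.card_eq_sum_card_fiberwise (f := Prod.fst) (t := Finset.range p)]
    · refine Finset.sum_congr rfl fun i hi => ?_
      rw [← Finset.card_range ((w - c * i) / p + 1)]
      have hi' := Finset.mem_range.1 hi
      have hci : c * i ≤ w := (Nat.mul_le_mul_left c hi'.le).trans hw
      refine (Finset.card_bij (fun j _ => (i, j)) ?_ ?_ ?_).symm
      · intro j hj
        rw [Finset.mem_filter, mem_weightIndex hp]
        refine ⟨⟨hi', ?_⟩, rfl⟩
        have hj' : j ≤ (w - c * i) / p := Nat.lt_succ_iff.1 (Finset.mem_range.1 hj)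
        have := (Nat.le_div_iff_mul_le hp).1 hj'
        rw [mul_comm] at this
        dsimp only
        omega
      · intro a _ b _ h
        exact (Prod.mk.inj h).2
      · rintro ⟨a, b⟩ hab
        rw [Finset.mem_filter, mem_weightIndex hp] at hab
        obtain ⟨⟨h1, h2⟩, h3⟩ := hab
        dsimp only at h1 h2 h3
        subst h3
        refine ⟨b, Finset.mem_range.2 (Nat.lt_succ_iff.2 ((Nat.le_div_iff_mul_le hp).2 ?_)), rfl⟩
        rw [mul_comm]
        omega
    · intro x hx
      simpa using ((mem_weightIndex hp).1 hx).1
  have h1 : ∀ i ∈ Finset.range p, (w - c * p) / p + 1 ≤ (w - c * i) / p + 1 := by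
    intro i hi
    have : c * i ≤ c * p := Nat.mul_le_mul_left c (Finset.mem_range.1 hi).le
    gcongr
  have h2 := Finset.sum_le_sum h1
  rw [← hcard, Finset.sum_const, Finset.card_range, smul_eq_mul] at h2
  have h3 := Nat.lt_mul_div_succ (w - c * p) hp
  omega

/-- The polynomial with prescribed coefficients on a finite set of monomials. -/
def polyOfCoeffs {k : Type*} [Field k] (I : Finset (ℕ × ℕ)) (f : I → k) : k[X][X] :=
  ∑ x : I, monomial x.1.1 (monomial x.1.2 (f x))

section polyOfCoeffs

variable {k : Type*} [Field k] {I : Finset (ℕ × ℕ)}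

theorem coeff_coeff_polyOfCoeffs (f : I → k) (x : I) :
    ((polyOfCoeffs I f).coeff x.1.1).coeff x.1.2 = f x := by
  classical
  simp only [polyOfCoeffs, finsetSum_coeff]
  rw [Finset.sum_eq_single x]
  · simp
  · intro y _ hy
    rw [coeff_monomial]
    split_ifs with h1
    · rw [coeff_monomial, if_neg]
      exact fun h2 => hy (Subtype.ext (Prod.ext h1 h2))
    · simp
  · simp

theorem polyOfCoeffs_sub (f g : I → k) :
    polyOfCoeffs I (f - g) = polyOfCoeffs I f - polyOfCoeffs I g := by
  simp [polyOfCoeffs, Finset.sum_sub_distrib]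

theorem weightLE_polyOfCoeffs {p c w : ℕ} (hp : 0 < p) (f : weightIndex p c w → k) :
    WeightLE p c w (polyOfCoeffs _ f) :=
  WeightLE.sum fun x _ => WeightLE.monomial _ _ _ ((mem_weightIndex hp).1 x.2).2

theorem degree_polyOfCoeffs_lt {p c w : ℕ} (hp : 0 < p) (f : weightIndex p c w → k) :
    (polyOfCoeffs _ f).degree < p := by
  refine (degree_sum_le _ _).trans_lt ?_
  rw [Finset.sup_lt_iff (by simp)]
  intro x _
  refine (degree_monomial_le _ _).trans_lt ?_
  exact_mod_cast ((mem_weightIndex hp).1 x.2).1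

theorem eq_zero_of_coeffs_eq_zero {p c w : ℕ} (hp : 0 < p) {H : k[X][X]} (hH : WeightLE p c w H)
    (hdeg : H.degree < p) (h : ∀ x ∈ weightIndex p c w, (H.coeff x.1).coeff x.2 = 0) : H = 0 := by
  ext i j
  by_contra hij
  have hi : H.coeff i ≠ 0 := fun h0 => hij (by simp [h0])
  have hi' : i < p := by exact_mod_cast (le_degree_of_ne_zero hi).trans_lt hdeg
  exact hij (h (i, j) ((mem_weightIndex hp).2 ⟨hi', hH i j (by simpa using hij)⟩))

end polyOfCoeffs

/-- The dimension count: a nontrivial relation `∑ u_v^s v = 0` modulo `rel`. -/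
theorem exists_frobenius_relation {k : Type*} [Field k] [Fintype k] {p c t l m : ℕ}
    (hp : p.Prime) [CharP k p] {β : k} (hpc : p.Coprime c)
    {rel : k[X][X]} (hmon : rel.Monic) (hdeg : rel.natDegree = p)
    (hrel : WeightLE p c (c * p) rel) (hlead : (weightSubst p c β rel).coeff (c * p) = 0)
    (hcard : l * p ^ t + m + 1 < (weightIndex p c m).card * (weightIndex p c l).card) :
    ∃ u : weightIndex p c m → weightIndex p c l → k, u ≠ 0 ∧
      rel ∣ ∑ v, (polyOfCoeffs _ (u v)) ^ p ^ t * monomial v.1.1 (monomial v.1.2 (1 : k)) := by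
  classical
  have : Fact p.Prime := ⟨hp⟩
  set Φ : (weightIndex p c m → weightIndex p c l → k) → k[X][X] := fun u =>
    (∑ v, (polyOfCoeffs _ (u v)) ^ p ^ t * monomial v.1.1 (monomial v.1.2 (1 : k))) with hΦ
  have hsub : ∀ u u', Φ (u - u') = Φ u - Φ u' := by
    intro u u'
    simp only [hΦ, ← Finset.sum_sub_distrib, ← sub_mul]
    refine Finset.sum_congr rfl fun v _ => ?_
    rw [Pi.sub_apply, polyOfCoeffs_sub, sub_pow_char_pow]
  have hwt : ∀ u, WeightLE p c (l * p ^ t + m) (Φ u) := fun u =>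
    WeightLE.sum fun v _ => ((weightLE_polyOfCoeffs hp.pos _).pow _).mul
      (WeightLE.monomial _ _ _ ((mem_weightIndex hp.pos).1 v.2).2)
  let Ψ : (weightIndex p c m → weightIndex p c l → k) → (weightIndex p c (l * p ^ t + m) → k) :=
    fun u x => ((Φ u %ₘ rel).coeff x.1.1).coeff x.1.2
  have hlt : Fintype.card (weightIndex p c (l * p ^ t + m) → k) <
      Fintype.card (weightIndex p c m → weightIndex p c l → k) := by
    simp only [Fintype.card_fun, Fintype.card_coe, ← pow_mul]
    refine Nat.pow_lt_pow_right Fintype.one_lt_card ?_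
    have := card_weightIndex_le (l * p ^ t + m) hp.pos hpc
    rw [mul_comm (weightIndex p c l).card]
    omega
  obtain ⟨u, u', hne, heq⟩ := Fintype.exists_ne_map_eq_of_card_lt Ψ hlt
  refine ⟨u - u', sub_ne_zero.2 hne, ?_⟩
  rw [← modByMonic_eq_zero_iff_dvd hmon]
  change Φ (u - u') %ₘ rel = 0
  refine eq_zero_of_coeffs_eq_zero hp.pos
    (WeightLE.modByMonic (β := β) hmon hdeg hrel hlead _ (hwt _)).1 ?_ ?_
  · have := degree_modByMonic_lt (Φ (u - u')) hmon
    rwa [degree_eq_natDegree hmon.ne_zero, hdeg] at this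
  · intro x hx
    have := congrFun heq ⟨x, hx⟩
    simp only [Ψ] at this
    rw [hsub, sub_modByMonic, coeff_sub, coeff_sub, this, sub_self]

/-- The Stepanov–Bombieri upper bound for the number of fibres with `p` rational points. -/
theorem card_mul_le_of_fibres {k : Type*} [Field k] [Fintype k] {p c t : ℕ}
    (hp : p.Prime) [CharP k p] (hk : Fintype.card k = p ^ t * p ^ t) {β : k} (hβ : β ≠ 0)
    (hpc : p.Coprime c)
    {rel : k[X][X]} (hmon : rel.Monic) (hdeg : rel.natDegree = p)
    (hrel : WeightLE p c (c * p) rel) (hlead : (weightSubst p c β rel).coeff (c * p) = 0)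
    (ht : (c * p + 3) ^ 2 ≤ p ^ t) (Z : Finset k)
    (hZ : ∀ x ∈ Z, ∃ S : Finset k, S.card = p ∧ ∀ y ∈ S, rel.evalEval x y = 0) :
    p * Z.card ≤ p ^ t * p ^ t + (2 * (c * p) + 4) * p ^ t := by
  classical
  have : Fact p.Prime := ⟨hp⟩
  set s := p ^ t with hs
  set K := c * p with hK
  have hcard : (s - 1) * s + (s + (2 * K + 3)) + 1 <
      (weightIndex p c (s + (2 * K + 3))).card * (weightIndex p c (s - 1)).card := by
    have h1 := le_card_weightIndex (c := c) (s + (2 * K + 3)) hp.pos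
    have h2 := le_card_weightIndex (c := c) (s - 1) hp.pos
    rw [← hK] at h1 h2
    obtain ⟨r, hr⟩ : ∃ r, s = r + (K + 3) ^ 2 := ⟨s - (K + 3) ^ 2, by omega⟩
    have h3 : r + (K + 3) ^ 2 + K + 3 ≤ (weightIndex p c (s + (2 * K + 3))).card := by omega
    have h4 : r + K ^ 2 + 5 * K + 8 ≤ (weightIndex p c (s - 1)).card := by
      have : (K + 3) ^ 2 = K ^ 2 + 6 * K + 9 := by ring
      omega
    refine lt_of_lt_of_le ?_ (Nat.mul_le_mul h3 h4)
    have h5 : s - 1 = r + K ^ 2 + 6 * K + 8 := by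
      have : (K + 3) ^ 2 = K ^ 2 + 6 * K + 9 := by ring
      omega
    rw [h5, hr]
    nlinarith [Nat.zero_le r, Nat.zero_le K, Nat.zero_le (r * K), Nat.zero_le (K ^ 2)]
  obtain ⟨u, hu, hdvd⟩ := exists_frobenius_relation (β := β) hp hpc hmon hdeg hrel hlead hcard
  set mon : weightIndex p c (s + (2 * K + 3)) → k[X][X] := fun v =>
    monomial v.1.1 (monomial v.1.2 (1 : k)) with hmon_def
  set G : k[X][X] := ∑ v, polyOfCoeffs _ (u v) * mon v ^ s with hG
  have hs0 : 0 < s := pow_pos hp.pos t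
  have hmonw : ∀ v, WeightLE p c (p * v.1.2 + c * v.1.1) (mon v) := fun v =>
    WeightLE.monomial _ _ _ le_rfl
  have hmonc : ∀ v, ((weightSubst p c β (mon v)) ^ s).coeff ((p * v.1.2 + c * v.1.1) * s) ≠ 0 := by
    intro v
    rw [mul_comm, coeff_pow_of_natDegree_le (hmonw v).natDegree_weightSubst_le]
    simp [hmon_def, weightSubst_monomial, hβ]
  have hGw : WeightLE p c (s - 1 + (s + (2 * K + 3)) * s) G := by
    refine WeightLE.sum fun v _ => (weightLE_polyOfCoeffs hp.pos _).mul ?_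
    exact ((hmonw v).mono ((mem_weightIndex hp.pos).1 v.2).2).pow s
  -- the polynomial `G` is nonzero modulo `rel`
  have hne : G %ₘ rel ≠ 0 := by
    have hex : ∀ v, u v ≠ 0 → ∃ w, WeightLE p c w (polyOfCoeffs _ (u v)) ∧
        (weightSubst p c β (polyOfCoeffs _ (u v))).coeff w ≠ 0 ∧ w < s := by
      intro v hv
      have h0 : polyOfCoeffs _ (u v) ≠ 0 := by
        intro h0
        refine hv (funext fun x => ?_)
        rw [← coeff_coeff_polyOfCoeffs (u v) x, h0]
        simp
      obtain ⟨w, h1, h2, i, j, h3, h4⟩ := exists_weightLE_coeff_ne_zero hpc hβ h0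
        (degree_polyOfCoeffs_lt hp.pos _)
      refine ⟨w, h1, h2, ?_⟩
      have := weightLE_polyOfCoeffs hp.pos (u v) i j h3
      omega
    obtain ⟨v₁, hv₁⟩ := Function.ne_iff.1 hu
    obtain ⟨v₀, hv₀, hmax⟩ := (Finset.univ.filter fun v => u v ≠ 0).exists_max_image
      (fun v => p * v.1.2 + c * v.1.1) ⟨v₁, by simpa using hv₁⟩
    rw [Finset.mem_filter] at hv₀
    obtain ⟨w₀, hw1, hw2, hw3⟩ := hex v₀ hv₀.2
    set W := w₀ + (p * v₀.1.2 + c * v₀.1.1) * s with hW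
    have hlow : ∀ v, v ≠ v₀ → u v ≠ 0 → ∃ w, w < W ∧
        WeightLE p c w (polyOfCoeffs _ (u v) * mon v ^ s) := by
      intro v hv huv
      obtain ⟨w, h1, _, h3⟩ := hex v huv
      refine ⟨_, ?_, h1.mul ((hmonw v).pow s)⟩
      have h4 := hmax v (by simpa using huv)
      have h5 : p * v.1.2 + c * v.1.1 ≠ p * v₀.1.2 + c * v₀.1.1 := by
        intro h
        obtain ⟨h6, h7⟩ := weight_injective hpc ((mem_weightIndex hp.pos).1 v.2).1
          ((mem_weightIndex hp.pos).1 v₀.2).1 h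
        exact hv (Subtype.ext (Prod.ext h6 h7))
      have h6 : p * v.1.2 + c * v.1.1 + 1 ≤ p * v₀.1.2 + c * v₀.1.1 := by
        have : p * v.1.2 + c * v.1.1 ≤ p * v₀.1.2 + c * v₀.1.1 := h4
        omega
      have h7 := Nat.mul_le_mul_right s h6
      rw [add_mul, one_mul] at h7
      omega
    have hGW : WeightLE p c W G := by
      refine WeightLE.sum fun v _ => ?_
      by_cases hv : v = v₀
      · subst hv
        exact hw1.mul ((hmonw v).pow s)
      · by_cases huv : u v = 0
        · simp only [huv, polyOfCoeffs]
          simp [WeightLE.zero]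
        · obtain ⟨w, h1, h2⟩ := hlow v hv huv
          exact h2.mono h1.le
    have hGc : (weightSubst p c β G).coeff W ≠ 0 := by
      rw [hG, map_sum, finsetSum_coeff, Finset.sum_eq_single v₀]
      · rw [hw1.coeff_weightSubst_mul ((hmonw v₀).pow s), map_pow]
        exact mul_ne_zero hw2 (hmonc v₀)
      · intro v _ hv
        by_cases huv : u v = 0
        · simp [huv, polyOfCoeffs]
        · obtain ⟨w, h1, h2⟩ := hlow v hv huv
          exact h2.coeff_weightSubst_eq_zero h1
      · simp
    intro h0
    have := (WeightLE.modByMonic (β := β) hmon hdeg hrel hlead G hGW).2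
    rw [h0, map_zero, coeff_zero] at this
    exact hGc this.symm
  set R := G %ₘ rel with hR
  have hRw : WeightLE p c (s - 1 + (s + (2 * K + 3)) * s) R :=
    (WeightLE.modByMonic (β := β) hmon hdeg hrel hlead G hGw).1
  have hRdeg : R.degree < p := by
    have := degree_modByMonic_lt G hmon
    rwa [degree_eq_natDegree hmon.ne_zero, hdeg] at this
  have hRG : ∃ D, G = R + rel * D := ⟨G /ₘ rel, (modByMonic_add_div G rel).symm⟩
  have hvanish : ∀ x y, rel.evalEval x y = 0 → R.evalEval x y = 0 := by
    intro x y hxy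
    obtain ⟨D, hD⟩ := hRG
    have h1 : R.evalEval x y = G.evalEval x y := by
      rw [hD, evalEval_add, evalEval_mul, hxy, zero_mul, add_zero]
    rw [h1]
    refine pow_eq_zero_iff (n := s) hs0.ne' |>.1 ?_
    obtain ⟨E, hE⟩ := hdvd
    have h2 := congrArg (evalEval x y) hE
    rw [evalEval_mul, hxy, zero_mul] at h2
    have hfrob : ∀ f : weightIndex p c (s + (2 * K + 3)) → k, (∑ v, f v) ^ s = ∑ v, f v ^ s :=
      fun f => sum_pow_char_pow p t Finset.univ f
    rw [← h2, hG, ← coe_evalEvalRingHom, map_sum, map_sum, hfrob]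
    refine Finset.sum_congr rfl fun v _ => ?_
    rw [map_mul, map_mul, mul_pow, map_pow, map_pow, ← pow_mul, ← hk, FiniteField.pow_card]
  obtain ⟨i, hi⟩ : ∃ i, R.coeff i ≠ 0 := by
    by_contra! h
    exact hne (ext fun i => by rw [h i, coeff_zero])
  have hroot : ∀ x ∈ Z, (R.coeff i).IsRoot x := by
    intro x hx
    obtain ⟨S, hS, hy⟩ := hZ x hx
    have h0 : R.map (evalRingHom x) = 0 := by
      refine eq_zero_of_degree_lt_of_eval_finset_eq_zero S ?_ ?_
      · rw [hS]
        exact (degree_map_le).trans_lt hRdeg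
      · intro y hyS
        have := hvanish x y (hy y hyS)
        rwa [← map_evalRingHom_eval] at this
    have := congrArg (fun f => coeff f i) h0
    simpa using this
  have h1 : Z.card ≤ (R.coeff i).natDegree :=
    card_le_degree_of_subset_roots (by
      intro x hx
      exact (mem_roots hi).2 (hroot x hx))
  have h2 := hRw i (R.coeff i).natDegree (by simpa using hi)
  have h3 : p * Z.card ≤ s - 1 + (s + (2 * K + 3)) * s := by
    have := Nat.mul_le_mul_left p h1
    omega
  refine h3.trans ?_
  have : (s + (2 * K + 3)) * s + s = s * s + (2 * K + 4) * s := by ring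
  omega

/-- The number of `x` for which `y^p - y = a x^d + b x^{-d} + e` is solvable. -/
theorem card_artinSchreier_le {k : Type*} [Field k] [Fintype k] [DecidableEq k] {p d t : ℕ}
    (hp : p.Prime) [CharP k p] (hk : Fintype.card k = p ^ t * p ^ t) (hd : p.Coprime d)
    (ht : (d * (p + 1) * p + 3) ^ 2 ≤ p ^ t) {a : k} (ha : a ≠ 0) (b e : k) :
    p * (Finset.univ.filter fun x : kˣ =>
      ∃ y : k, y ^ p - y = a * (x : k) ^ d + b * ((x⁻¹ : kˣ) : k) ^ d + e).card ≤
      p ^ t * p ^ t + (2 * (d * (p + 1) * p) + 4) * p ^ t := by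
  have : Fact p.Prime := ⟨hp⟩
  have hp1 : 1 < p := hp.one_lt
  obtain ⟨β, hβ⟩ : ∃ β : k, β ^ p = a := by
    obtain ⟨β, hβ⟩ := (PerfectRing.bijective_frobenius (R := k) (p := p)).2 a
    exact ⟨β, hβ⟩
  have hβ0 : β ≠ 0 := by
    rintro rfl
    rw [zero_pow hp.ne_zero] at hβ
    exact ha hβ.symm
  obtain ⟨r, rfl⟩ : ∃ r, p = r + 1 := ⟨p - 1, by omega⟩
  set rel : k[X][X] := monomial (r + 1) (monomial 0 1) - (monomial 1 (monomial (d * r) 1)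
    + monomial 0 (monomial (d * (r + 2)) a) + monomial 0 (monomial (d * (r + 1)) e)
    + monomial 0 (monomial (d * r) b)) with hrel
  set low : k[X][X] := monomial 1 (monomial (d * r) 1)
    + monomial 0 (monomial (d * (r + 2)) a) + monomial 0 (monomial (d * (r + 1)) e)
    + monomial 0 (monomial (d * r) b) with hlow
  have hX : (monomial (r + 1) (monomial 0 1) : k[X][X]) = X ^ (r + 1) := by
    rw [monomial_zero_left, C_1, ← X_pow_eq_monomial]
  have hlowdeg : low.degree < ((r + 1 : ℕ) : WithBot ℕ) := by
    rw [hlow]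
    refine (degree_add_le _ _).trans_lt (max_lt ((degree_add_le _ _).trans_lt (max_lt
      ((degree_add_le _ _).trans_lt (max_lt ?_ ?_)) ?_)) ?_)
    all_goals refine (degree_monomial_le _ _).trans_lt ?_
    all_goals exact_mod_cast (by omega)
  have hmon : rel.Monic := by
    rw [hrel, hX]
    exact monic_X_pow_sub hlowdeg
  have hdeg : rel.natDegree = r + 1 := by
    rw [hrel, hX, natDegree_sub_eq_left_of_natDegree_lt, natDegree_X_pow]
    rw [natDegree_X_pow]
    by_cases h0 : low = 0
    · rw [h0, natDegree_zero]
      omega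
    · exact (natDegree_lt_iff_degree_lt h0).2 hlowdeg
  have hw : ∀ i j (z : k), (r + 1) * j + d * (r + 1 + 1) * i ≤ d * (r + 1 + 1) * (r + 1) →
      WeightLE (r + 1) (d * (r + 1 + 1)) (d * (r + 1 + 1) * (r + 1))
        (monomial i (monomial j z)) := fun i j z h => WeightLE.monomial i j z h
  have hrelw : WeightLE (r + 1) (d * (r + 1 + 1)) (d * (r + 1 + 1) * (r + 1)) rel := by
    refine (hw _ _ _ (by simp)).sub ((((hw _ _ _ ?_).add (hw _ _ _ ?_)).add
      (hw _ _ _ ?_)).add (hw _ _ _ ?_))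
    all_goals nlinarith [Nat.zero_le d, Nat.zero_le (d * r), Nat.zero_le (d * r * r)]
  have hd0 : 0 < d := by
    rcases Nat.eq_zero_or_pos d with rfl | h
    · simp at hd
      omega
    · exact h
  have hr0 : 0 < r := by omega
  have hlead : (weightSubst (r + 1) (d * (r + 1 + 1)) β rel).coeff (d * (r + 1 + 1) * (r + 1))
      = 0 := by
    have h1 : (r + 1) * (d * r) + d * (r + 1 + 1) * 1 ≠ d * (r + 1 + 1) * (r + 1) := by
      have : 0 < d * r := Nat.mul_pos hd0 hr0
      nlinarith
    have h2 : (r + 1) * (d * (r + 2)) = d * (r + 1 + 1) * (r + 1) := by ring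
    have h3 : (r + 1) * (d * (r + 1)) ≠ d * (r + 1 + 1) * (r + 1) := by
      have : 0 < d * (r + 1) := Nat.mul_pos hd0 (by omega)
      nlinarith
    have h4 : (r + 1) * (d * r) ≠ d * (r + 1 + 1) * (r + 1) := by
      have : 0 < d * (r + 1) := Nat.mul_pos hd0 (by omega)
      nlinarith
    simp only [hrel, hlow, map_sub, map_add, weightSubst_monomial, coeff_sub, coeff_add, coeff_monomial]
    rw [if_neg h1]
    simp only [mul_zero, zero_add, add_zero]
    rw [if_pos h2, if_neg h3, if_neg h4]
    simp [hβ]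
  have hcop : (r + 1).Coprime (d * (r + 1 + 1)) :=
    Nat.Coprime.mul_right hd (by simp)
  set Zu := Finset.univ.filter fun x : kˣ =>
      ∃ y : k, y ^ (r + 1) - y = a * (x : k) ^ d + b * ((x⁻¹ : kˣ) : k) ^ d + e with hZu
  have key := card_mul_le_of_fibres hp hk hβ0 hcop hmon hdeg hrelw hlead ht
    (Zu.image Units.val) ?_
  · rwa [Finset.card_image_of_injective _ Units.val_injective] at key
  intro x hx
  obtain ⟨x, hxZ, rfl⟩ := Finset.mem_image.1 hx
  obtain ⟨y, hy⟩ := (Finset.mem_filter.1 hxZ).2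
  have hx0 : (x : k) ≠ 0 := x.ne_zero
  refine ⟨Finset.univ.image fun i : ZMod (r + 1) =>
    (x : k) ^ d * (y + ZMod.castHom (dvd_refl (r + 1)) k i), ?_, ?_⟩
  · rw [Finset.card_image_of_injective, Finset.card_univ, ZMod.card]
    intro i j hij
    exact (ZMod.castHom (dvd_refl (r + 1)) k).injective
      (add_left_cancel (mul_left_cancel₀ (pow_ne_zero d hx0) hij))
  · intro y' hy'
    obtain ⟨i, -, rfl⟩ := Finset.mem_image.1 hy'
    set z := ZMod.castHom (dvd_refl (r + 1)) k i with hz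
    have hzp : z ^ (r + 1) = z := by rw [hz, ← map_pow, ZMod.pow_card]
    have hyz : (y + z) ^ (r + 1) = y + z + (a * (x : k) ^ d + b * ((x⁻¹ : kˣ) : k) ^ d + e) := by
      rw [add_pow_char, hzp, ← hy]
      ring
    have hxi : (x : k) ^ d * ((x⁻¹ : kˣ) : k) ^ d = 1 := by
      rw [← mul_pow, Units.mul_inv, one_pow]
    simp only [hrel, hlow, evalEval_sub, evalEval_add, evalEval, eval_monomial, eval_mul, eval_pow,
      eval_C]
    rw [mul_pow, hyz]
    simp only [pow_mul, pow_succ, pow_zero, mul_add]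
    linear_combination ((x : k) ^ d) ^ r * b * hxi

theorem norm_sum_addChar_le {k : Type*} [Field k] [Fintype k] [DecidableEq k] {p d t : ℕ}
    (hp : p.Prime) [CharP k p] (hk : Fintype.card k = p ^ t * p ^ t) (hd : p.Coprime d)
    (ht : (d * (p + 1) * p + 3) ^ 2 ≤ p ^ t) {a : k} (ha : a ≠ 0) (b : k)
    (ψ : AddChar k ℂ) (hψ : ψ ≠ 0) (hfrob : ∀ y, ψ (y ^ p) = ψ y) :
    ‖∑ x : kˣ, ψ (a * (x : k) ^ d + b * ((x⁻¹ : kˣ) : k) ^ d)‖ ≤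
      (2 * (d * (p + 1) * p) + 4) * p ^ t + 1 := by
  classical
  set g : kˣ → k := fun x => a * (x : k) ^ d + b * ((x⁻¹ : kˣ) : k) ^ d with hg
  set P : Finset k := Finset.univ.image fun y : k => y ^ p - y with hP
  set A : ℝ := (2 * (d * (p + 1) * p) + 4) with hA
  set R : ℝ := (p : ℝ) ^ t * (p : ℝ) ^ t with hR
  have hRk : (Fintype.card k : ℝ) = R := by rw [hk, hR]; push_cast; ring
  have hp0 : (0 : ℝ) < p := by exact_mod_cast hp.pos
  have hPcard : R ≤ p * P.card := by
    rw [← hRk]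
    have := Finset.card_le_mul_card_image (s := (Finset.univ : Finset k))
      (f := fun y : k => y ^ p - y) p ?_
    · rw [Finset.card_univ] at this
      exact_mod_cast this
    · intro z _
      have hne : (X ^ p - X - C z : k[X]).natDegree = p := by
        rw [sub_sub, natDegree_sub_eq_left_of_natDegree_lt, natDegree_X_pow]
        rw [natDegree_X_pow, natDegree_X_add_C]
        exact hp.one_lt
      have hne0 : (X ^ p - X - C z : k[X]) ≠ 0 := by
        intro h
        rw [h, natDegree_zero] at hne
        exact hp.ne_zero hne.symm
      conv_rhs => rw [← hne]
      refine card_le_degree_of_subset_roots fun y hy => ?_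
      rw [mem_roots hne0]
      have := (Finset.mem_filter.1 hy).2
      simp [this]
  have hP1 : ∀ z ∈ P, ψ z = 1 := by
    intro z hz
    obtain ⟨y, -, rfl⟩ := Finset.mem_image.1 hz
    rw [AddChar.map_sub_eq_div, hfrob, div_self (norm_ne_zero_iff.1 (by rw [AddChar.norm_apply]; exact one_ne_zero))]
  set N : k → ℕ := fun e => (Finset.univ.filter fun x : kˣ => g x - e ∈ P).card with hN
  have hNle : ∀ e, (p : ℝ) * N e ≤ R + A * p ^ t := by
    intro e
    have h1 := card_artinSchreier_le hp hk hd ht ha b (-e)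
    have h2 : N e = (Finset.univ.filter fun x : kˣ =>
        ∃ y : k, y ^ p - y = a * (x : k) ^ d + b * ((x⁻¹ : kˣ) : k) ^ d + -e).card := by
      simp only [hN, hP, hg, Finset.mem_image, Finset.mem_univ, true_and, sub_eq_add_neg]
    rw [← h2] at h1
    rw [hR, hA]
    exact_mod_cast h1
  have hsum : ∑ e, ψ e * (N e : ℂ) = P.card * ∑ x, ψ (g x) := by
    have h1 : ∀ e, ψ e * (N e : ℂ) = ∑ x, if g x - e ∈ P then ψ e else 0 := by
      intro e
      simp only [hN]
      rw [Finset.card_filter]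
      push_cast
      rw [Finset.mul_sum]
      refine Finset.sum_congr rfl fun x _ => ?_
      split_ifs <;> simp
    simp only [h1]
    rw [Finset.sum_comm, Finset.mul_sum]
    refine Finset.sum_congr rfl fun x _ => ?_
    rw [← Equiv.sum_comp (Equiv.subLeft (g x))]
    simp only [Equiv.subLeft_apply, sub_sub_cancel]
    rw [← Finset.sum_filter, Finset.filter_univ_mem]
    rw [Finset.sum_congr rfl (g := fun _ => ψ (g x))]
    · simp
    · intro z hz
      rw [AddChar.map_sub_eq_div, hP1 z hz, div_one]
  have hsumN : ∑ e, (N e : ℝ) = P.card * (R - 1) := by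
    have h1 : ∀ e, (N e : ℝ) = ∑ x, if g x - e ∈ P then 1 else 0 := by
      intro e
      simp only [hN]
      rw [Finset.card_filter]
      push_cast
      rfl
    simp only [h1]
    rw [Finset.sum_comm]
    have h2 : ∀ x, (∑ e, if g x - e ∈ P then (1 : ℝ) else 0) = P.card := by
      intro x
      rw [← Equiv.sum_comp (Equiv.subLeft (g x))]
      simp only [Equiv.subLeft_apply, sub_sub_cancel]
      rw [← Finset.sum_filter, Finset.filter_univ_mem]
      simp
    simp only [h2, Finset.sum_const, Finset.card_univ, nsmul_eq_mul]
    rw [Fintype.card_units, Nat.cast_sub Fintype.card_pos, hRk]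
    push_cast
    ring
  have hψ0 : ∑ e, ψ e = 0 := AddChar.sum_eq_zero_iff_ne_zero.2 hψ
  set U : ℝ := (R + A * p ^ t) / p with hU
  have hUN : ∀ e, (N e : ℝ) ≤ U := fun e => by
    rw [hU, le_div_iff₀ hp0, mul_comm]
    exact hNle e
  have hTP : (P.card : ℝ) * ‖∑ x, ψ (g x)‖ ≤ R * U - P.card * (R - 1) := by
    have h1 : (P.card : ℂ) * ∑ x, ψ (g x) = -∑ e, ψ e * ((U - N e : ℝ) : ℂ) := by
      rw [← hsum]
      push_cast
      simp only [mul_sub, Finset.sum_sub_distrib, ← Finset.sum_mul, hψ0]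
      ring
    have h2 : (P.card : ℝ) * ‖∑ x, ψ (g x)‖ = ‖(P.card : ℂ) * ∑ x, ψ (g x)‖ := by simp
    rw [h2, h1, norm_neg]
    refine (norm_sum_le _ _).trans ?_
    have h3 : ∀ e ∈ Finset.univ, ‖ψ e * ((U - N e : ℝ) : ℂ)‖ ≤ U - N e := by
      intro e _
      rw [norm_mul, AddChar.norm_apply, one_mul, Complex.norm_real, Real.norm_eq_abs,
        abs_of_nonneg (sub_nonneg.2 (hUN e))]
    refine (Finset.sum_le_sum h3).trans ?_
    rw [Finset.sum_sub_distrib, hsumN]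
    simp [hRk]
  have hpt : (0 : ℝ) < (p : ℝ) ^ t := pow_pos hp0 t
  have hRpos : 0 < R := mul_pos hpt hpt
  have hPpos : (0 : ℝ) < P.card := by
    by_contra h
    push Not at h
    nlinarith
  have hUpos : 0 ≤ U := by positivity
  have hfinal : (P.card : ℝ) * ‖∑ x, ψ (g x)‖ ≤ P.card * (A * p ^ t + 1) := by
    refine hTP.trans ?_
    have h1 : R * U ≤ p * P.card * U := mul_le_mul_of_nonneg_right hPcard hUpos
    have h2 : p * U = R + A * p ^ t := by rw [hU]; field_simp
    have h3 : p * P.card * U = P.card * (R + A * p ^ t) := by rw [← h2]; ring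
    nlinarith
  exact le_of_mul_le_mul_left hfinal hPpos

section Monics

variable {F : Type*} [Field F]

/-- The monic polynomials of degree `k`. -/
def monicsOfDegree (F : Type*) [Field F] [Fintype F] (k : ℕ) : Finset F[X] :=
  open Classical in
  Finset.univ.image fun f : Fin k → F => X ^ k + ∑ i, C (f i) * X ^ (i : ℕ)

theorem coeff_X_pow_add_sum {k : ℕ} (f : Fin k → F) (i : Fin k) :
    (X ^ k + ∑ i, C (f i) * X ^ (i : ℕ)).coeff i = f i := by
  rw [coeff_add, coeff_X_pow, if_neg i.2.ne, zero_add, finsetSum_coeff,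
    Finset.sum_eq_single i]
  · simp
  · intro j _ hj
    rw [coeff_C_mul, coeff_X_pow, if_neg (fun h => hj (Fin.ext h.symm)), mul_zero]
  · simp

theorem X_pow_add_sum_injective (k : ℕ) :
    Function.Injective fun f : Fin k → F => X ^ k + ∑ i, C (f i) * X ^ (i : ℕ) := by
  intro f g h
  funext i
  rw [← coeff_X_pow_add_sum f i, ← coeff_X_pow_add_sum g i]
  exact congrArg (fun P => coeff P (i : ℕ)) h

theorem degree_sum_C_mul_X_pow_lt {k : ℕ} (f : Fin k → F) :
    (∑ i, C (f i) * X ^ (i : ℕ)).degree < (k : WithBot ℕ) := by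
  refine (degree_sum_le _ _).trans_lt ?_
  rw [Finset.sup_lt_iff (by simp)]
  intro i _
  refine (degree_C_mul_X_pow_le _ _).trans_lt ?_
  exact_mod_cast i.2

variable [Fintype F]

theorem mem_monicsOfDegree {k : ℕ} {g : F[X]} :
    g ∈ monicsOfDegree F k ↔ g.Monic ∧ g.natDegree = k := by
  classical
  simp only [monicsOfDegree, Finset.mem_image, Finset.mem_univ, true_and]
  constructor
  · rintro ⟨f, rfl⟩
    have h := degree_sum_C_mul_X_pow_lt f
    refine ⟨monic_X_pow_add h, ?_⟩
    rw [natDegree_add_eq_left_of_degree_lt, natDegree_X_pow]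
    rwa [degree_X_pow]
  · rintro ⟨hg, rfl⟩
    refine ⟨fun i => g.coeff i, ?_⟩
    conv_rhs => rw [hg.as_sum]
    rw [Fin.sum_univ_eq_sum_range (fun i => C (g.coeff i) * X ^ i)]

theorem sum_monicsOfDegree {M : Type*} [AddCommMonoid M] (k : ℕ) (φ : F[X] → M) :
    ∑ g ∈ monicsOfDegree F k, φ g =
      ∑ f : Fin k → F, φ (X ^ k + ∑ i, C (f i) * X ^ (i : ℕ)) := by
  classical
  rw [monicsOfDegree, Finset.sum_image fun f _ g _ h => X_pow_add_sum_injective k h]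

/-- The monic irreducible polynomials of degree at most `k`. -/
def monicIrreducibles (F : Type*) [Field F] [Fintype F] (k : ℕ) : Finset F[X] :=
  open Classical in
  ((Finset.range (k + 1)).biUnion (monicsOfDegree F)).filter Irreducible

theorem mem_monicIrreducibles {k : ℕ} {P : F[X]} :
    P ∈ monicIrreducibles F k ↔ P.Monic ∧ Irreducible P ∧ P.natDegree ≤ k := by
  classical
  simp only [monicIrreducibles, Finset.mem_filter, Finset.mem_biUnion, Finset.mem_range,
    mem_monicsOfDegree, Nat.lt_succ_iff]
  constructor
  · rintro ⟨⟨a, h1, h2, rfl⟩, h3⟩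
    exact ⟨h2, h3, h1⟩
  · rintro ⟨h1, h2, h3⟩
    exact ⟨⟨_, h3, h1, rfl⟩, h2⟩

open UniqueFactorizationMonoid in
/-- The degree of a monic polynomial is the sum of the von Mangoldt function over its divisors. -/
theorem natDegree_eq_sum_pow_dvd {g : F[X]} (hg : g.Monic) {k : ℕ} (hk : g.natDegree = k) :
    k = ∑ P ∈ monicIrreducibles F k, ∑ i ∈ Finset.Icc 1 k,
      open Classical in if P ^ i ∣ g then P.natDegree else 0 := by
  classical
  have hg0 : g ≠ 0 := hg.ne_zero
  have hmonic : ∀ P ∈ normalizedFactors g, P.Monic := fun P hP => by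
    have := normalize_normalized_factor P hP
    rw [← this]
    exact monic_normalize (irreducible_of_normalized_factor P hP).ne_zero
  have hsub : (normalizedFactors g).toFinset ⊆ monicIrreducibles F k := by
    intro P hP
    rw [Multiset.mem_toFinset] at hP
    refine mem_monicIrreducibles.2 ⟨hmonic P hP, irreducible_of_normalized_factor P hP, ?_⟩
    rw [← hk]
    exact natDegree_le_of_dvd (dvd_of_mem_normalizedFactors hP) hg0
  have hprod : (normalizedFactors g).prod = g := by
    rw [prod_normalizedFactors_eq hg0, hg.normalize_eq_self]
  have hdeg : k = ∑ P ∈ (normalizedFactors g).toFinset,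
      (normalizedFactors g).count P * P.natDegree := by
    conv_lhs => rw [← hk, ← hprod]
    rw [natDegree_multiset_prod_of_monic _ hmonic, Finset.sum_multiset_map_count]
    simp
  rw [Finset.sum_subset hsub] at hdeg
  · conv_lhs => rw [hdeg]
    refine Finset.sum_congr rfl fun P hP => ?_
    obtain ⟨h1, h2, h3⟩ := mem_monicIrreducibles.1 hP
    have hiff : ∀ i, P ^ i ∣ g ↔ i ≤ (normalizedFactors g).count P := by
      intro i
      rw [dvd_iff_normalizedFactors_le_normalizedFactors (pow_ne_zero _ h2.ne_zero) hg0,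
        normalizedFactors_pow, normalizedFactors_irreducible h2, h1.normalize_eq_self,
        Multiset.nsmul_singleton, Multiset.le_count_iff_replicate_le]
    rw [← Finset.sum_filter, Finset.sum_const, smul_eq_mul]
    congr 1
    have hle : (normalizedFactors g).count P ≤ k := by
      have h4 := (hiff _).2 le_rfl
      have h5 := natDegree_le_of_dvd h4 hg0
      rw [natDegree_pow, hk] at h5
      have := h2.natDegree_pos
      nlinarith
    have : (Finset.Icc 1 k).filter (fun i => P ^ i ∣ g) =
        Finset.Icc 1 ((normalizedFactors g).count P) := by
      ext i
      simp only [Finset.mem_filter, Finset.mem_Icc, hiff]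
      omega
    rw [this, Nat.card_Icc, Nat.add_sub_cancel]
  · intro P _ hP
    rw [Multiset.mem_toFinset, ← Multiset.count_eq_zero] at hP
    rw [hP, zero_mul]

/-- The power sums attached to a completely multiplicative function on monic polynomials. -/
def irreduciblePowerSum (Λ : F[X] → ℂ) (j : ℕ) : ℂ :=
  ∑ P ∈ monicIrreducibles F j with P.natDegree ∣ j, P.natDegree * Λ P ^ (j / P.natDegree)

/-- Newton's identities for the Euler product of a completely multiplicative function. -/
theorem newton_identity (Λ : F[X] → ℂ) (h1 : Λ 1 = 1)
    (hmul : ∀ g h : F[X], g.Monic → h.Monic → Λ (g * h) = Λ g * Λ h) (k : ℕ) :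
    k * ∑ g ∈ monicsOfDegree F k, Λ g =
      ∑ j ∈ Finset.Icc 1 k, irreduciblePowerSum Λ j * ∑ h ∈ monicsOfDegree F (k - j), Λ h := by
  classical
  have hpow : ∀ (P : F[X]) (i : ℕ), P.Monic → Λ (P ^ i) = Λ P ^ i := by
    intro P i hP
    induction i with
    | zero => simpa using h1
    | succ i ih => rw [pow_succ, hmul _ _ (hP.pow i) hP, ih, pow_succ]
  -- monic multiples of `P ^ i`
  have hmult : ∀ (P : F[X]) (i : ℕ), P.Monic → i * P.natDegree ≤ k →
      ∑ g ∈ monicsOfDegree F k with P ^ i ∣ g, Λ g =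
        Λ P ^ i * ∑ h ∈ monicsOfDegree F (k - i * P.natDegree), Λ h := by
    intro P i hP hi
    rw [Finset.mul_sum]
    symm
    have hPi := hP.pow i
    refine Finset.sum_bij (fun h _ => P ^ i * h) ?_ ?_ ?_ ?_
    · intro h hh
      obtain ⟨h2, h3⟩ := mem_monicsOfDegree.1 hh
      rw [Finset.mem_filter, mem_monicsOfDegree]
      refine ⟨⟨hPi.mul h2, ?_⟩, dvd_mul_right _ _⟩
      rw [hPi.natDegree_mul h2, hP.natDegree_pow, h3]
      omega
    · intro h _ h' _ he
      exact mul_left_cancel₀ hPi.ne_zero he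
    · intro g hg
      obtain ⟨hg, h, rfl⟩ := Finset.mem_filter.1 hg
      obtain ⟨h2, h3⟩ := mem_monicsOfDegree.1 hg
      have hh : h.Monic := hPi.of_mul_monic_left h2
      refine ⟨h, mem_monicsOfDegree.2 ⟨hh, ?_⟩, rfl⟩
      rw [hPi.natDegree_mul hh, hP.natDegree_pow] at h3
      omega
    · intro h hh
      rw [hmul _ _ hPi (mem_monicsOfDegree.1 hh).1, hpow P i hP]
  have hlhs : (k : ℂ) * ∑ g ∈ monicsOfDegree F k, Λ g =
      ∑ P ∈ monicIrreducibles F k, ∑ i ∈ Finset.Icc 1 k with i * P.natDegree ≤ k,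
        P.natDegree * Λ P ^ i * ∑ h ∈ monicsOfDegree F (k - i * P.natDegree), Λ h := by
    have e1 : (k : ℂ) * ∑ g ∈ monicsOfDegree F k, Λ g =
        ∑ g ∈ monicsOfDegree F k, ∑ P ∈ monicIrreducibles F k, ∑ i ∈ Finset.Icc 1 k,
          if P ^ i ∣ g then P.natDegree * Λ g else 0 := by
      rw [Finset.mul_sum]
      refine Finset.sum_congr rfl fun g hg => ?_
      obtain ⟨h2, h3⟩ := mem_monicsOfDegree.1 hg
      conv_lhs => rw [natDegree_eq_sum_pow_dvd h2 h3]
      push_cast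
      simp only [Finset.sum_mul, ite_mul, zero_mul]
    rw [e1, Finset.sum_comm]
    refine Finset.sum_congr rfl fun P hP => ?_
    obtain ⟨h2, h3, h4⟩ := mem_monicIrreducibles.1 hP
    rw [Finset.sum_comm, Finset.sum_filter]
    refine Finset.sum_congr rfl fun i hi => ?_
    rw [← Finset.sum_filter, ← Finset.mul_sum]
    split_ifs with hik
    · rw [hmult P i h2 hik, mul_assoc]
    · rw [Finset.filter_false_of_mem, Finset.sum_empty, mul_zero]
      intro g hg hdvd
      obtain ⟨h5, h6⟩ := mem_monicsOfDegree.1 hg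
      have := natDegree_le_of_dvd hdvd h5.ne_zero
      rw [natDegree_pow, h6] at this
      exact hik this
  rw [hlhs]
  have hrhs : ∀ j ∈ Finset.Icc 1 k,
      irreduciblePowerSum Λ j * ∑ h ∈ monicsOfDegree F (k - j), Λ h =
      ∑ P ∈ monicIrreducibles F k, if P.natDegree ∣ j then
        P.natDegree * Λ P ^ (j / P.natDegree) * ∑ h ∈ monicsOfDegree F (k - j), Λ h else 0 := by
    intro j hj
    rw [irreduciblePowerSum, Finset.sum_mul, ← Finset.sum_filter]
    refine Finset.sum_congr ?_ fun _ _ => rfl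
    ext P
    simp only [Finset.mem_filter, mem_monicIrreducibles]
    rw [Finset.mem_Icc] at hj
    constructor
    · rintro ⟨⟨h2, h3, h4⟩, h5⟩
      exact ⟨⟨h2, h3, h4.trans hj.2⟩, h5⟩
    · rintro ⟨⟨h2, h3, h4⟩, h5⟩
      exact ⟨⟨h2, h3, Nat.le_of_dvd (by omega) h5⟩, h5⟩
  rw [Finset.sum_congr rfl hrhs, Finset.sum_comm]
  refine Finset.sum_congr rfl fun P hP => ?_
  obtain ⟨h2, h3, h4⟩ := mem_monicIrreducibles.1 hP
  have hpos := h3.natDegree_pos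
  rw [← Finset.sum_filter]
  refine Finset.sum_bij (fun i _ => i * P.natDegree) ?_ ?_ ?_ ?_
  · intro i hi
    simp only [Finset.mem_filter, Finset.mem_Icc] at hi ⊢
    exact ⟨⟨Nat.mul_pos hi.1.1 hpos, hi.2⟩, dvd_mul_left _ _⟩
  · intro i _ i' _ h
    exact Nat.eq_of_mul_eq_mul_right hpos h
  · intro j hj
    simp only [Finset.mem_filter, Finset.mem_Icc] at hj
    obtain ⟨⟨hj1, hj2⟩, i, rfl⟩ := hj
    refine ⟨i, ?_, mul_comm _ _⟩
    simp only [Finset.mem_filter, Finset.mem_Icc]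
    rw [mul_comm] at hj2
    refine ⟨⟨?_, ?_⟩, hj2⟩
    · exact Nat.pos_of_ne_zero (by rintro rfl; simp at hj1)
    · exact (Nat.le_mul_of_pos_right i hpos).trans hj2
  · intro i _
    rw [Nat.mul_div_cancel _ hpos]

end Monics

section Kloosterman

theorem minpoly_inv {F K : Type*} [Field F] [Field K] [Algebra F K] {x : K}
    (hx : IsIntegral F x) (h0 : x ≠ 0) :
    minpoly F x⁻¹ = C ((minpoly F x).coeff 0)⁻¹ * (minpoly F x).reverse := by
  set P := minpoly F x with hP
  have hc : P.coeff 0 ≠ 0 := minpoly.coeff_zero_ne_zero hx h0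
  have htd : P.natTrailingDegree = 0 := natTrailingDegree_eq_zero.2 (Or.inr hc)
  have hdeg : ∀ y : K, IsIntegral F y → y ≠ 0 →
      aeval y⁻¹ (C ((minpoly F y).coeff 0)⁻¹ * (minpoly F y).reverse) = 0 := by
    intro y hy hy0
    let _ : Invertible y := invertibleOfNonzero hy0
    have h := eval₂_reverse_mul_pow (algebraMap F K) y (minpoly F y)
    rw [invOf_eq_inv] at h
    have h2 : eval₂ (algebraMap F K) y (minpoly F y) = 0 := minpoly.aeval F y
    rw [h2] at h
    have h3 := (mul_eq_zero.1 h).resolve_right (pow_ne_zero _ hy0)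
    rw [map_mul, aeval_def, aeval_def, h3, mul_zero]
  have hmonic : ∀ R : F[X], R.coeff 0 ≠ 0 → (C (R.coeff 0)⁻¹ * R.reverse).Monic := by
    intro R hR
    have : R.natTrailingDegree = 0 := natTrailingDegree_eq_zero.2 (Or.inr hR)
    rw [Monic, leadingCoeff_mul, leadingCoeff_C, reverse_leadingCoeff, trailingCoeff, this,
      inv_mul_cancel₀ hR]
  have hnat : ∀ R : F[X], R.coeff 0 ≠ 0 →
      (C (R.coeff 0)⁻¹ * R.reverse).natDegree = R.natDegree := by
    intro R hR
    have : R.natTrailingDegree = 0 := natTrailingDegree_eq_zero.2 (Or.inr hR)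
    rw [natDegree_C_mul (inv_ne_zero hR), reverse_natDegree, this, Nat.sub_zero]
  have hxi : IsIntegral F x⁻¹ := hx.isAlgebraic.inv.isIntegral
  have hci : (minpoly F x⁻¹).coeff 0 ≠ 0 := minpoly.coeff_zero_ne_zero hxi (inv_ne_zero h0)
  have hle : P.natDegree ≤ (minpoly F x⁻¹).natDegree := by
    have h := hdeg x⁻¹ hxi (inv_ne_zero h0)
    rw [inv_inv] at h
    have := natDegree_le_natDegree (minpoly.min F x (hmonic _ hci) h)
    rwa [hnat _ hci] at this
  symm
  refine eq_of_monic_of_dvd_of_natDegree_le (minpoly.monic hxi) (hmonic _ hc)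
    (minpoly.dvd F _ (hdeg x hx h0)) ?_
  rw [hnat _ hc]
  exact hle

theorem nextCoeff_minpoly_inv {F K : Type*} [Field F] [Field K] [Algebra F K] {x : K}
    (hx : IsIntegral F x) (h0 : x ≠ 0) :
    (minpoly F x⁻¹).nextCoeff = (minpoly F x).coeff 1 / (minpoly F x).coeff 0 := by
  have hc : (minpoly F x).coeff 0 ≠ 0 := minpoly.coeff_zero_ne_zero hx h0
  have htd : (minpoly F x).natTrailingDegree = 0 := natTrailingDegree_eq_zero.2 (Or.inr hc)
  have hpos := minpoly.natDegree_pos hx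
  have hd : (minpoly F x⁻¹).natDegree = (minpoly F x).natDegree := by
    rw [minpoly_inv hx h0, natDegree_C_mul (inv_ne_zero hc), reverse_natDegree, htd, Nat.sub_zero]
  rw [nextCoeff_of_natDegree_pos (by omega), hd, minpoly_inv hx h0, coeff_C_mul, coeff_reverse,
    revAt_le (by omega), Nat.sub_sub_self hpos, div_eq_inv_mul]

/-- The completely multiplicative function on monic polynomials whose `L`-function is that of a
twisted Kloosterman sum. -/
def kloostermanWeight {F : Type*} [Field F] (χ : MulChar F ℂ) (ψ : AddChar F ℂ) (a b : F)
    (g : F[X]) : ℂ :=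
  χ ((-1) ^ g.natDegree * g.coeff 0) * ψ (-(a * g.nextCoeff + b * (g.coeff 1 / g.coeff 0)))

variable {F : Type*} [Field F] (χ : MulChar F ℂ) (ψ : AddChar F ℂ) (a b : F)

theorem kloostermanWeight_one : kloostermanWeight χ ψ a b 1 = 1 := by
  have h : (1 : F[X]).nextCoeff = 0 := by rw [← C_1, nextCoeff_C_eq_zero]
  simp [kloostermanWeight, coeff_one, h]

theorem kloostermanWeight_mul {g h : F[X]} (hg : g.Monic) (hh : h.Monic) :
    kloostermanWeight χ ψ a b (g * h) =
      kloostermanWeight χ ψ a b g * kloostermanWeight χ ψ a b h := by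
  simp only [kloostermanWeight, mul_coeff_zero, mul_coeff_one, hg.natDegree_mul hh,
    hg.nextCoeff_mul hh]
  by_cases hg0 : g.coeff 0 = 0
  · simp [hg0, MulChar.map_zero]
  by_cases hh0 : h.coeff 0 = 0
  · simp [hh0, MulChar.map_zero]
  rw [show (-1 : F) ^ (g.natDegree + h.natDegree) * (g.coeff 0 * h.coeff 0) =
    ((-1) ^ g.natDegree * g.coeff 0) * ((-1) ^ h.natDegree * h.coeff 0) by ring, map_mul]
  rw [show -(a * (g.nextCoeff + h.nextCoeff) + b * ((g.coeff 0 * h.coeff 1 +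
      g.coeff 1 * h.coeff 0) / (g.coeff 0 * h.coeff 0))) =
    -(a * g.nextCoeff + b * (g.coeff 1 / g.coeff 0)) +
      -(a * h.nextCoeff + b * (h.coeff 1 / h.coeff 0)) by field_simp; ring,
    AddChar.map_add_eq_mul]
  ring

theorem kloostermanWeight_quadratic (u v : F) :
    kloostermanWeight χ ψ a b (X ^ 2 + (C v + C u * X)) =
      χ v * ψ (u * -(a + b / v)) := by
  have h1 : (X ^ 2 + (C v + C u * X) : F[X]).natDegree = 2 := by compute_degree!
  have h2 : (X ^ 2 + (C v + C u * X) : F[X]).nextCoeff = u := by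
    rw [nextCoeff_of_natDegree_pos (by omega), h1]
    simp [coeff_X_pow, coeff_C]
  have h3 : (X ^ 2 + (C v + C u * X) : F[X]).coeff 0 = v := by simp
  have h4 : (X ^ 2 + (C v + C u * X) : F[X]).coeff 1 = u := by simp [coeff_X_pow, coeff_C]
  rw [kloostermanWeight, h1, h2, h3, h4]
  congr 2
  · ring
  · ring

theorem kloostermanWeight_minpoly_pow {K : Type*} [Field K] [Algebra F K] [FiniteDimensional F K]
    (x : K) : kloostermanWeight χ ψ a b (minpoly F x) ^
        (Module.finrank F K / (minpoly F x).natDegree) =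
      χ (Algebra.norm F x) * ψ (a * Algebra.trace F K x + b * Algebra.trace F K x⁻¹) := by
  have hx : IsIntegral F x := Algebra.IsIntegral.isIntegral x
  have hfr : ∀ y : K, Module.finrank (IntermediateField.adjoin F {y}) K =
      Module.finrank F K / (minpoly F y).natDegree := by
    intro y
    have hy : IsIntegral F y := Algebra.IsIntegral.isIntegral y
    rw [← Module.finrank_mul_finrank F (IntermediateField.adjoin F {y}) K,
      IntermediateField.adjoin.finrank hy, Nat.mul_div_cancel_left _ (minpoly.natDegree_pos hy)]
  have htr : ∀ y : K, Algebra.trace F K y =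
      (Module.finrank F K / (minpoly F y).natDegree) • -(minpoly F y).nextCoeff := by
    intro y
    have hy : IsIntegral F y := Algebra.IsIntegral.isIntegral y
    have h := PowerBasis.trace_gen_eq_nextCoeff_minpoly (IntermediateField.adjoin.powerBasis hy)
    rw [IntermediateField.adjoin.powerBasis_gen hy, IntermediateField.minpoly_gen] at h
    rw [trace_eq_trace_adjoin, h, hfr]
  have hno : Algebra.norm F x = ((-1) ^ (minpoly F x).natDegree * (minpoly F x).coeff 0) ^
      (Module.finrank F K / (minpoly F x).natDegree) := by
    have h := Algebra.PowerBasis.norm_gen_eq_coeff_zero_minpoly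
      (IntermediateField.adjoin.powerBasis hx)
    rw [IntermediateField.adjoin.powerBasis_gen hx, IntermediateField.minpoly_gen,
      IntermediateField.adjoin.powerBasis_dim] at h
    rw [Algebra.norm_eq_norm_adjoin, h, hfr]
  have hpos : 0 < Module.finrank F K / (minpoly F x).natDegree :=
    Nat.div_pos (minpoly.natDegree_le x) (minpoly.natDegree_pos hx)
  by_cases h0 : x = 0
  · subst h0
    rw [Algebra.norm_zero, MulChar.map_zero, zero_mul, kloostermanWeight, minpoly.zero]
    simp only [coeff_X_zero, mul_zero, MulChar.map_zero, zero_mul]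
    rw [minpoly.zero] at hpos
    exact zero_pow hpos.ne'
  · have hd : (minpoly F x⁻¹).natDegree = (minpoly F x).natDegree := by
      have hc : (minpoly F x).coeff 0 ≠ 0 := minpoly.coeff_zero_ne_zero hx h0
      rw [minpoly_inv hx h0, natDegree_C_mul (inv_ne_zero hc), reverse_natDegree,
        natTrailingDegree_eq_zero.2 (Or.inr hc), Nat.sub_zero]
    rw [hno, htr x, htr x⁻¹, hd, nextCoeff_minpoly_inv hx h0, kloostermanWeight, mul_pow,
      ← map_pow, ← AddChar.map_nsmul_eq_pow]
    congr 2
    simp only [nsmul_eq_mul]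
    ring

theorem card_filter_minpoly_eq [Fintype F] {K : Type*} [Field K] [Fintype K] [Algebra F K]
    {P : F[X]} (hP : Irreducible P) (hm : P.Monic) (hd : P.natDegree ∣ Module.finrank F K) :
    open Classical in (Finset.univ.filter fun x : K => minpoly F x = P).card = P.natDegree := by
  classical
  have hdvd := (hP.natDegree_dvd_iff_dvd_X_pow_card_pow_sub_X).1 hd
  have hcard : Nat.card F ^ Module.finrank F K = Nat.card K := by
    rw [← Module.natCard_eq_pow_finrank]
  have hsplit : (P.map (algebraMap F K)).Splits := by
    rw [hcard] at hdvd
    refine Splits.of_dvd (splits_X_pow_nat_card_sub_X (K := K)) ?_ ?_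
    · rw [Nat.card_eq_fintype_card]
      exact FiniteField.X_pow_card_sub_X_ne_zero K Fintype.one_lt_card
    · simpa using Polynomial.map_dvd (algebraMap F K) hdvd
  rw [← card_rootSet_eq_natDegree (PerfectField.separable_of_irreducible hP) hsplit,
    ← Set.toFinset_card]
  congr 1
  ext x
  simp only [Finset.mem_filter, Finset.mem_univ, true_and, Set.mem_toFinset, mem_rootSet]
  constructor
  · rintro rfl
    exact ⟨hm.ne_zero, minpoly.aeval F x⟩
  · rintro ⟨_, h⟩
    exact (minpoly.eq_of_irreducible_of_monic hP h hm).symm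

theorem irreduciblePowerSum_kloostermanWeight [Fintype F] {K : Type*} [Field K] [Fintype K]
    [Algebra F K] :
    irreduciblePowerSum (kloostermanWeight χ ψ a b) (Module.finrank F K) =
      ∑ x : K, χ (Algebra.norm F x) * ψ (a * Algebra.trace F K x + b * Algebra.trace F K x⁻¹) := by
  classical
  have : FiniteDimensional F K := Module.Finite.of_finite
  rw [irreduciblePowerSum, ← Finset.sum_fiberwise_of_maps_to (s := (Finset.univ : Finset K))
    (g := fun x => minpoly F x) (t := (monicIrreducibles F (Module.finrank F K)).filter
      fun P => P.natDegree ∣ Module.finrank F K)]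
  · refine Finset.sum_congr rfl fun P hP => ?_
    rw [Finset.mem_filter, mem_monicIrreducibles] at hP
    rw [Finset.sum_congr rfl (g := fun _ =>
      kloostermanWeight χ ψ a b P ^ (Module.finrank F K / P.natDegree)), Finset.sum_const,
      card_filter_minpoly_eq hP.1.2.1 hP.1.1 hP.2, nsmul_eq_mul]
    intro x hx
    rw [← kloostermanWeight_minpoly_pow, (Finset.mem_filter.1 hx).2]
  · intro x _
    have hx : IsIntegral F x := Algebra.IsIntegral.isIntegral x
    rw [Finset.mem_filter, mem_monicIrreducibles]
    exact ⟨⟨minpoly.monic hx, minpoly.irreducible hx, minpoly.natDegree_le x⟩,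
      minpoly.degree_dvd hx⟩

end Kloosterman

section KloostermanBound

theorem MulChar.norm_apply_of_ne_zero {F : Type*} [Field F] [Fintype F] (χ : MulChar F ℂ) {x : F}
    (hx : x ≠ 0) : ‖χ x‖ = 1 := by
  refine Complex.norm_eq_one_of_pow_eq_one (n := Fintype.card F - 1) ?_ ?_
  · rw [← map_pow, FiniteField.pow_card_sub_one_eq_one x hx, map_one]
  · have := Fintype.one_lt_card (α := F)
    omega

theorem MulChar.norm_apply_le_one {F : Type*} [Field F] [Fintype F] (χ : MulChar F ℂ) (x : F) :
    ‖χ x‖ ≤ 1 := by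
  by_cases hx : x = 0
  · simp [hx]
  · exact (χ.norm_apply_of_ne_zero hx).le

variable {F : Type*} [Field F] [Fintype F] (χ : MulChar F ℂ) (ψ : AddChar F ℂ) (a b : F)

theorem sum_kloostermanWeight_zero :
    ∑ g ∈ monicsOfDegree F 0, kloostermanWeight χ ψ a b g = 1 := by
  rw [sum_monicsOfDegree]
  simp [kloostermanWeight_one]

theorem norm_sum_kloostermanWeight_two (hψ : ψ ≠ 0) (ha : a ≠ 0) (hb : b ≠ 0) :
    ‖∑ g ∈ monicsOfDegree F 2, kloostermanWeight χ ψ a b g‖ = Fintype.card F := by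
  classical
  rw [sum_monicsOfDegree, ← (finTwoArrowEquiv F).symm.sum_comp, Fintype.sum_prod_type]
  have h : ∀ v u : F, kloostermanWeight χ ψ a b
      (X ^ 2 + ∑ i, C ((finTwoArrowEquiv F).symm (v, u) i) * X ^ (i : ℕ)) =
      χ v * ψ (u * -(a + b / v)) := by
    intro v u
    rw [← kloostermanWeight_quadratic]
    simp [Fin.sum_univ_two]
  have hprim : ψ.IsPrimitive := AddChar.IsPrimitive.of_ne_one hψ
  simp_rw [h, ← Finset.mul_sum, AddChar.sum_mulShift _ hprim]
  rw [Finset.sum_eq_single (-(b / a))]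
  · rw [if_pos (by field_simp; ring), norm_mul, χ.norm_apply_of_ne_zero (by simp [ha, hb]), one_mul]
    simp
  · intro v _ hv
    by_cases hv0 : v = 0
    · simp [hv0, MulChar.map_zero]
    rw [if_neg, Nat.cast_zero, mul_zero]
    intro h0
    apply hv
    field_simp at h0 ⊢
    linear_combination -h0
  · simp

theorem sum_kloostermanWeight_of_three_le (hψ : ψ ≠ 0) (ha : a ≠ 0) {k : ℕ} (hk : 3 ≤ k) :
    ∑ g ∈ monicsOfDegree F k, kloostermanWeight χ ψ a b g = 0 := by
  obtain ⟨y, hy⟩ := (AddChar.ne_zero_iff (ψ := ψ)).1 hψ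
  set t := -(y / a) with ht
  have hmem : ∀ s : F, ∀ g ∈ monicsOfDegree F k,
      g + C s * X ^ (k - 1) ∈ monicsOfDegree F k := by
    intro s g hg
    rw [mem_monicsOfDegree] at hg ⊢
    obtain ⟨h1, h2⟩ := hg
    have hlt : (C s * X ^ (k - 1)).degree < g.degree := by
      rw [degree_eq_natDegree h1.ne_zero, h2]
      refine (degree_C_mul_X_pow_le _ _).trans_lt ?_
      exact_mod_cast (by omega : k - 1 < k)
    exact ⟨h1.add_of_left hlt, by rw [natDegree_add_eq_left_of_degree_lt hlt, h2]⟩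
  have hval : ∀ g ∈ monicsOfDegree F k, kloostermanWeight χ ψ a b (g + C t * X ^ (k - 1)) =
      ψ y * kloostermanWeight χ ψ a b g := by
    intro g hg
    have h3 := (mem_monicsOfDegree.1 (hmem t g hg)).2
    have h2 := (mem_monicsOfDegree.1 hg).2
    simp only [kloostermanWeight]
    rw [nextCoeff_of_natDegree_pos (by omega), nextCoeff_of_natDegree_pos (by omega), h3, h2]
    simp only [coeff_add, coeff_C_mul, coeff_X_pow]
    rw [if_neg (by omega : ¬(0 = k - 1)), if_neg (by omega : ¬(1 = k - 1)), if_pos trivial]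
    rw [mul_left_comm, ← AddChar.map_add_eq_mul]
    congr 2
    · ring
    · have : a * t = -y := by rw [ht]; field_simp
      rw [mul_add, mul_one, this]; ring
  have hinv : ∑ g ∈ monicsOfDegree F k, kloostermanWeight χ ψ a b (g + C t * X ^ (k - 1)) =
      ∑ g ∈ monicsOfDegree F k, kloostermanWeight χ ψ a b g := by
    refine Finset.sum_bij' (fun g _ => g + C t * X ^ (k - 1)) (fun g _ => g + C (-t) * X ^ (k - 1))
      (hmem t) (hmem (-t)) ?_ ?_ fun _ _ => rfl
    · intro g _
      simp
    · intro g _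
      simp
  rw [Finset.sum_congr rfl hval, ← Finset.mul_sum] at hinv
  by_contra h0
  exact hy (mul_right_cancel₀ h0 (hinv.trans (one_mul _).symm))

theorem trace_pow_char {F K : Type*} [Field F] [Field K] [Finite K] [Algebra F K] {p : ℕ} [Fact p.Prime]
    [CharP K p] (x : K) : Algebra.trace F K (x ^ p) = Algebra.trace F K x ^ p := by
  apply (algebraMap F K).injective
  rw [map_pow (algebraMap F K), FiniteField.algebraMap_trace_eq_sum_pow, FiniteField.algebraMap_trace_eq_sum_pow,
    sum_pow_char]
  exact Finset.sum_congr rfl fun i _ => pow_right_comm _ _ _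

/-- A bound, weak by a constant factor, for twisted Kloosterman sums over extensions. -/
theorem norm_sum_extension_le (hψ : ψ ≠ 0) (ha : a ≠ 0) {p : ℕ} [Fact p.Prime] [CharP F p]
    (hfrob : ∀ y, ψ (y ^ p) = ψ y) {K : Type*} [Field K] [Fintype K] [Algebra F K] {t : ℕ}
    (hK : Fintype.card K = p ^ t * p ^ t)
    (ht : ((Fintype.card F - 1) * (p + 1) * p + 3) ^ 2 ≤ p ^ t) :
    ‖∑ x : K, χ (Algebra.norm F x) * ψ (a * Algebra.trace F K x + b * Algebra.trace F K x⁻¹)‖ ≤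
      (2 * ((Fintype.card F - 1 : ℕ) * (p + 1) * p) + 5) * p ^ t := by
  classical
  have hp : p.Prime := Fact.out
  have : FiniteDimensional F K := Module.Finite.of_finite
  have : CharP K p := charP_of_injective_algebraMap (algebraMap F K).injective p
  set d := Fintype.card F - 1 with hd
  obtain ⟨e, -, he⟩ := FiniteField.card F p
  have hpd : p.Coprime d := by
    have h1 : p ∣ Fintype.card F := by rw [he]; exact dvd_pow_self p e.ne_zero
    rw [hp.coprime_iff_not_dvd]
    intro h2
    have h3 : Fintype.card F = d + 1 := by have := Fintype.one_lt_card (α := F); omega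
    rw [h3, Nat.dvd_add_right h2] at h1
    exact hp.one_lt.ne' (Nat.dvd_one.1 h1)
  let Ψ : AddChar K ℂ := ψ.compAddMonoidHom (Algebra.trace F K).toAddMonoidHom
  have hΨa : ∀ y, Ψ y = ψ (Algebra.trace F K y) := fun _ => rfl
  have hΨ : Ψ ≠ 0 := by
    obtain ⟨y, hy⟩ := (AddChar.ne_zero_iff (ψ := ψ)).1 hψ
    obtain ⟨z, rfl⟩ := Algebra.trace_surjective F K y
    exact AddChar.ne_zero_iff.2 ⟨z, hy⟩
  have hΨf : ∀ y, Ψ (y ^ p) = Ψ y := fun y => by rw [hΨa, trace_pow_char, hfrob, hΨa]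
  set A := algebraMap F K a with hA
  set B := algebraMap F K b with hB
  have hA0 : A ≠ 0 := by rw [hA]; simpa using ha
  let T : Kˣ → ℂ := fun y => χ (Algebra.norm F (y : K)) * Ψ (A * y + B * ((y⁻¹ : Kˣ) : K))
  have hS : ∑ x : K, χ (Algebra.norm F x) *
      ψ (a * Algebra.trace F K x + b * Algebra.trace F K x⁻¹) = ∑ y : Kˣ, T y := by
    have h1 : ∀ x : K, a * Algebra.trace F K x + b * Algebra.trace F K x⁻¹ =
        Algebra.trace F K (A * x + B * x⁻¹) := by
      intro x
      rw [map_add, ← Algebra.smul_def, ← Algebra.smul_def, map_smul, map_smul, smul_eq_mul,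
        smul_eq_mul]
    rw [← Finset.sum_erase (s := Finset.univ) (a := (0 : K))]
    · symm
      refine Finset.sum_bij (fun y _ => (y : K)) ?_ ?_ ?_ ?_
      · intro y _; simp
      · intro y _ z _ h; exact Units.ext h
      · intro x hx
        exact ⟨Units.mk0 x (by simpa using hx), Finset.mem_univ _, rfl⟩
      · intro y _
        simp only [T, hΨa, h1, Units.val_inv_eq_inv_val]
    · rw [Algebra.norm_zero, MulChar.map_zero, zero_mul]
  rw [hS]
  have hshift : ∀ x : Kˣ, ∑ y : Kˣ, T y =
      ∑ y : Kˣ, χ (Algebra.norm F (y : K)) *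
        Ψ ((A * y) * (x : K) ^ d + (B * ((y⁻¹ : Kˣ) : K)) * ((x⁻¹ : Kˣ) : K) ^ d) := by
    intro x
    rw [← Equiv.sum_comp (Equiv.mulRight (x ^ d)) T]
    refine Finset.sum_congr rfl fun y _ => ?_
    simp only [T, Equiv.coe_mulRight, mul_inv_rev, Units.val_mul, Units.val_pow_eq_pow_val,
      map_mul, map_pow]
    have hn : Algebra.norm F (x : K) ^ d = 1 :=
      FiniteField.pow_card_sub_one_eq_one _ (by simp [Algebra.norm_eq_zero_iff])
    rw [← map_pow, hn, map_one, mul_one]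
    congr 2
    rw [← inv_pow, Units.val_pow_eq_pow_val]
    ring
  have havg : (Fintype.card Kˣ : ℂ) * ∑ y : Kˣ, T y =
      ∑ y : Kˣ, χ (Algebra.norm F (y : K)) *
        ∑ x : Kˣ, Ψ ((A * y) * (x : K) ^ d + (B * ((y⁻¹ : Kˣ) : K)) * ((x⁻¹ : Kˣ) : K) ^ d) := by
    simp_rw [Finset.mul_sum]
    rw [Finset.sum_comm, ← Finset.sum_congr rfl fun x _ => hshift x, Finset.sum_const,
      Finset.card_univ, nsmul_eq_mul, Finset.mul_sum]
  have hpt : (1 : ℝ) ≤ (p : ℝ) ^ t := one_le_pow₀ (by exact_mod_cast hp.one_lt.le)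
  have hbound : ∀ y : Kˣ, ‖χ (Algebra.norm F (y : K)) *
        ∑ x : Kˣ, Ψ ((A * y) * (x : K) ^ d + (B * ((y⁻¹ : Kˣ) : K)) * ((x⁻¹ : Kˣ) : K) ^ d)‖ ≤
      (2 * (d * (p + 1) * p) + 5) * p ^ t := by
    intro y
    rw [norm_mul]
    refine (mul_le_of_le_one_left (norm_nonneg _) (χ.norm_apply_le_one _)).trans ?_
    refine (norm_sum_addChar_le hp hK hpd ht (mul_ne_zero hA0 y.ne_zero) _ Ψ hΨ hΨf).trans ?_
    linarith
  have hcard : (0 : ℝ) < Fintype.card Kˣ := by exact_mod_cast Fintype.card_pos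
  have hfin : (Fintype.card Kˣ : ℝ) * ‖∑ y : Kˣ, T y‖ ≤
      Fintype.card Kˣ * ((2 * (d * (p + 1) * p) + 5) * p ^ t) := by
    have h2 := (norm_sum_le _ _).trans
      (Finset.sum_le_sum fun y (_ : y ∈ Finset.univ) => hbound y)
    rwa [← havg, norm_mul, Complex.norm_natCast, Finset.sum_const, Finset.card_univ,
      nsmul_eq_mul] at h2
  exact le_of_mul_le_mul_left hfin hcard

/-- If the even power sums of `α` and `β` are `O(c ^ j)`, then `‖α‖ ^ 2 ≤ c`. -/
theorem norm_sq_le_of_powerSum_le {α β : ℂ} {c B : ℝ} (hc : 0 < c) (hαβ : ‖α * β‖ = c) {j₀ : ℕ}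
    (h : ∀ j ≥ j₀, ‖α ^ (2 * j) + β ^ (2 * j)‖ ≤ B * c ^ j) : ‖α‖ ^ 2 ≤ c := by
  by_contra! hlt
  have hβ : ‖β‖ ^ 2 ≤ c := by
    have h1 : ‖α‖ ^ 2 * ‖β‖ ^ 2 = c * c := by rw [← mul_pow, ← norm_mul, hαβ, sq]
    by_contra! h2
    nlinarith
  have hone : 1 < ‖α‖ ^ 2 / c := by rwa [one_lt_div hc]
  obtain ⟨j₁, hj₁⟩ := pow_unbounded_of_one_lt (B + 1) hone
  set j := max j₀ j₁
  have h3 : B + 1 < (‖α‖ ^ 2 / c) ^ j :=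
    hj₁.trans_le (pow_le_pow_right₀ hone.le (le_max_right _ _))
  rw [div_pow, lt_div_iff₀ (by positivity)] at h3
  have h4 := h j (le_max_left _ _)
  have h5 : ‖α ^ (2 * j)‖ ≤ ‖α ^ (2 * j) + β ^ (2 * j)‖ + ‖β ^ (2 * j)‖ := by
    simpa using norm_sub_le (α ^ (2 * j) + β ^ (2 * j)) (β ^ (2 * j))
  have h6 : ‖β ^ (2 * j)‖ ≤ c ^ j := by
    rw [norm_pow, pow_mul]
    exact pow_le_pow_left₀ (by positivity) hβ j
  rw [norm_pow, pow_mul] at h5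
  linarith

/-- The Weil bound for twisted Kloosterman sums. -/
theorem norm_kloosterman_le (hψ : ψ ≠ 0) (ha : a ≠ 0) (hb : b ≠ 0) {p : ℕ} [Fact p.Prime]
    [CharP F p] (hfrob : ∀ y, ψ (y ^ p) = ψ y) :
    ‖∑ x : F, χ x * ψ (a * x + b * x⁻¹)‖ ≤ 2 * √(Fintype.card F) := by
  classical
  have hp : p.Prime := Fact.out
  set Λ := kloostermanWeight χ ψ a b with hΛ
  set L : ℕ → ℂ := fun k => ∑ g ∈ monicsOfDegree F k, Λ g with hL
  set s := irreduciblePowerSum Λ with hs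
  have hnewton : ∀ k : ℕ, (k : ℂ) * L k = ∑ j ∈ Finset.Icc 1 k, s j * L (k - j) :=
    newton_identity Λ (kloostermanWeight_one χ ψ a b)
      fun g h hg hh => kloostermanWeight_mul χ ψ a b hg hh
  have hL0 : L 0 = 1 := sum_kloostermanWeight_zero χ ψ a b
  have hL2 : ‖L 2‖ = Fintype.card F := norm_sum_kloostermanWeight_two χ ψ a b hψ ha hb
  have hL3 : ∀ k, 3 ≤ k → L k = 0 := fun k hk =>
    sum_kloostermanWeight_of_three_le χ ψ a b hψ ha hk
  have hs1 : s 1 = L 1 := by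
    have := hnewton 1
    simpa [hL0] using this.symm
  have hS : ∑ x : F, χ x * ψ (a * x + b * x⁻¹) = L 1 := by
    rw [← hs1, hs, ← Module.finrank_self F, irreduciblePowerSum_kloostermanWeight]
    simp
  have hs2 : s 2 = 2 * L 2 - L 1 * L 1 := by
    have := hnewton 2
    rw [Finset.sum_Icc_succ_top (by norm_num)] at this
    simp [hL0, hs1] at this
    linear_combination -this
  have hrec : ∀ k, s (k + 3) = -(L 1 * s (k + 2)) - L 2 * s (k + 1) := by
    intro k
    have := hnewton (k + 3)
    rw [hL3 _ (by omega), mul_zero, Finset.sum_Icc_succ_top (by omega),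
      Finset.sum_Icc_succ_top (by omega), Finset.sum_Icc_succ_top (by omega),
      Finset.sum_eq_zero] at this
    · rw [show k + 3 - (k + 1) = 2 by omega, show k + 3 - (k + 1 + 1) = 1 by omega,
        show k + 3 - (k + 1 + 1 + 1) = 0 by omega, hL0] at this
      linear_combination -this
    · intro j hj
      rw [Finset.mem_Icc] at hj
      rw [hL3 _ (by omega), mul_zero]
  obtain ⟨w, hw⟩ := IsAlgClosed.exists_pow_nat_eq (L 1 ^ 2 - 4 * L 2) (n := 2) (by norm_num)
  set α := (-L 1 + w) / 2 with hα
  set β := (-L 1 - w) / 2 with hβ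
  have hadd : α + β = -L 1 := by rw [hα, hβ]; ring
  have hmul : α * β = L 2 := by rw [hα, hβ]; linear_combination -hw / 4
  have hpow : ∀ k, s (k + 1) = -(α ^ (k + 1) + β ^ (k + 1)) ∧
      s (k + 2) = -(α ^ (k + 2) + β ^ (k + 2)) := by
    intro k
    have e1 : L 1 = -(α + β) := by rw [hadd, neg_neg]
    induction k with
    | zero =>
      refine ⟨?_, ?_⟩
      · rw [hs1, e1]; ring
      · rw [hs2, e1, ← hmul]; ring
    | succ k ih =>
      refine ⟨ih.2, ?_⟩
      rw [show k + 1 + 2 = k + 3 by ring, hrec, ih.1, ih.2, e1, ← hmul]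
      ring
  obtain ⟨e, -, he⟩ := FiniteField.card F p
  have hQ1 := Fintype.one_lt_card (α := F)
  obtain ⟨j₀, hj₀⟩ := pow_unbounded_of_one_lt
    (((Fintype.card F - 1) * (p + 1) * p + 3) ^ 2) hQ1
  have hbound : ∀ j ≥ j₀ + 1, ‖α ^ (2 * j) + β ^ (2 * j)‖ ≤
      (2 * ((Fintype.card F - 1 : ℕ) * (p + 1) * p) + 5) * (Fintype.card F : ℝ) ^ j := by
    intro j hj
    have : NeZero (2 * j) := ⟨by omega⟩
    have : Finite (FiniteField.Extension F p (2 * j)) := Module.finite_of_finite F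
    let _ : Fintype (FiniteField.Extension F p (2 * j)) := Fintype.ofFinite _
    have hcK : Fintype.card (FiniteField.Extension F p (2 * j)) =
        p ^ (e * j) * p ^ (e * j) := by
      rw [← Nat.card_eq_fintype_card, FiniteField.natCard_extension, Nat.card_eq_fintype_card,
        he]
      ring
    have ht : ((Fintype.card F - 1) * (p + 1) * p + 3) ^ 2 ≤ p ^ (e * j) := by
      rw [pow_mul, ← he]
      exact hj₀.le.trans (Nat.pow_le_pow_right hQ1.le (by omega))
    have h1 := norm_sum_extension_le χ ψ a b hψ ha hfrob hcK ht
    rw [← irreduciblePowerSum_kloostermanWeight, FiniteField.finrank_extension] at h1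
    have h2 : irreduciblePowerSum (kloostermanWeight χ ψ a b) (2 * j) =
        -(α ^ (2 * j) + β ^ (2 * j)) := by
      have := (hpow (2 * j - 1)).1
      rwa [Nat.sub_add_cancel (by omega)] at this
    rw [h2, norm_neg] at h1
    refine h1.trans (le_of_eq ?_)
    rw [he, pow_mul]
    push_cast
    rfl
  have hQ0 : (0 : ℝ) < Fintype.card F := by exact_mod_cast Fintype.card_pos
  have hα2 := norm_sq_le_of_powerSum_le hQ0 (hmul ▸ hL2) hbound
  have hβ2 := norm_sq_le_of_powerSum_le (α := β) (β := α) hQ0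
    (by rw [mul_comm, hmul, hL2]) (j₀ := j₀ + 1) fun j hj => by
      rw [add_comm]; exact hbound j hj
  rw [hS, ← norm_neg, ← hadd]
  refine (norm_add_le _ _).trans ?_
  have := Real.le_sqrt_of_sq_le hα2
  have := Real.le_sqrt_of_sq_le hβ2
  linarith

end KloostermanBound

section CharacterSums

variable {F : Type*} [Field F] [Fintype F]

theorem norm_gaussSum {χ : MulChar F ℂ} (hχ : χ ≠ 1) {ψ : AddChar F ℂ} (hψ : ψ ≠ 0) :
    ‖gaussSum χ ψ‖ = √(Fintype.card F) := by
  have h := gaussSum_mul_gaussSum_eq_card hχ (AddChar.IsPrimitive.of_ne_one hψ)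
  have hconj : gaussSum χ⁻¹ ψ⁻¹ = (starRingEnd ℂ) (gaussSum χ ψ) := by
    simp only [gaussSum, map_sum, map_mul]
    refine Finset.sum_congr rfl fun x _ => ?_
    congr 1
    · rw [MulChar.inv_apply_eq_inv']
      by_cases hx : x = 0
      · rw [hx, MulChar.map_zero]
        simp
      · rw [Complex.inv_def, Complex.normSq_eq_norm_sq, χ.norm_apply_of_ne_zero hx]
        simp
    · rw [AddChar.inv_apply', AddChar.inv_apply_eq_conj]
  rw [hconj, Complex.mul_conj, Complex.normSq_eq_norm_sq] at h
  rw [← Real.sqrt_sq (norm_nonneg (gaussSum χ ψ))]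
  congr 1
  exact_mod_cast h

theorem norm_sum_mulChar_addChar_le (χ : MulChar F ℂ) {ψ : AddChar F ℂ} (hψ : ψ ≠ 0) :
    ‖∑ x : F, χ x * ψ x‖ ≤ √(Fintype.card F) := by
  classical
  by_cases hχ : χ = 1
  · subst hχ
    have h1 : ∑ x : F, (1 : MulChar F ℂ) x * ψ x = -1 := by
      have h2 : ∑ x : F, ψ x = 0 := AddChar.sum_eq_zero_iff_ne_zero.2 hψ
      rw [← Finset.add_sum_erase _ _ (Finset.mem_univ (0 : F)), AddChar.map_zero_eq_one] at h2
      rw [← Finset.add_sum_erase _ _ (Finset.mem_univ (0 : F)), MulChar.map_zero, zero_mul,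
        zero_add, Finset.sum_congr rfl fun x hx => by
          rw [MulChar.one_apply (Finset.ne_of_mem_erase hx).isUnit, one_mul]]
      linear_combination h2
    rw [h1, norm_neg, norm_one, Real.one_le_sqrt]
    exact_mod_cast Fintype.card_pos (α := F)
  · exact (norm_gaussSum hχ hψ).le

theorem exists_frobenius_invariant_addChar (F : Type*) [Field F] [Fintype F] {p : ℕ}
    [Fact p.Prime] [CharP F p] : ∃ ψ : AddChar F ℂ, ψ ≠ 0 ∧ ∀ y, ψ (y ^ p) = ψ y := by
  let _ : Algebra (ZMod p) F := ZMod.algebra F p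
  have : FiniteDimensional (ZMod p) F := Module.Finite.of_finite
  obtain ⟨ψ, hψ⟩ := (AddChar.exists_apply_ne_zero (a := (1 : ZMod p))).2 one_ne_zero
  refine ⟨ψ.compAddMonoidHom (Algebra.trace (ZMod p) F).toAddMonoidHom, ?_, ?_⟩
  · obtain ⟨z, hz⟩ := Algebra.trace_surjective (ZMod p) F 1
    refine AddChar.ne_zero_iff.2 ⟨z, ?_⟩
    change ψ (Algebra.trace (ZMod p) F z) ≠ 1
    rwa [hz]
  · intro y
    change ψ (Algebra.trace (ZMod p) F (y ^ p)) = ψ (Algebra.trace (ZMod p) F y)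
    rw [trace_pow_char, ZMod.pow_card]

theorem exists_eq_mulShift {ψ : AddChar F ℂ} (hψ : ψ ≠ 0) (φ : AddChar F ℂ) :
    ∃ a, ψ.mulShift a = φ := by
  have hinj := AddChar.to_mulShift_inj_of_isPrimitive (AddChar.IsPrimitive.of_ne_one hψ)
  exact ((Fintype.bijective_iff_injective_and_card _).2 ⟨hinj, AddChar.card_eq.symm⟩).2 φ

theorem norm_sum_mulChar_addChar_addChar_le (χ : MulChar F ℂ) (φ₁ φ₂ : AddChar F ℂ)
    (h : ¬(χ = 1 ∧ φ₁ = 0 ∧ φ₂ = 0)) :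
    ‖∑ x : F, χ x * (φ₁ x * φ₂ x⁻¹)‖ ≤ 2 * √(Fintype.card F) := by
  have hs : 0 ≤ √(Fintype.card F : ℝ) := Real.sqrt_nonneg _
  by_cases h1 : φ₁ = 0
  · by_cases h2 : φ₂ = 0
    · have hχ : χ ≠ 1 := fun h0 => h ⟨h0, h1, h2⟩
      simp only [h1, h2, AddChar.zero_apply, mul_one, MulChar.sum_eq_zero_of_ne_one hχ, norm_zero]
      positivity
    · have h3 : ∑ x : F, χ x * (φ₁ x * φ₂ x⁻¹) = ∑ x : F, χ⁻¹ x * φ₂ x := by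
        rw [← Equiv.sum_comp (Equiv.inv F)]
        refine Finset.sum_congr rfl fun x _ => ?_
        rw [h1, AddChar.zero_apply, one_mul, Equiv.inv_apply, inv_inv, MulChar.inv_apply']
      rw [h3]
      exact (norm_sum_mulChar_addChar_le _ h2).trans (by linarith)
  · by_cases h2 : φ₂ = 0
    · simp only [h2, AddChar.zero_apply, mul_one]
      exact (norm_sum_mulChar_addChar_le _ h1).trans (by linarith)
    · obtain ⟨p, hchar⟩ := CharP.exists F
      have : Fact p.Prime := ⟨CharP.char_is_prime F p⟩
      obtain ⟨ψ, hψ, hfrob⟩ := exists_frobenius_invariant_addChar F (p := p)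
      obtain ⟨a, rfl⟩ := exists_eq_mulShift hψ φ₁
      obtain ⟨b, rfl⟩ := exists_eq_mulShift hψ φ₂
      have ha : a ≠ 0 := by
        rintro rfl
        exact h1 (AddChar.mulShift_zero ψ)
      have hb : b ≠ 0 := by
        rintro rfl
        exact h2 (AddChar.mulShift_zero ψ)
      simp only [AddChar.mulShift_apply, ← AddChar.map_add_eq_mul]
      exact norm_kloosterman_le χ ψ a b hψ ha hb hfrob

variable {A : Type*} [AddCommGroup A]

/-- The multiplicative character of `F` attached to a character of a quotient of `Fˣ`. -/
def quotientMulChar (f : Fˣ →* Multiplicative A) (φ : AddChar A ℂ) : MulChar F ℂ :=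
  MulChar.ofUnitHom (MonoidHom.toHomUnits
    { toFun := fun x : Fˣ => φ (f x).toAdd
      map_one' := by rw [map_one, toAdd_one, φ.map_zero_eq_one]
      map_mul' := fun x y => by rw [map_mul, toAdd_mul, φ.map_add_eq_mul] })

theorem quotientMulChar_apply {F A : Type*} [Field F] [AddCommGroup A] (f : Fˣ →* Multiplicative A) (φ : AddChar A ℂ) (x : Fˣ) :
    quotientMulChar f φ x = φ (f x).toAdd := by
  simp only [quotientMulChar, MulChar.ofUnitHom_coe, MonoidHom.coe_toHomUnits]
  rfl

theorem quotientMulChar_eq_one {F A : Type*} [Field F] [AddCommGroup A] {f : Fˣ →* Multiplicative A} (hf : Function.Surjective f)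
    {φ : AddChar A ℂ} (h : quotientMulChar f φ = 1) : φ = 0 := by
  ext y
  obtain ⟨x, hx⟩ := hf (Multiplicative.ofAdd y)
  have h1 := quotientMulChar_apply f φ x
  rw [h, MulChar.one_apply_coe, hx] at h1
  exact h1.symm

theorem addChar_comp_mk_eq_zero {G : Type*} [AddCommGroup G] {V : AddSubgroup G}
    {φ : AddChar (G ⧸ V) ℂ} (h : φ.compAddMonoidHom (QuotientAddGroup.mk' V) = 0) : φ = 0 := by
  ext y
  obtain ⟨x, rfl⟩ := QuotientAddGroup.mk_surjective y
  exact DFunLike.congr_fun h x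

/-- Triples of characters of `Fˣ ⧸ H`, `F ⧸ V₁` and `F ⧸ V₂`. -/
abbrev QuotientChars (A : Type*) [AddCommGroup A] (V₁ V₂ : AddSubgroup F) : Type _ :=
  AddChar A ℂ × AddChar (F ⧸ V₁) ℂ × AddChar (F ⧸ V₂) ℂ

open Classical in
theorem norm_sum_quotient_chars_le {f : Fˣ →* Multiplicative A} (hf : Function.Surjective f)
    {V₁ V₂ : AddSubgroup F} (φ : QuotientChars A V₁ V₂) (hφ : φ ≠ 0) :
    ‖∑ x : Fˣ, φ.1 (f x).toAdd *
      (φ.2.1 (QuotientAddGroup.mk (x : F)) * φ.2.2 (QuotientAddGroup.mk ((x⁻¹ : Fˣ) : F)))‖ ≤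
      2 * √(Fintype.card F) := by
  have h1 : ∑ x : Fˣ, φ.1 (f x).toAdd *
      (φ.2.1 (QuotientAddGroup.mk (x : F)) * φ.2.2 (QuotientAddGroup.mk ((x⁻¹ : Fˣ) : F))) =
      ∑ x : F, quotientMulChar f φ.1 x * (φ.2.1.compAddMonoidHom (QuotientAddGroup.mk' V₁) x *
        φ.2.2.compAddMonoidHom (QuotientAddGroup.mk' V₂) x⁻¹) := by
    refine Fintype.sum_of_injective Units.val Units.val_injective _ _ ?_ ?_
    · intro x hx
      rw [MulChar.map_nonunit _ fun hu => hx ⟨hu.unit, rfl⟩, zero_mul]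
    · intro x
      rw [quotientMulChar_apply, Units.val_inv_eq_inv_val]
      rfl
  rw [h1]
  refine norm_sum_mulChar_addChar_addChar_le _ _ _ fun h => hφ ?_
  exact Prod.ext (quotientMulChar_eq_one hf h.1) (Prod.ext (addChar_comp_mk_eq_zero h.2.1)
    (addChar_comp_mk_eq_zero h.2.2))

open Classical in
/-- The number of `x` in a subgroup of `Fˣ` such that `x` and `x⁻¹` lie in given additive
subgroups of `F`. -/
theorem abs_card_sub_le_of_surjective [Fintype A] {f : Fˣ →* Multiplicative A}
    (hf : Function.Surjective f) (V₁ V₂ : AddSubgroup F) :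
    |((Finset.univ.filter fun x : Fˣ => f x = 1 ∧ (x : F) ∈ V₁ ∧ ((x⁻¹ : Fˣ) : F) ∈ V₂).card : ℝ) -
      ((Fintype.card F : ℝ) - 1) / (Fintype.card A * (V₁.index * V₂.index))| ≤ 2 * √(Fintype.card F) := by
  set N : ℝ := Fintype.card A * (V₁.index * V₂.index) with hN
  set c := (Finset.univ.filter fun x : Fˣ =>
    f x = 1 ∧ (x : F) ∈ V₁ ∧ ((x⁻¹ : Fˣ) : F) ∈ V₂).card with hc
  let t : QuotientChars A V₁ V₂ → ℂ := fun φ => ∑ x : Fˣ, φ.1 (f x).toAdd *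
      (φ.2.1 (QuotientAddGroup.mk (x : F)) * φ.2.2 (QuotientAddGroup.mk ((x⁻¹ : Fˣ) : F)))
  have hI : (Fintype.card (QuotientChars A V₁ V₂) : ℝ) = N := by
    rw [hN, Fintype.card_prod, Fintype.card_prod, AddChar.card_eq, AddChar.card_eq,
      AddChar.card_eq, AddSubgroup.index_eq_card,
      AddSubgroup.index_eq_card, Nat.card_eq_fintype_card,
      Nat.card_eq_fintype_card]
    push_cast
    rfl
  have hNpos : 0 < N := by
    rw [← hI]
    exact_mod_cast Fintype.card_pos (α := QuotientChars A V₁ V₂)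
  have hsum : ∑ φ : QuotientChars A V₁ V₂, t φ = (c * N : ℝ) := by
    rw [Finset.sum_comm]
    have hx : ∀ x : Fˣ, ∑ φ : QuotientChars A V₁ V₂, φ.1 (f x).toAdd *
        (φ.2.1 (QuotientAddGroup.mk (x : F)) * φ.2.2 (QuotientAddGroup.mk ((x⁻¹ : Fˣ) : F))) =
        if f x = 1 ∧ (x : F) ∈ V₁ ∧ ((x⁻¹ : Fˣ) : F) ∈ V₂ then (N : ℂ) else 0 := by
      intro x
      rw [Fintype.sum_prod_type]
      simp_rw [Fintype.sum_prod_type, ← Finset.mul_sum, ← Finset.sum_mul]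
      rw [AddChar.sum_apply_eq_ite, AddChar.sum_apply_eq_ite, AddChar.sum_apply_eq_ite, hN,
        AddSubgroup.index_eq_card, AddSubgroup.index_eq_card, Nat.card_eq_fintype_card,
        Nat.card_eq_fintype_card]
      simp only [QuotientAddGroup.eq_zero_iff, toAdd_eq_zero]
      split_ifs <;> first | tauto | (push_cast; ring1)
    rw [Finset.sum_congr rfl fun x _ => hx x, ← Finset.sum_filter, Finset.sum_const, ← hc]
    simp
  have hzero : t 0 = ((Fintype.card F : ℝ) - 1 : ℝ) := by
    have : t 0 = (Fintype.card Fˣ : ℂ) := by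
      simp [t]
    rw [this, Fintype.card_units, Nat.cast_sub Fintype.card_pos]
    simp
  have hmain : |(c : ℝ) * N - ((Fintype.card F : ℝ) - 1)| ≤ N * (2 * √(Fintype.card F)) := by
    rw [← Finset.add_sum_erase _ _ (Finset.mem_univ (0 : QuotientChars A V₁ V₂)), hzero] at hsum
    have h1 : (((c : ℝ) * N - ((Fintype.card F : ℝ) - 1) : ℝ) : ℂ) =
        ∑ φ ∈ Finset.univ.erase (0 : QuotientChars A V₁ V₂), t φ := by
      rw [Complex.ofReal_sub, ← hsum]
      ring
    rw [← Real.norm_eq_abs, ← Complex.norm_real, h1]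
    refine (norm_sum_le_of_le _ fun φ hφ =>
      norm_sum_quotient_chars_le hf φ (Finset.ne_of_mem_erase hφ)).trans ?_
    rw [Finset.sum_const, nsmul_eq_mul, ← hI]
    gcongr
    exact Finset.card_le_univ _
  have h2 : (c : ℝ) - ((Fintype.card F : ℝ) - 1) / N =
      ((c : ℝ) * N - ((Fintype.card F : ℝ) - 1)) / N := by
    field_simp
  rw [h2, abs_div, abs_of_pos hNpos, div_le_iff₀ hNpos]
  linarith

open Classical in
/-- The number of `x` in a subgroup of `Fˣ` such that `x` and `x⁻¹` lie in given additive
subgroups of `F`. -/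
theorem abs_card_sub_le (H : Subgroup Fˣ) (V₁ V₂ : AddSubgroup F) :
    |((Finset.univ.filter fun x : Fˣ => x ∈ H ∧ (x : F) ∈ V₁ ∧ ((x⁻¹ : Fˣ) : F) ∈ V₂).card : ℝ) -
      ((Fintype.card F : ℝ) - 1) / (H.index * (V₁.index * V₂.index))| ≤ 2 * √(Fintype.card F) := by
  convert abs_card_sub_le_of_surjective (A := Additive (Fˣ ⧸ H))
    (f := QuotientGroup.mk' H) (QuotientGroup.mk'_surjective H) V₁ V₂ using 6
  · exact (and_congr_left' (QuotientGroup.eq_one_iff _)).symm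
  · rw [Subgroup.index_eq_card, Nat.card_eq_fintype_card]
    exact Fintype.card_congr Additive.ofMul

end CharacterSums

section TracePoly

variable {Fq : Type*} [Field Fq]

variable (Fq) in
/-- The polynomial `1 + X + ⋯ + X ^ (n - 1)`. -/
def tracePoly (n : ℕ) : Fq[X] := ∑ i ∈ Finset.range n, X ^ i

theorem tracePoly_mul (n : ℕ) : tracePoly Fq n * (X - 1) = X ^ n - 1 := geom_sum_mul X n

theorem tracePoly_dvd (n : ℕ) : tracePoly Fq n ∣ X ^ n - 1 := ⟨_, (tracePoly_mul n).symm⟩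

theorem tracePoly_monic {n : ℕ} (hn : n ≠ 0) : (tracePoly Fq n).Monic := by
  refine Monic.of_mul_monic_right (q := X - 1) ?_ ?_
  · exact monic_X_sub_C 1
  · rw [tracePoly_mul]
    exact monic_X_pow_sub_C 1 hn

theorem natDegree_tracePoly {n : ℕ} (hn : n ≠ 0) : (tracePoly Fq n).natDegree = n - 1 := by
  have h := congrArg natDegree (tracePoly_mul (Fq := Fq) n)
  have hX : (X - 1 : Fq[X]).Monic := monic_X_sub_C 1
  rw [(tracePoly_monic hn).natDegree_mul hX] at h
  have h1 : (X - 1 : Fq[X]).natDegree = 1 := natDegree_X_sub_C 1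
  have h2 : (X ^ n - 1 : Fq[X]).natDegree = n := natDegree_X_pow_sub_C (r := (1 : Fq))
  omega

end TracePoly

section FrobeniusAction

variable {Fq F : Type*} [Field Fq] [Fintype Fq] [Field F] [Algebra Fq F]

variable (Fq F) in
/-- The Frobenius of `F` over `Fq`, as a linear map. -/
def frobLin : F →ₗ[Fq] F := (FiniteField.frobeniusAlgHom Fq F).toLinearMap

theorem frobLin_pow_apply (i : ℕ) (β : F) :
    (frobLin Fq F ^ i) β = β ^ Fintype.card Fq ^ i := by
  induction i with
  | zero => simp
  | succ i ih =>
    rw [pow_succ', Module.End.mul_apply, ih, pow_succ, pow_mul]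
    rfl

theorem polyAct_eq_aeval (h : Fq[X]) (β : F) :
    polyAct (Fintype.card Fq) h β = aeval (frobLin Fq F) h β := by
  rw [polyAct, aeval_eq_sum_range, sum_over_range _ (by simp), LinearMap.sum_apply]
  refine Finset.sum_congr rfl fun i _ => ?_
  rw [LinearMap.smul_apply, frobLin_pow_apply, Algebra.smul_def]

variable (F) in
/-- The kernel of the action of `g` on `F`. -/
def actKer (g : Fq[X]) : Submodule Fq F := LinearMap.ker (aeval (frobLin Fq F) g)

theorem mem_actKer {g : Fq[X]} {β : F} : β ∈ actKer F g ↔ aeval (frobLin Fq F) g β = 0 :=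
  LinearMap.mem_ker

theorem actKer_mono {g h : Fq[X]} (hgh : g ∣ h) : actKer F g ≤ actKer F h := by
  obtain ⟨k, rfl⟩ := hgh
  intro β hβ
  rw [mem_actKer] at hβ ⊢
  rw [mul_comm, map_mul, Module.End.mul_apply, hβ, map_zero]

/-- An element of trace zero which is killed by no `(X ^ n - 1) / ((X - 1) P)`, `P` irreducible,
is `1`-normal. -/
theorem isKNormal_one {α : F} {n : ℕ} (hn : n ≠ 0) (h0 : α ∈ actKer F (tracePoly Fq n))
    (h : ∀ P g : Fq[X], Irreducible P → P.Monic → tracePoly Fq n = P * g → α ∉ actKer F g) :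
    IsKNormal Fq (Fintype.card Fq) n 1 α := by
  refine ⟨tracePoly Fq n, ⟨tracePoly_monic hn, tracePoly_dvd n, ?_, ?_⟩, natDegree_tracePoly hn⟩
  · rwa [polyAct_eq_aeval, ← mem_actKer]
  · intro h' hmon hdvd hker
    rw [polyAct_eq_aeval, ← mem_actKer] at hker
    classical
    suffices hf : tracePoly Fq n ∣ h' from natDegree_le_of_dvd hf hmon.ne_zero
    have hgcd : α ∈ actKer F (EuclideanDomain.gcd h' (tracePoly Fq n)) := by
      rw [mem_actKer] at hker h0 ⊢
      rw [EuclideanDomain.gcd_eq_gcd_ab, mul_comm h', mul_comm (tracePoly Fq n), map_add, map_mul,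
        map_mul, LinearMap.add_apply, Module.End.mul_apply, Module.End.mul_apply, hker, h0,
        map_zero, map_zero, add_zero]
    obtain ⟨e, he⟩ := EuclideanDomain.gcd_dvd_right h' (tracePoly Fq n)
    by_cases hu : IsUnit e
    · exact (he ▸ (hu.mul_right_dvd).2 dvd_rfl).trans (EuclideanDomain.gcd_dvd_left _ _)
    · exfalso
      have he0 : e ≠ 0 := by
        rintro rfl
        exact (tracePoly_monic (Fq := Fq) hn).ne_zero (by rw [he, mul_zero])
      obtain ⟨P, hP, k, hk⟩ := WfDvdMonoid.exists_irreducible_factor hu he0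
      have hP' : Irreducible (normalize P) := (normalize_associated P).symm.irreducible hP
      obtain ⟨k', hk'⟩ : normalize P ∣ e := (normalize_dvd_iff).2 ⟨k, hk⟩
      refine h (normalize P) (EuclideanDomain.gcd h' (tracePoly Fq n) * k') hP'
        (monic_normalize hP.ne_zero) ?_ (actKer_mono (dvd_mul_right _ _) hgcd)
      conv_lhs => rw [he, hk']
      ring

theorem IsKNormal.smul {α : F} {n k : ℕ} (h : IsKNormal Fq (Fintype.card Fq) n k α) {c : Fq}
    (hc : c ≠ 0) : IsKNormal Fq (Fintype.card Fq) n k (c • α) := by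
  obtain ⟨g, ⟨h1, h2, h3, h4⟩, h5⟩ := h
  refine ⟨g, ⟨h1, h2, ?_, ?_⟩, h5⟩
  · rw [polyAct_eq_aeval] at h3 ⊢
    rw [map_smul, h3, smul_zero]
  · intro h' h6 h7 h8
    refine h4 h' h6 h7 ?_
    rw [polyAct_eq_aeval] at h8 ⊢
    rw [map_smul] at h8
    exact (smul_eq_zero.1 h8).resolve_left hc

variable [Fintype F]

theorem aeval_frobLin_X_pow_sub_one :
    aeval (frobLin Fq F) (X ^ Module.finrank Fq F - 1 : Fq[X]) = 0 := by
  rw [← FiniteField.minpoly_frobeniusAlgHom Fq F]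
  exact minpoly.aeval _ _

theorem finrank_actKer_le {g : Fq[X]} (hg : g ≠ 0) :
    Module.finrank Fq (actKer F g) ≤ g.natDegree := by
  set q := Fintype.card Fq with hq
  have hq1 : 1 < q := Fintype.one_lt_card
  let G : F[X] := ∑ i ∈ Finset.range (g.natDegree + 1), C (algebraMap Fq F (g.coeff i)) * X ^ q ^ i
  have hcoeff : G.coeff (q ^ g.natDegree) = algebraMap Fq F g.leadingCoeff := by
    rw [finsetSum_coeff, Finset.sum_eq_single g.natDegree]
    · rw [coeff_C_mul, coeff_X_pow_self, mul_one, leadingCoeff]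
    · intro i _ hi
      rw [coeff_C_mul, coeff_X_pow, if_neg, mul_zero]
      exact fun h => hi (Nat.pow_right_injective hq1 h).symm
    · simp
  have hG0 : G ≠ 0 := by
    intro h
    rw [h, coeff_zero] at hcoeff
    exact hg (leadingCoeff_eq_zero.1 ((map_eq_zero _).1 hcoeff.symm))
  have hdeg : G.natDegree ≤ q ^ g.natDegree := by
    refine natDegree_sum_le_of_forall_le _ _ fun i hi => ?_
    exact (natDegree_C_mul_X_pow_le _ _).trans
      (Nat.pow_le_pow_right (by omega) (Nat.lt_succ_iff.1 (Finset.mem_range.1 hi)))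
  have hroot : ∀ β ∈ actKer F g, G.IsRoot β := by
    intro β hβ
    rw [mem_actKer, ← polyAct_eq_aeval, polyAct, sum_over_range _ (by simp)] at hβ
    simp only [IsRoot, G, eval_finsetSum, eval_mul, eval_C, eval_pow, eval_X]
    exact hβ
  have hcard : Nat.card (actKer F g) ≤ q ^ g.natDegree := by
    classical
    have h1 : Nat.card (actKer F g) ≤ G.roots.toFinset.card := by
      rw [← Set.ncard_coe_finset, ← Nat.card_coe_set_eq]
      refine Nat.card_mono (Finset.finite_toSet _) fun β hβ => ?_
      simp only [Finset.mem_coe, Multiset.mem_toFinset, mem_roots hG0]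
      exact hroot β hβ
    exact h1.trans ((Multiset.toFinset_card_le _).trans ((card_roots' G).trans hdeg))
  rw [Module.natCard_eq_pow_finrank (K := Fq), Nat.card_eq_fintype_card] at hcard
  exact (Nat.pow_le_pow_iff_right hq1).1 hcard

theorem finrank_actKer {g : Fq[X]} (hg : g ∣ X ^ Module.finrank Fq F - 1) :
    Module.finrank Fq (actKer F g) = g.natDegree := by
  have hn : 0 < Module.finrank Fq F := Module.finrank_pos
  have hne : (X ^ Module.finrank Fq F - 1 : Fq[X]) ≠ 0 := (monic_X_pow_sub_C 1 hn.ne').ne_zero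
  obtain ⟨h, hh⟩ := hg
  have hg0 : g ≠ 0 := by
    rintro rfl
    exact hne (by rw [hh, zero_mul])
  have hh0 : h ≠ 0 := by
    rintro rfl
    exact hne (by rw [hh, mul_zero])
  have hdeg : Module.finrank Fq F = g.natDegree + h.natDegree := by
    rw [← natDegree_mul hg0 hh0, ← hh]
    exact (natDegree_X_pow_sub_C (r := (1 : Fq))).symm
  have h1 := finrank_actKer_le (F := F) hg0
  have h2 := finrank_actKer_le (F := F) hh0
  have h3 := LinearMap.finrank_range_add_finrank_ker (aeval (frobLin Fq F) h)
  have h4 : LinearMap.range (aeval (frobLin Fq F) h) ≤ actKer F g := by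
    rintro _ ⟨β, rfl⟩
    rw [mem_actKer, ← Module.End.mul_apply, ← map_mul, ← hh, aeval_frobLin_X_pow_sub_one]
    rfl
  have h5 := Submodule.finrank_mono h4
  change _ + Module.finrank Fq (actKer F h) = _ at h3
  omega

theorem index_actKer {g : Fq[X]} (hg : g ∣ X ^ Module.finrank Fq F - 1) :
    (actKer F g).toAddSubgroup.index = Fintype.card Fq ^ (Module.finrank Fq F - g.natDegree) := by
  have h1 := (actKer F g).toAddSubgroup.card_mul_index
  have h2 : Nat.card (actKer F g).toAddSubgroup = Fintype.card Fq ^ g.natDegree := by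
    change Nat.card (actKer F g) = _
    rw [Module.natCard_eq_pow_finrank (K := Fq), Nat.card_eq_fintype_card, finrank_actKer hg]
  have h3 : g.natDegree ≤ Module.finrank Fq F := by
    rw [← finrank_actKer hg]
    exact Submodule.finrank_le _
  rw [h2, Module.natCard_eq_pow_finrank (K := Fq), Nat.card_eq_fintype_card,
    ← Nat.add_sub_cancel' h3, pow_add] at h1
  exact Nat.eq_of_mul_eq_mul_left (pow_pos Fintype.card_pos _) h1

end FrobeniusAction

section Intersections

variable {Fq F : Type*} [Field Fq] [Fintype Fq] [Field F] [Algebra Fq F]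

theorem actKer_inf_of_isCoprime {a b h : Fq[X]} (hab : IsCoprime a b) :
    actKer F (a * h) ⊓ actKer F (b * h) = actKer F h := by
  refine le_antisymm ?_ (le_inf (actKer_mono (dvd_mul_left _ _)) (actKer_mono (dvd_mul_left _ _)))
  rintro β ⟨h1, h2⟩
  obtain ⟨u, v, huv⟩ := hab
  have h3 : h = u * (a * h) + v * (b * h) := by linear_combination (-h) * huv
  change β ∈ actKer F (a * h) at h1
  change β ∈ actKer F (b * h) at h2
  rw [mem_actKer] at h1 h2 ⊢
  rw [h3, map_add, map_mul _ u, map_mul _ v, LinearMap.add_apply, Module.End.mul_apply,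
    Module.End.mul_apply, h1, h2, map_zero, map_zero, add_zero]

theorem mem_actKer_div_prod {f : Fq[X]} {S : Finset Fq[X]}
    (hS : ∀ P ∈ S, Irreducible P ∧ P.Monic ∧ P ∣ f) {h : Fq[X]} (hh : f = (∏ P ∈ S, P) * h)
    {β : F} : β ∈ actKer F h ↔ β ∈ actKer F f ∧ ∀ P ∈ S, β ∈ actKer F (f / P) := by
  classical
  induction S using Finset.induction_on generalizing h with
  | empty => simp [hh]
  | insert P S hPS ih =>
    have hP := hS P (Finset.mem_insert_self _ _)
    have hS' : ∀ R ∈ S, Irreducible R ∧ R.Monic ∧ R ∣ f := fun R hR =>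
      hS R (Finset.mem_insert_of_mem hR)
    rw [Finset.prod_insert hPS] at hh
    have hcop : IsCoprime P (∏ R ∈ S, R) := by
      refine IsCoprime.prod_right fun R hR => ?_
      rw [hP.1.coprime_iff_not_dvd]
      intro hdvd
      have := eq_of_monic_of_associated hP.2.1 (hS' R hR).2.1
        (hP.1.associated_of_dvd (hS' R hR).1 hdvd)
      exact hPS (this ▸ hR)
    have hdiv : f / P = (∏ R ∈ S, R) * h := by
      conv_lhs => rw [hh, mul_assoc]
      exact mul_div_cancel_left₀ _ hP.1.ne_zero
    rw [← actKer_inf_of_isCoprime hcop, Submodule.mem_inf,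
      ih hS' (h := P * h) (by rw [hh]; ring), Finset.forall_mem_insert, hdiv]
    tauto

theorem prod_dvd_of_irreducible {Fq : Type*} [Field Fq] {f : Fq[X]} {S : Finset Fq[X]}
    (hS : ∀ P ∈ S, Irreducible P ∧ P.Monic ∧ P ∣ f) : ∏ P ∈ S, P ∣ f := by
  refine Finset.prod_dvd_of_coprime (fun P hP R hR hPR => ?_) fun P hP => (hS P hP).2.2
  change IsCoprime P R
  rw [(hS P hP).1.coprime_iff_not_dvd]
  exact fun hdvd => hPR (eq_of_monic_of_associated (hS P hP).2.1 (hS R hR).2.1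
    ((hS P hP).1.associated_of_dvd (hS R hR).1 hdvd))

/-- Elements of trace zero killed by `f / P` for all `P` in `S`, where `f` is the trace
polynomial. -/
def traceKer (F : Type*) [Field F] [Algebra Fq F] (n : ℕ) (S : Finset Fq[X]) : AddSubgroup F :=
  (actKer F (tracePoly Fq n / ∏ P ∈ S, P)).toAddSubgroup

theorem mem_traceKer {n : ℕ} {S : Finset Fq[X]}
    (hS : ∀ P ∈ S, Irreducible P ∧ P.Monic ∧ P ∣ tracePoly Fq n) {β : F} :
    β ∈ traceKer F n S ↔ β ∈ actKer F (tracePoly Fq n) ∧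
      ∀ P ∈ S, β ∈ actKer F (tracePoly Fq n / P) := by
  refine mem_actKer_div_prod hS ?_
  exact (EuclideanDomain.mul_div_cancel' (monic_prod_of_monic _ _ fun P hP =>
    (hS P hP).2.1).ne_zero (prod_dvd_of_irreducible hS)).symm

theorem index_traceKer [Fintype F] {S : Finset Fq[X]}
    (hS : ∀ P ∈ S, Irreducible P ∧ P.Monic ∧ P ∣ tracePoly Fq (Module.finrank Fq F)) :
    (traceKer F (Module.finrank Fq F) S).index =
      Fintype.card Fq * ∏ P ∈ S, Fintype.card Fq ^ P.natDegree := by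
  have hn : Module.finrank Fq F ≠ 0 := Module.finrank_pos.ne'
  have hmon : (∏ P ∈ S, P).Monic := monic_prod_of_monic _ _ fun P hP => (hS P hP).2.1
  have hmul := EuclideanDomain.mul_div_cancel' hmon.ne_zero (prod_dvd_of_irreducible hS)
  have hdvd : tracePoly Fq (Module.finrank Fq F) / ∏ P ∈ S, P ∣ X ^ Module.finrank Fq F - 1 :=
    (Dvd.intro_left _ hmul).trans (tracePoly_dvd _)
  have hdeg := congrArg natDegree hmul
  have hne : tracePoly Fq (Module.finrank Fq F) / ∏ P ∈ S, P ≠ 0 := by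
    intro h
    rw [h, mul_zero] at hmul
    exact (tracePoly_monic hn).ne_zero hmul.symm
  rw [natDegree_mul hmon.ne_zero hne, natDegree_tracePoly hn,
    natDegree_prod_of_monic _ _ fun P hP => (hS P hP).2.1] at hdeg
  rw [traceKer, index_actKer hdvd, Finset.prod_pow_eq_pow_sum, ← pow_succ']
  congr 1
  omega

end Intersections

section Powers

theorem mem_range_powMonoidHom {G : Type*} [CommGroup G] {a : ℕ} {x : G} :
    x ∈ (powMonoidHom a : G →* G).range ↔ ∃ y, y ^ a = x := Iff.rfl

theorem mem_range_powMonoidHom_prod {G : Type*} [CommGroup G] {S : Finset ℕ}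
    (hS : ∀ ℓ ∈ S, ℓ.Prime) {x : G} :
    x ∈ (powMonoidHom (∏ ℓ ∈ S, ℓ) : G →* G).range ↔
      ∀ ℓ ∈ S, x ∈ (powMonoidHom ℓ : G →* G).range := by
  classical
  induction S using Finset.induction_on with
  | empty => simp
  | insert p S hp ih =>
    rw [Finset.prod_insert hp, Finset.forall_mem_insert,
      ← ih fun ℓ hℓ => hS ℓ (Finset.mem_insert_of_mem hℓ)]
    simp only [mem_range_powMonoidHom]
    constructor
    · rintro ⟨y, rfl⟩
      exact ⟨⟨y ^ ∏ ℓ ∈ S, ℓ, by rw [← pow_mul, mul_comm]⟩, ⟨y ^ p, by rw [← pow_mul]⟩⟩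
    · rintro ⟨⟨y, hy⟩, ⟨z, hz⟩⟩
      have hcop : IsCoprime (p : ℤ) ((∏ ℓ ∈ S, ℓ : ℕ) : ℤ) := by
        rw [Nat.isCoprime_iff_coprime]
        refine Nat.Coprime.prod_right fun ℓ hℓ => ?_
        rw [Nat.coprime_primes (hS p (Finset.mem_insert_self _ _))
          (hS ℓ (Finset.mem_insert_of_mem hℓ))]
        rintro rfl
        exact hp hℓ
      obtain ⟨u, v, huv⟩ := hcop
      refine ⟨z ^ u * y ^ v, ?_⟩
      generalize (∏ ℓ ∈ S, ℓ) = b at *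
      have h1 : (z ^ u) ^ (p * b) = x ^ (u * p) := by
        rw [← hz, ← zpow_natCast, ← zpow_natCast, ← zpow_mul, ← zpow_mul]
        congr 1
        push_cast
        ring
      have h2 : (y ^ v) ^ (p * b) = x ^ (v * b) := by
        rw [← hy, ← zpow_natCast, ← zpow_natCast, ← zpow_mul, ← zpow_mul]
        congr 1
        push_cast
        ring
      rw [mul_pow, h1, h2, ← zpow_add, huv, zpow_one]

theorem index_range_powMonoidHom_prod {G : Type*} [CommGroup G] [Finite G] [IsCyclic G]
    {S : Finset ℕ} (hS : ∀ ℓ ∈ S, ℓ.Prime ∧ ℓ ∣ Nat.card G) :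
    (powMonoidHom (∏ ℓ ∈ S, ℓ) : G →* G).range.index = ∏ ℓ ∈ S, ℓ := by
  rw [IsCyclic.index_powMonoidHom_range]
  exact Nat.gcd_eq_right (Finset.prod_primes_dvd _ (fun ℓ hℓ => (hS ℓ hℓ).1.prime)
    fun ℓ hℓ => (hS ℓ hℓ).2)

/-- An element which is not an `ℓ`-th power for any prime `ℓ ∣ M` generates modulo elements of
order dividing `k`, where `M * k` is the order of the group. -/
theorem exists_generator_of_not_mem_range {G : Type*} [CommGroup G] [Finite G] [IsCyclic G]
    {M k : ℕ} (hMk : M * k = Nat.card G) {x : G}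
    (hx : ∀ ℓ ∈ M.primeFactors, x ∉ (powMonoidHom ℓ : G →* G).range) :
    ∃ c : G, c ^ k = 1 ∧ orderOf (c * x) = Nat.card G := by
  have hcard : 0 < Nat.card G := Nat.card_pos
  have hM : M ≠ 0 := by
    rintro rfl
    omega
  obtain ⟨g, hg⟩ := IsCyclic.exists_generator (α := G)
  obtain ⟨a, rfl⟩ := (mem_powers_iff_mem_zpowers).2 (hg x)
  have hord : orderOf g = Nat.card G := orderOf_eq_card_of_forall_mem_zpowers hg
  have hcop : Nat.Coprime a M := by
    by_contra h
    obtain ⟨ℓ, hℓ, h1, h2⟩ := Nat.Prime.not_coprime_iff_dvd.1 h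
    obtain ⟨b, rfl⟩ := h1
    refine hx ℓ (Nat.mem_primeFactors.2 ⟨hℓ, h2, hM⟩) ⟨g ^ b, ?_⟩
    change (g ^ b) ^ ℓ = g ^ (ℓ * b)
    rw [← pow_mul, mul_comm]
  have : NeZero (Nat.card G) := ⟨hcard.ne'⟩
  obtain ⟨u, hu⟩ := ZMod.unitsMap_surjective (Dvd.intro _ hMk) (ZMod.unitOfCoprime a hcop)
  have hu1 : ((u : ZMod (Nat.card G)).val : ZMod M) = a := by
    have h2 := congrArg Units.val hu
    rw [ZMod.unitsMap_val, ZMod.coe_unitOfCoprime] at h2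
    rw [ZMod.natCast_val]
    exact h2
  set b := (u : ZMod (Nat.card G)).val with hb
  have hbcop : Nat.Coprime b (Nat.card G) := ZMod.val_coe_unit_coprime u
  rw [ZMod.natCast_eq_natCast_iff] at hu1
  obtain ⟨t, ht⟩ := hu1.symm.dvd
  refine ⟨g ^ ((b : ℤ) - a), ?_, ?_⟩
  · rw [ht, ← zpow_natCast, ← zpow_mul, mul_right_comm, ← Nat.cast_mul, hMk, zpow_mul,
      zpow_natCast, pow_card_eq_one', one_zpow]
  · change orderOf (g ^ ((b : ℤ) - a) * g ^ a) = _
    rw [← zpow_natCast, ← zpow_add, sub_add_cancel, zpow_natCast, Nat.Coprime.orderOf_pow, hord]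
    rwa [hord, Nat.coprime_comm]

end Powers

section Primitive

variable {Fq F : Type*} [Field Fq] [Fintype Fq] [Field F] [Fintype F] [Algebra Fq F]

theorem exists_algebraMap_eq_of_pow_eq_one {x : Fˣ} (hx : x ^ (Fintype.card Fq - 1) = 1) :
    ∃ c : Fq, algebraMap Fq F c = x := by
  have hpos : 0 < Fintype.card Fq := Fintype.card_pos
  have hd : (X - 1 : Fq[X]) ∣ X ^ Module.finrank Fq F - 1 := ⟨tracePoly Fq _, by
    rw [mul_comm, tracePoly_mul]⟩
  have h1 : Module.finrank Fq (actKer F (X - 1 : Fq[X])) = 1 := by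
    rw [finrank_actKer hd]
    exact natDegree_X_sub_C 1
  have hmem : ∀ y : F, y ^ Fintype.card Fq = y → y ∈ actKer F (X - 1 : Fq[X]) := by
    intro y hy
    rw [mem_actKer, map_sub, aeval_X, map_one, LinearMap.sub_apply, Module.End.one_apply,
      sub_eq_zero]
    exact hy
  have hx' : (x : F) ∈ actKer F (X - 1 : Fq[X]) := by
    refine hmem _ ?_
    rw [← Units.val_pow_eq_pow_val, ← Nat.sub_add_cancel hpos, pow_succ, hx, one_mul]
  obtain ⟨c, hc⟩ := (finrank_eq_one_iff_of_nonzero' (⟨1, hmem 1 (one_pow _)⟩ :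
    actKer F (X - 1 : Fq[X])) fun h => one_ne_zero (congrArg Subtype.val h)).1 h1 ⟨x, hx'⟩
  refine ⟨c, ?_⟩
  rw [Algebra.algebraMap_eq_smul_one]
  exact congrArg Subtype.val hc

theorem exists_primitive_of_not_mem_range {n M : ℕ} (hn : Module.finrank Fq F = n)
    (hM : M * (Fintype.card Fq - 1) = Fintype.card Fq ^ n - 1) {α : Fˣ}
    (hα : ∀ ℓ ∈ M.primeFactors, α ∉ (powMonoidHom ℓ : Fˣ →* Fˣ).range)
    (h1 : IsKNormal Fq (Fintype.card Fq) n 1 (α : F))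
    (h2 : IsKNormal Fq (Fintype.card Fq) n 1 ((α⁻¹ : Fˣ) : F)) :
    ∃ α : F, α ≠ 0 ∧ orderOf α = Fintype.card Fq ^ n - 1 ∧
      orderOf α⁻¹ = Fintype.card Fq ^ n - 1 ∧
      IsKNormal Fq (Fintype.card Fq) n 1 α ∧ IsKNormal Fq (Fintype.card Fq) n 1 α⁻¹ := by
  have hcard : Nat.card Fˣ = Fintype.card Fq ^ n - 1 := by
    rw [Nat.card_units, Module.natCard_eq_pow_finrank (K := Fq), Nat.card_eq_fintype_card, hn]
  obtain ⟨c, hc, hord⟩ := exists_generator_of_not_mem_range (hM.trans hcard.symm) hα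
  obtain ⟨d, hd⟩ := exists_algebraMap_eq_of_pow_eq_one hc
  have hd0 : d ≠ 0 := by
    rintro rfl
    rw [map_zero] at hd
    exact c.ne_zero hd.symm
  have hval : ((c * α : Fˣ) : F) = d • (α : F) := by
    rw [Units.val_mul, ← hd, Algebra.smul_def]
  have hinv : ((c * α : Fˣ) : F)⁻¹ = d⁻¹ • ((α⁻¹ : Fˣ) : F) := by
    rw [hval, smul_inv₀, Units.val_inv_eq_inv_val]
  refine ⟨((c * α : Fˣ) : F), (c * α).ne_zero, ?_, ?_, ?_, ?_⟩
  · rw [orderOf_units, hord, hcard]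
  · rw [← Units.val_inv_eq_inv_val, orderOf_units, orderOf_inv, hord, hcard]
  · rw [hval]
    exact h1.smul hd0
  · rw [hinv]
    exact h2.smul (inv_ne_zero hd0)

end Primitive

section Sieve

variable {ι Ω : Type*} [DecidableEq ι]

open Classical in
theorem abs_card_sieve_sub_le {A : Finset Ω} {Bad : ι → Ω → Prop} {ρ : ι → ℝ} {X E : ℝ}
    (C T : Finset ι) (hCT : Disjoint C T)
    (h : ∀ S ⊆ C ∪ T, |((A.filter fun x => ∀ i ∈ S, Bad i x).card : ℝ) - X * ∏ i ∈ S, ρ i| ≤ E) :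
    |((A.filter fun x => (∀ i ∈ C, ¬Bad i x) ∧ ∀ i ∈ T, Bad i x).card : ℝ) -
      X * (∏ i ∈ T, ρ i) * ∏ i ∈ C, (1 - ρ i)| ≤ 2 ^ C.card * E := by
  induction C using Finset.induction_on generalizing T with
  | empty => simpa using h T (by simp)
  | insert c C hc ih =>
    rw [Finset.disjoint_insert_left] at hCT
    have hcT : c ∉ T := hCT.1
    have h1 := ih T hCT.2 fun S hS => h S (hS.trans (Finset.union_subset_union_left
      (Finset.subset_insert _ _)))
    have h2 := ih (insert c T) (by
      rw [Finset.disjoint_insert_right]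
      exact ⟨hc, hCT.2⟩) fun S hS => h S (hS.trans (by
        intro i hi
        simp only [Finset.mem_union, Finset.mem_insert] at hi ⊢
        tauto))
    have hcount : ((A.filter fun x => (∀ i ∈ C, ¬Bad i x) ∧ ∀ i ∈ T, Bad i x).card : ℝ) =
        (A.filter fun x => (∀ i ∈ insert c C, ¬Bad i x) ∧ ∀ i ∈ T, Bad i x).card +
        (A.filter fun x => (∀ i ∈ C, ¬Bad i x) ∧ ∀ i ∈ insert c T, Bad i x).card := by
      rw [← Nat.cast_add, ← Finset.card_union_of_disjoint, ← Finset.filter_or]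
      · congr 2
        ext x
        simp only [Finset.mem_filter, Finset.forall_mem_insert]
        tauto
      · rw [Finset.disjoint_filter]
        simp only [Finset.forall_mem_insert]
        tauto
    rw [Finset.prod_insert hcT] at h2
    rw [Finset.prod_insert hc, Finset.card_insert_of_notMem hc, pow_succ]
    rw [hcount] at h1
    rw [abs_le] at *
    constructor <;> nlinarith [h1.1, h1.2, h2.1, h2.2]

/-- A lower bound sieve: conditions indexed by `C` are treated by inclusion-exclusion and those
indexed by `D` by a union bound. -/
theorem exists_not_bad {A : Finset Ω} {Bad : ι → Ω → Prop} {ρ : ι → ℝ} {X E : ℝ}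
    (C D : Finset ι) (hCD : Disjoint C D)
    (h : ∀ S : Finset ι, S ⊆ C ∪ D → ∀ N : Finset Ω, (∀ x, x ∈ N ↔ x ∈ A ∧ ∀ i ∈ S, Bad i x) →
      |(N.card : ℝ) - X * ∏ i ∈ S, ρ i| ≤ E)
    (hlt : 2 ^ C.card * E * (1 + D.card) <
      X * (∏ i ∈ C, (1 - ρ i)) * (1 - ∑ i ∈ D, ρ i)) :
    ∃ x ∈ A, ∀ i ∈ C ∪ D, ¬Bad i x := by
  classical
  by_contra! hcon
  replace h : ∀ S ⊆ C ∪ D,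
      |((A.filter fun x => ∀ i ∈ S, Bad i x).card : ℝ) - X * ∏ i ∈ S, ρ i| ≤ E :=
    fun S hS => h S hS _ fun x => Finset.mem_filter
  have h0 := abs_card_sieve_sub_le C ∅ (Finset.disjoint_empty_right _) fun S hS =>
    h S (hS.trans (by simp))
  have h1 : ∀ d ∈ D, ((A.filter fun x => (∀ i ∈ C, ¬Bad i x) ∧ ∀ i ∈ ({d} : Finset ι),
      Bad i x).card : ℝ) ≤ X * ρ d * ∏ i ∈ C, (1 - ρ i) + 2 ^ C.card * E := by
    intro d hd
    have h2 := abs_card_sieve_sub_le C {d} (Finset.disjoint_singleton_right.2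
      fun hdC => Finset.disjoint_left.1 hCD hdC hd) fun S hS =>
      h S (hS.trans (Finset.union_subset_union_right (Finset.singleton_subset_iff.2 hd)))
    rw [Finset.prod_singleton] at h2
    linarith [(abs_le.1 h2).2]
  have hcover : (A.filter fun x => (∀ i ∈ C, ¬Bad i x) ∧ ∀ i ∈ (∅ : Finset ι), Bad i x) ⊆
      D.biUnion fun d => A.filter fun x => (∀ i ∈ C, ¬Bad i x) ∧
        ∀ i ∈ ({d} : Finset ι), Bad i x := by
    intro x hx
    rw [Finset.mem_filter] at hx
    obtain ⟨i, hi, hbad⟩ := hcon x hx.1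
    rcases Finset.mem_union.1 hi with hi | hi
    · exact absurd hbad (hx.2.1 i hi)
    · rw [Finset.mem_biUnion]
      exact ⟨i, hi, Finset.mem_filter.2 ⟨hx.1, hx.2.1, by simpa using hbad⟩⟩
  have h3 : ((A.filter fun x => (∀ i ∈ C, ¬Bad i x) ∧ ∀ i ∈ (∅ : Finset ι), Bad i x).card : ℝ) ≤
      ∑ d ∈ D, (X * ρ d * ∏ i ∈ C, (1 - ρ i) + 2 ^ C.card * E) := by
    refine le_trans ?_ (Finset.sum_le_sum h1)
    exact_mod_cast (Finset.card_le_card hcover).trans Finset.card_biUnion_le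
  rw [Finset.sum_add_distrib, Finset.sum_const, nsmul_eq_mul, ← Finset.sum_mul,
    ← Finset.mul_sum] at h3
  rw [Finset.prod_empty, mul_one] at h0
  nlinarith [(abs_le.1 h0).1]

end Sieve

section Criterion

variable {Fq F : Type*} [Field Fq] [Fintype Fq] [Field F] [Fintype F] [Algebra Fq F]

open Classical in
variable (Fq) in
/-- The monic irreducible factors of `1 + X + ⋯ + X ^ (n - 1)`. -/
def traceFactors (n : ℕ) : Finset Fq[X] :=
  (UniqueFactorizationMonoid.normalizedFactors (tracePoly Fq n)).toFinset

theorem mem_traceFactors {Fq : Type*} [Field Fq] {n : ℕ} (hn : n ≠ 0) {P : Fq[X]} :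
    P ∈ traceFactors Fq n ↔ Irreducible P ∧ P.Monic ∧ P ∣ tracePoly Fq n := by
  classical
  rw [traceFactors, Multiset.mem_toFinset,
    UniqueFactorizationMonoid.mem_normalizedFactors_iff' (tracePoly_monic hn).ne_zero]
  constructor
  · rintro ⟨h1, h2, h3⟩
    exact ⟨h1, h2 ▸ monic_normalize h1.ne_zero, h3⟩
  · rintro ⟨h1, h2, h3⟩
    exact ⟨h1, h2.normalize_eq_self, h3⟩

/-- The property that is excluded by the sieve. -/
def SieveBad (n : ℕ) : ℕ ⊕ Fq[X] ⊕ Fq[X] → Fˣ → Prop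
  | .inl ℓ, x => x ∈ (powMonoidHom ℓ : Fˣ →* Fˣ).range
  | .inr (.inl P), x => (x : F) ∈ actKer F (tracePoly Fq n / P)
  | .inr (.inr P), x => ((x⁻¹ : Fˣ) : F) ∈ actKer F (tracePoly Fq n / P)

/-- The density of the property that is excluded by the sieve. -/
def sieveDensity : ℕ ⊕ Fq[X] ⊕ Fq[X] → ℝ
  | .inl ℓ => (ℓ : ℝ)⁻¹
  | .inr (.inl P) => ((Fintype.card Fq : ℝ) ^ P.natDegree)⁻¹
  | .inr (.inr P) => ((Fintype.card Fq : ℝ) ^ P.natDegree)⁻¹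

theorem abs_card_sieveBad_sub_le {n M : ℕ} (hn : Module.finrank Fq F = n)
    (hM : M * (Fintype.card Fq - 1) = Fintype.card Fq ^ n - 1)
    (S : Finset (ℕ ⊕ Fq[X] ⊕ Fq[X]))
    (hS : S ⊆ M.primeFactors.disjSum ((traceFactors Fq n).disjSum (traceFactors Fq n)))
    (N : Finset Fˣ) (hN : ∀ x : Fˣ, x ∈ N ↔ ((x : F) ∈ actKer F (tracePoly Fq n) ∧
      ((x⁻¹ : Fˣ) : F) ∈ actKer F (tracePoly Fq n)) ∧ ∀ i ∈ S, SieveBad n i x) :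
    |(N.card : ℝ) - (((Fintype.card Fq : ℝ) ^ n - 1) / (Fintype.card Fq : ℝ) ^ 2) *
      ∏ i ∈ S, sieveDensity i| ≤ 2 * √((Fintype.card Fq : ℝ) ^ n) := by
  classical
  have hn0 : n ≠ 0 := hn ▸ Module.finrank_pos.ne'
  set S₀ := S.toLeft with hS₀
  set S₁ := S.toRight.toLeft with hS₁
  set S₂ := S.toRight.toRight with hS₂
  have hSeq : S = S₀.disjSum (S₁.disjSum S₂) := by
    rw [hS₁, hS₂, Finset.toLeft_disjSum_toRight, hS₀, Finset.toLeft_disjSum_toRight]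
  have h0 : ∀ ℓ ∈ S₀, ℓ ∈ M.primeFactors := by
    intro ℓ hℓ
    simpa using hS (Finset.mem_toLeft.1 hℓ)
  have h1 : ∀ P ∈ S₁, Irreducible P ∧ P.Monic ∧ P ∣ tracePoly Fq n := by
    intro P hP
    rw [← mem_traceFactors hn0]
    simpa using hS (Finset.mem_toRight.1 (Finset.mem_toLeft.1 hP))
  have h2 : ∀ P ∈ S₂, Irreducible P ∧ P.Monic ∧ P ∣ tracePoly Fq n := by
    intro P hP
    rw [← mem_traceFactors hn0]
    simpa using hS (Finset.mem_toRight.1 (Finset.mem_toRight.1 hP))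
  have hcard : Fintype.card F = Fintype.card Fq ^ n := by
    rw [← hn, Module.card_eq_pow_finrank (K := Fq)]
  have hcardu : Nat.card Fˣ = M * (Fintype.card Fq - 1) := by
    rw [hM, Nat.card_units, Nat.card_eq_fintype_card, hcard]
  have key := abs_card_sub_le (powMonoidHom (∏ ℓ ∈ S₀, ℓ) : Fˣ →* Fˣ).range
    (traceKer F n S₁) (traceKer F n S₂)
  have hi0 := index_range_powMonoidHom_prod (G := Fˣ) (S := S₀) fun ℓ hℓ =>
    ⟨Nat.prime_of_mem_primeFactors (h0 ℓ hℓ), hcardu ▸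
      (Nat.dvd_of_mem_primeFactors (h0 ℓ hℓ)).mul_right _⟩
  have hmem : ∀ x : Fˣ, _ := fun x => mem_range_powMonoidHom_prod (G := Fˣ) (S := S₀) (x := x)
    fun ℓ hℓ => Nat.prime_of_mem_primeFactors (h0 ℓ hℓ)
  generalize (powMonoidHom (∏ ℓ ∈ S₀, ℓ) : Fˣ →* Fˣ).range = H at key hi0 hmem
  have hi1 := index_traceKer (F := F) (S := S₁) (by rwa [hn])
  have hi2 := index_traceKer (F := F) (S := S₂) (by rwa [hn])
  rw [hn] at hi1 hi2
  rw [hi0, hi1, hi2, hcard] at key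
  convert key using 3
  · congr 2
    ext x
    rw [hN, Finset.mem_filter, hmem, mem_traceKer h1, mem_traceKer h2, hSeq]
    simp only [Finset.mem_univ, true_and, Sum.forall, Finset.inl_mem_disjSum,
      Finset.inr_mem_disjSum, SieveBad]
    tauto
  · rw [hSeq, Finset.prod_disjSum, Finset.prod_disjSum]
    simp only [sieveDensity, Finset.prod_inv_distrib]
    push_cast
    rw [div_mul_eq_mul_div, div_eq_mul_inv, div_eq_mul_inv]
    simp only [mul_inv]
    ring
  · push_cast
    rfl

theorem exists_of_sieve {n M : ℕ} (hn : Module.finrank Fq F = n)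
    (hM : M * (Fintype.card Fq - 1) = Fintype.card Fq ^ n - 1)
    {C₀ D₀ : Finset ℕ} {C₁ D₁ C₂ D₂ : Finset Fq[X]}
    (h₀ : Disjoint C₀ D₀) (h₁ : Disjoint C₁ D₁) (h₂ : Disjoint C₂ D₂)
    (hu₀ : ∀ ℓ, ℓ ∈ M.primeFactors ↔ ℓ ∈ C₀ ∨ ℓ ∈ D₀)
    (hu₁ : ∀ P, P ∈ traceFactors Fq n ↔ P ∈ C₁ ∨ P ∈ D₁)
    (hu₂ : ∀ P, P ∈ traceFactors Fq n ↔ P ∈ C₂ ∨ P ∈ D₂)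
    (hlt : 2 * √((Fintype.card Fq : ℝ) ^ n) * (Fintype.card Fq : ℝ) ^ 2 *
      (1 + (D₀.card + (D₁.card + D₂.card))) *
      ((∏ ℓ ∈ C₀, 2 / (1 - (ℓ : ℝ)⁻¹)) *
      ((∏ P ∈ C₁, 2 / (1 - ((Fintype.card Fq : ℝ) ^ P.natDegree)⁻¹)) *
      ∏ P ∈ C₂, 2 / (1 - ((Fintype.card Fq : ℝ) ^ P.natDegree)⁻¹))) <
      ((Fintype.card Fq : ℝ) ^ n - 1) * (1 - (∑ ℓ ∈ D₀, (ℓ : ℝ)⁻¹ +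
      (∑ P ∈ D₁, ((Fintype.card Fq : ℝ) ^ P.natDegree)⁻¹ +
      ∑ P ∈ D₂, ((Fintype.card Fq : ℝ) ^ P.natDegree)⁻¹))) ) :
    ∃ α : F, α ≠ 0 ∧ orderOf α = Fintype.card Fq ^ n - 1 ∧
      orderOf α⁻¹ = Fintype.card Fq ^ n - 1 ∧
      IsKNormal Fq (Fintype.card Fq) n 1 α ∧ IsKNormal Fq (Fintype.card Fq) n 1 α⁻¹ := by
  classical
  have hn0 : n ≠ 0 := hn ▸ Module.finrank_pos.ne'
  have hq1 : (1 : ℝ) < Fintype.card Fq := by exact_mod_cast Fintype.one_lt_card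
  set C := C₀.disjSum (C₁.disjSum C₂) with hC
  set D := D₀.disjSum (D₁.disjSum D₂) with hD
  have hCD : Disjoint C D := by
    rw [Finset.disjoint_left] at *
    simp only [Sum.forall, hC, hD, Finset.inl_mem_disjSum, Finset.inr_mem_disjSum]
    exact ⟨h₀, h₁, h₂⟩
  have hsub : ∀ i, i ∈ C ∪ D ↔
      i ∈ M.primeFactors.disjSum ((traceFactors Fq n).disjSum (traceFactors Fq n)) := by
    simp only [Finset.mem_union, Sum.forall, hC, hD, Finset.inl_mem_disjSum,
      Finset.inr_mem_disjSum]
    exact ⟨fun ℓ => (hu₀ ℓ).symm, fun P => (hu₁ P).symm, fun P => (hu₂ P).symm⟩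
  have hρ : ∀ i ∈ C, sieveDensity i < 1 := by
    simp only [Sum.forall, hC, Finset.inl_mem_disjSum, Finset.inr_mem_disjSum, sieveDensity]
    have hP : ∀ P ∈ traceFactors Fq n, ((Fintype.card Fq : ℝ) ^ P.natDegree)⁻¹ < 1 := by
      intro P hP
      exact inv_lt_one_of_one_lt₀ (one_lt_pow₀ hq1 ((mem_traceFactors hn0).1 hP).1.natDegree_pos.ne')
    refine ⟨fun ℓ hℓ => ?_, fun P h => hP P ((hu₁ P).2 (.inl h)),
      fun P h => hP P ((hu₂ P).2 (.inl h))⟩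
    refine inv_lt_one_of_one_lt₀ ?_
    exact_mod_cast (Nat.prime_of_mem_primeFactors ((hu₀ ℓ).2 (.inl hℓ))).one_lt
  have hsieve := exists_not_bad (A := Finset.univ.filter fun x : Fˣ =>
    (x : F) ∈ actKer F (tracePoly Fq n) ∧ ((x⁻¹ : Fˣ) : F) ∈ actKer F (tracePoly Fq n))
    (Bad := SieveBad n) (ρ := sieveDensity)
    (X := ((Fintype.card Fq : ℝ) ^ n - 1) / (Fintype.card Fq : ℝ) ^ 2)
    (E := 2 * √((Fintype.card Fq : ℝ) ^ n)) C D hCD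
    (fun S hS N hN => abs_card_sieveBad_sub_le hn hM S (fun i hi => (hsub i).1 (hS hi)) N
      (by simpa using hN)) ?_
  · obtain ⟨x, hx, hbad⟩ := hsieve
    rw [Finset.mem_filter] at hx
    have hbad' : ∀ i ∈ M.primeFactors.disjSum ((traceFactors Fq n).disjSum (traceFactors Fq n)),
        ¬SieveBad n i x := fun i hi => hbad i ((hsub i).2 hi)
    simp only [Sum.forall, Finset.inl_mem_disjSum, Finset.inr_mem_disjSum, SieveBad] at hbad'
    have hdiv : ∀ P g : Fq[X], Irreducible P → tracePoly Fq n = P * g →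
        tracePoly Fq n / P = g := by
      intro P g hP hg
      rw [hg, mul_div_cancel_left₀ _ hP.ne_zero]
    refine exists_primitive_of_not_mem_range hn hM hbad'.1
      (isKNormal_one hn0 hx.2.1 fun P g h1 h2 h3 => ?_)
      (isKNormal_one hn0 hx.2.2 fun P g h1 h2 h3 => ?_)
    · rw [← hdiv P g h1 h3]
      exact hbad'.2.1 P ((mem_traceFactors hn0).2 ⟨h1, h2, Dvd.intro _ h3.symm⟩)
    · rw [← hdiv P g h1 h3]
      exact hbad'.2.2 P ((mem_traceFactors hn0).2 ⟨h1, h2, Dvd.intro _ h3.symm⟩)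
  · have hprod : (∏ ℓ ∈ C₀, 2 / (1 - (ℓ : ℝ)⁻¹)) *
        ((∏ P ∈ C₁, 2 / (1 - ((Fintype.card Fq : ℝ) ^ P.natDegree)⁻¹)) *
        ∏ P ∈ C₂, 2 / (1 - ((Fintype.card Fq : ℝ) ^ P.natDegree)⁻¹)) =
        2 ^ C.card / ∏ i ∈ C, (1 - sieveDensity i) := by
      rw [← Finset.prod_const, ← Finset.prod_div_distrib, hC, Finset.prod_disjSum,
        Finset.prod_disjSum]
      rfl
    have hpos : 0 < ∏ i ∈ C, (1 - sieveDensity i) :=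
      Finset.prod_pos fun i hi => sub_pos.2 (hρ i hi)
    have hsum : ∑ i ∈ D, sieveDensity i = ∑ ℓ ∈ D₀, (ℓ : ℝ)⁻¹ +
        (∑ P ∈ D₁, ((Fintype.card Fq : ℝ) ^ P.natDegree)⁻¹ +
        ∑ P ∈ D₂, ((Fintype.card Fq : ℝ) ^ P.natDegree)⁻¹) := by
      rw [hD, Finset.sum_disjSum, Finset.sum_disjSum]
      rfl
    have hDcard : (D.card : ℝ) = D₀.card + (D₁.card + D₂.card) := by
      rw [hD, Finset.card_disjSum, Finset.card_disjSum]
      push_cast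
      rfl
    rw [hprod, mul_div_assoc', div_lt_iff₀ hpos, ← hsum, ← hDcard] at hlt
    rw [div_mul_eq_mul_div, div_mul_eq_mul_div, lt_div_iff₀ (by positivity)]
    calc _ = _ := by ring
      _ < _ := hlt
      _ = _ := by ring

end Criterion

/-! ### Degrees of the irreducible factors of `1 + X + ⋯ + X ^ (n - 1)` -/

section FactorCount

variable {Fq : Type*} [Field Fq]

theorem dvd_X_pow_gcd_sub_one {P : Fq[X]} {a b : ℕ} (ha : P ∣ X ^ a - 1) (hb : P ∣ X ^ b - 1) :
    P ∣ X ^ a.gcd b - 1 := by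
  rw [← AdjoinRoot.mk_eq_zero, map_sub, map_pow, map_one, sub_eq_zero] at *
  exact pow_gcd_eq_one.2 ⟨ha, hb⟩

theorem dvd_X_pow_sub_one_of_mem_traceFactors {n : ℕ} (hn : n ≠ 0) {P : Fq[X]}
    (hP : P ∈ traceFactors Fq n) : P ∣ X ^ n - 1 :=
  ((mem_traceFactors hn).1 hP).2.2.trans (tracePoly_dvd n)

theorem isCoprime_of_mem_traceFactors {n : ℕ} (hn : n ≠ 0) {P R : Fq[X]}
    (hP : P ∈ traceFactors Fq n) (hR : R ∈ traceFactors Fq n) (h : P ≠ R) : IsCoprime P R := by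
  obtain ⟨hP1, hP2, -⟩ := (mem_traceFactors hn).1 hP
  obtain ⟨hR1, hR2, -⟩ := (mem_traceFactors hn).1 hR
  refine (hP1.coprime_iff_not_dvd).2 fun hd => h ?_
  exact eq_of_monic_of_associated hP2 hR2 (hP1.associated_of_dvd hR1 hd)

theorem prod_dvd_of_subset_traceFactors {n : ℕ} (hn : n ≠ 0) {T : Finset Fq[X]}
    (hT : T ⊆ traceFactors Fq n) {G : Fq[X]} (hG : ∀ P ∈ T, P ∣ G) : ∏ P ∈ T, P ∣ G :=
  Finset.prod_dvd_of_coprime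
    (fun _ hP _ hR h => isCoprime_of_mem_traceFactors hn (hT hP) (hT hR) h) hG

theorem natDegree_prod_traceFactors {n : ℕ} (hn : n ≠ 0) {T : Finset Fq[X]}
    (hT : T ⊆ traceFactors Fq n) : (∏ P ∈ T, P).natDegree = ∑ P ∈ T, P.natDegree :=
  natDegree_prod_of_monic _ _ fun _ hP => ((mem_traceFactors hn).1 (hT hP)).2.1

theorem sum_natDegree_traceFactors_le {n : ℕ} (hn : n ≠ 0) :
    ∑ P ∈ traceFactors Fq n, P.natDegree ≤ n - 1 := by
  rw [← natDegree_prod_traceFactors hn subset_rfl, ← natDegree_tracePoly (Fq := Fq) hn]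
  exact natDegree_le_of_dvd (prod_dvd_of_subset_traceFactors hn subset_rfl
    fun P hP => ((mem_traceFactors hn).1 hP).2.2) (tracePoly_monic hn).ne_zero

theorem natDegree_pos_of_mem_traceFactors {n : ℕ} (hn : n ≠ 0) {P : Fq[X]}
    (hP : P ∈ traceFactors Fq n) : 0 < P.natDegree :=
  ((mem_traceFactors hn).1 hP).1.natDegree_pos

theorem natDegree_X_pow_sub_one (m : ℕ) : (X ^ m - 1 : Fq[X]).natDegree = m := by
  simpa using natDegree_X_pow_sub_C (n := m) (r := (1 : Fq))

variable (Fq) in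
/-- The irreducible factors of `1 + X + ⋯ + X ^ (n - 1)` of degree `d`. -/
def traceFactorsOfDegree (n d : ℕ) : Finset Fq[X] :=
  {P ∈ traceFactors Fq n | P.natDegree = d}

theorem mul_card_traceFactorsOfDegree_add_le {n d g : ℕ} (hn : n ≠ 0) {G : Fq[X]}
    (hg : g ≠ 0) (hdvd : ∀ P ∈ traceFactorsOfDegree Fq n d, P ∣ X ^ g - 1)
    (hG : G ∣ X ^ g - 1) (hcop : ∀ P ∈ traceFactorsOfDegree Fq n d, ¬ P ∣ G) :
    (traceFactorsOfDegree Fq n d).card * d + G.natDegree ≤ g := by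
  have hT : traceFactorsOfDegree Fq n d ⊆ traceFactors Fq n := Finset.filter_subset _ _
  have hne : (X ^ g - 1 : Fq[X]) ≠ 0 := by
    simpa using X_pow_sub_C_ne_zero (Nat.pos_of_ne_zero hg) (1 : Fq)
  have h1 : (∏ P ∈ traceFactorsOfDegree Fq n d, P) * G ∣ X ^ g - 1 := by
    refine IsCoprime.mul_dvd (IsCoprime.prod_left fun P hP => ?_)
      (prod_dvd_of_subset_traceFactors hn hT hdvd) hG
    exact ((mem_traceFactors hn).1 (hT hP)).1.coprime_iff_not_dvd.2 (hcop P hP)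
  have h2 := natDegree_le_of_dvd h1 hne
  have hG0 : G ≠ 0 := fun h => hne (zero_dvd_iff.1 (h ▸ hG))
  have hP0 : ∏ P ∈ traceFactorsOfDegree Fq n d, P ≠ 0 :=
    Finset.prod_ne_zero_iff.2 fun P hP => ((mem_traceFactors hn).1 (hT hP)).2.1.ne_zero
  rw [natDegree_X_pow_sub_one, natDegree_mul hP0 hG0, natDegree_prod_traceFactors hn hT] at h2
  have h3 : ∑ P ∈ traceFactorsOfDegree Fq n d, P.natDegree =
      (traceFactorsOfDegree Fq n d).card * d :=
    Finset.sum_const_nat fun P hP => (Finset.mem_filter.1 hP).2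
  rwa [h3] at h2

theorem card_filter_lt_natDegree_le {n : ℕ} (hn : n ≠ 0) (T : ℕ) :
    ({P ∈ traceFactors Fq n | T < P.natDegree}).card ≤ (n - 1) / (T + 1) := by
  rw [Nat.le_div_iff_mul_le (by omega)]
  refine le_trans ?_ (sum_natDegree_traceFactors_le (Fq := Fq) hn)
  refine le_trans ?_ (Finset.sum_le_sum_of_subset
    (Finset.filter_subset (fun P : Fq[X] => T < P.natDegree) _))
  rw [← smul_eq_mul]
  exact Finset.card_nsmul_le_sum _ _ _ fun P hP => (Finset.mem_filter.1 hP).2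

variable [Fintype Fq]

theorem dvd_X_pow_card_pow_natDegree_sub_one {n : ℕ} (hn : n ≠ 0) {P : Fq[X]}
    (hP : P ∈ traceFactors Fq n) : P ∣ X ^ (Fintype.card Fq ^ P.natDegree - 1) - 1 := by
  have hirr := ((mem_traceFactors hn).1 hP).1
  have : Fact (Irreducible P) := ⟨hirr⟩
  have h1 : AdjoinRoot.mk P X ^ n = 1 := by
    have := dvd_X_pow_sub_one_of_mem_traceFactors hn hP
    rwa [← AdjoinRoot.mk_eq_zero, map_sub, map_pow, map_one, sub_eq_zero] at this
  have h2 := (hirr.natDegree_dvd_iff_dvd_X_pow_card_pow_sub_X (n := P.natDegree)).1 dvd_rfl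
  rw [Nat.card_eq_fintype_card] at h2
  rw [← AdjoinRoot.mk_eq_zero, map_sub, map_pow, sub_eq_zero] at h2
  rw [← AdjoinRoot.mk_eq_zero, map_sub, map_pow, map_one, sub_eq_zero]
  have h0 : AdjoinRoot.mk P X ≠ 0 := by
    intro h
    rw [h, zero_pow hn] at h1
    exact zero_ne_one h1
  have hq : Fintype.card Fq ^ P.natDegree = Fintype.card Fq ^ P.natDegree - 1 + 1 :=
    (Nat.sub_add_cancel (Nat.one_le_pow _ _ Fintype.card_pos)).symm
  rw [hq, pow_succ] at h2
  exact mul_right_cancel₀ h0 (h2.trans (one_mul _).symm)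

theorem dvd_X_pow_gcd_of_mem_traceFactors {n : ℕ} (hn : n ≠ 0) {P : Fq[X]}
    (hP : P ∈ traceFactors Fq n) : P ∣ X ^ n.gcd (Fintype.card Fq ^ P.natDegree - 1) - 1 :=
  dvd_X_pow_gcd_sub_one (dvd_X_pow_sub_one_of_mem_traceFactors hn hP)
    (dvd_X_pow_card_pow_natDegree_sub_one hn hP)

/-- An upper bound for the number of irreducible factors of degree `d` of
`1 + X + ⋯ + X ^ (n - 1)` over a field with `q` elements. -/
def factorBound (q n d : ℕ) : ℕ :=
  if d = 1 then n.gcd (q - 1) - (if n.gcd q = 1 then 1 else 0)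
  else (n.gcd (q ^ d - 1) - n.gcd (q - 1)) / d

theorem card_traceFactorsOfDegree_le {n d : ℕ} (hn : n ≠ 0) (hd : d ≠ 0) :
    (traceFactorsOfDegree Fq n d).card ≤ factorBound (Fintype.card Fq) n d := by
  have hmem : ∀ P ∈ traceFactorsOfDegree Fq n d, P ∈ traceFactors Fq n ∧ P.natDegree = d :=
    fun P hP => Finset.mem_filter.1 hP
  have hdvd : ∀ P ∈ traceFactorsOfDegree Fq n d,
      P ∣ X ^ n.gcd (Fintype.card Fq ^ d - 1) - 1 := by
    intro P hP
    obtain ⟨h1, rfl⟩ := hmem P hP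
    exact dvd_X_pow_gcd_of_mem_traceFactors hn h1
  have hg : n.gcd (Fintype.card Fq ^ d - 1) ≠ 0 := (Nat.gcd_pos_of_pos_left _ (by omega)).ne'
  unfold factorBound
  split_ifs with hd1 hc
  · subst hd1
    rw [pow_one] at hdvd hg
    have := mul_card_traceFactorsOfDegree_add_le (G := X - 1) hn hg hdvd
      (by simpa using sub_dvd_pow_sub_pow (X : Fq[X]) 1 (n.gcd (Fintype.card Fq - 1))) (by
        intro P hP hdv
        have hirr := ((mem_traceFactors hn).1 (hmem P hP).1)
        have hX : (X - 1 : Fq[X]) = X - C 1 := by simp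
        have h1 : X - C 1 ∣ tracePoly Fq n := by
          refine Dvd.dvd.trans ?_ hirr.2.2
          rw [hX] at hdv
          exact (hirr.1.associated_of_dvd (irreducible_X_sub_C 1) hdv).symm.dvd
        rw [dvd_iff_isRoot, IsRoot, tracePoly] at h1
        have h2 : (n : Fq) = 0 := by simpa [eval_finsetSum] using h1
        obtain ⟨p, hp⟩ := CharP.exists Fq
        have hpp : p.Prime := CharP.char_is_prime Fq p
        have h3 := (CharP.cast_eq_zero_iff Fq p n).1 h2
        have h4 : p ∣ Fintype.card Fq := by
          obtain ⟨k, -, hk⟩ := FiniteField.card Fq p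
          rw [hk]
          exact dvd_pow_self _ k.pos.ne'
        exact hpp.one_lt.ne' (Nat.dvd_one.1 (hc ▸ Nat.dvd_gcd h3 h4)))
    have h5 : (X - 1 : Fq[X]).natDegree = 1 := by simpa using natDegree_X_sub_C (1 : Fq)
    omega
  · subst hd1
    rw [pow_one] at hdvd hg
    have := mul_card_traceFactorsOfDegree_add_le (G := 1) hn hg hdvd (one_dvd _)
      (fun P hP h => ((mem_traceFactors hn).1 (hmem P hP).1).1.not_isUnit (isUnit_of_dvd_one h))
    omega
  · have hgg : n.gcd (Fintype.card Fq - 1) ∣ n.gcd (Fintype.card Fq ^ d - 1) :=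
      Nat.gcd_dvd_gcd_of_dvd_right _ (by simpa using Nat.sub_dvd_pow_sub_pow (Fintype.card Fq) 1 d)
    have hdv : ∀ {a b : ℕ}, a ∣ b → (X ^ a - 1 : Fq[X]) ∣ X ^ b - 1 := by
      rintro a _ ⟨c, rfl⟩
      simpa [pow_mul] using sub_dvd_pow_sub_pow ((X : Fq[X]) ^ a) 1 c
    have := mul_card_traceFactorsOfDegree_add_le (G := X ^ n.gcd (Fintype.card Fq - 1) - 1)
      hn hg hdvd (hdv hgg) (by
        intro P hP h
        have h1 : P ∣ X ^ Fintype.card Fq ^ 1 - X := by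
          have h2 := h.trans (hdv (Nat.gcd_dvd_right n (Fintype.card Fq - 1)))
          have h3 : (X ^ Fintype.card Fq ^ 1 - X : Fq[X]) =
              (X ^ (Fintype.card Fq - 1) - 1) * X := by
            rw [sub_mul, ← pow_succ, Nat.sub_add_cancel Fintype.card_pos, pow_one, one_mul]
          exact h3 ▸ h2.mul_right _
        have h4 := (((mem_traceFactors hn).1 (hmem P hP).1).1
          |>.natDegree_dvd_iff_dvd_X_pow_card_pow_sub_X (n := 1)).2
            (by rwa [Nat.card_eq_fintype_card])
        rw [(hmem P hP).2] at h4
        exact hd1 (Nat.dvd_one.1 h4))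
    rw [natDegree_X_pow_sub_one] at this
    rw [Nat.le_div_iff_mul_le (Nat.pos_of_ne_zero hd)]
    omega

end FactorCount

/-! ### Splitting the bad events into a core and a sieved part -/

section Split

variable {ι : Type*}

/-- The finite set `T` is a disjoint union of a core, over which the product of the weights
`2 / (1 - 1 / w i)` is at most `W`, and of a sieved part, which has at most `N` elements and over
which the sum of the `1 / w i` is at most `S`. -/
def HasSplit (w : ι → ℝ) (T : Finset ι) (W N S : ℝ) : Prop :=
  (∀ i ∈ T, 1 < w i) ∧ ∃ C D : Finset ι, Disjoint C D ∧ (∀ i, i ∈ T ↔ i ∈ C ∨ i ∈ D) ∧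
    ∏ i ∈ C, 2 / (1 - (w i)⁻¹) ≤ W ∧ (D.card : ℝ) ≤ N ∧ ∑ i ∈ D, (w i)⁻¹ ≤ S

theorem one_le_coreWeight {x : ℝ} (hx : 1 < x) : 1 ≤ 2 / (1 - x⁻¹) := by
  have h1 : x⁻¹ < 1 := inv_lt_one_of_one_lt₀ hx
  have h2 : 0 < x⁻¹ := by positivity
  rw [le_div_iff₀ (by linarith)]
  linarith

theorem coreWeight_eq {x : ℝ} (hx : 1 < x) : 2 / (1 - x⁻¹) = 2 * x / (x - 1) := by
  have : x - 1 ≠ 0 := by linarith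
  have h0 : x ≠ 0 := by linarith
  field_simp

theorem coreWeight_anti {x y : ℝ} (hx : 1 < x) (hxy : x ≤ y) :
    2 / (1 - y⁻¹) ≤ 2 / (1 - x⁻¹) := by
  have h1 : x⁻¹ < 1 := inv_lt_one_of_one_lt₀ hx
  have h2 : y⁻¹ ≤ x⁻¹ := inv_anti₀ (by linarith) hxy
  exact div_le_div_of_nonneg_left (by norm_num) (by linarith) (by linarith)

namespace HasSplit

variable {w : ι → ℝ} {T T' : Finset ι} {W W' N N' S S' : ℝ}

theorem mono (h : HasSplit w T W N S) (hW : W ≤ W') (hN : N ≤ N') (hS : S ≤ S') :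
    HasSplit w T W' N' S' := by
  obtain ⟨hw, C, D, h1, h2, h3, h4, h5⟩ := h
  exact ⟨hw, C, D, h1, h2, h3.trans hW, h4.trans hN, h5.trans hS⟩

theorem one_le (h : HasSplit w T W N S) : 1 ≤ W := by
  obtain ⟨hw, C, D, -, h2, h3, -⟩ := h
  refine le_trans ?_ h3
  have := Finset.prod_le_prod (s := C) (f := fun _ => (1 : ℝ))
    (g := fun i => 2 / (1 - (w i)⁻¹)) (fun _ _ => zero_le_one)
    fun i hi => one_le_coreWeight (hw i ((h2 i).2 (Or.inl hi)))
  simpa using this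

theorem card_nonneg (h : HasSplit w T W N S) : 0 ≤ N := by
  obtain ⟨-, C, D, -, -, -, h4, -⟩ := h
  exact (Nat.cast_nonneg _).trans h4

theorem union [DecidableEq ι] (h : HasSplit w T W N S) (h' : HasSplit w T' W' N' S')
    (hd : Disjoint T T') : HasSplit w (T ∪ T') (W * W') (N + N') (S + S') := by
  have hW := h.one_le
  obtain ⟨hw, C, D, h1, h2, h3, h4, h5⟩ := h
  obtain ⟨hw', C', D', h1', h2', h3', h4', h5'⟩ := h'
  have hsub : ∀ {i}, i ∈ T → i ∈ T' → False := fun a b => Finset.disjoint_left.1 hd a b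
  have hCC : Disjoint C C' := Finset.disjoint_left.2 fun i a b =>
    hsub ((h2 i).2 (Or.inl a)) ((h2' i).2 (Or.inl b))
  have hDD : Disjoint D D' := Finset.disjoint_left.2 fun i a b =>
    hsub ((h2 i).2 (Or.inr a)) ((h2' i).2 (Or.inr b))
  refine ⟨fun i hi => (Finset.mem_union.1 hi).elim (hw i) (hw' i), C ∪ C', D ∪ D', ?_, ?_, ?_,
    ?_, ?_⟩
  · rw [Finset.disjoint_left] at *
    intro i hi hi'
    rw [Finset.mem_union] at hi hi'
    rcases hi with hi | hi <;> rcases hi' with hi' | hi'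
    · exact h1 hi hi'
    · exact hsub ((h2 i).2 (Or.inl hi)) ((h2' i).2 (Or.inr hi'))
    · exact hsub ((h2 i).2 (Or.inr hi')) ((h2' i).2 (Or.inl hi))
    · exact h1' hi hi'
  · intro i
    simp only [Finset.mem_union, h2, h2']
    tauto
  · rw [Finset.prod_union hCC]
    refine mul_le_mul h3 h3' (Finset.prod_nonneg fun i hi => ?_) (by linarith)
    exact zero_le_one.trans (one_le_coreWeight (hw' i ((h2' i).2 (Or.inl hi))))
  · rw [Finset.card_union_of_disjoint hDD]
    push_cast
    linarith
  · rw [Finset.sum_union hDD]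
    linarith

theorem of_core (hw : ∀ i ∈ T, 1 < w i) (h : ∏ i ∈ T, 2 / (1 - (w i)⁻¹) ≤ W) :
    HasSplit w T W 0 0 :=
  ⟨hw, T, ∅, by simp, by simp, h, by simp, by simp⟩

theorem of_sieve (hw : ∀ i ∈ T, 1 < w i) (hN : (T.card : ℝ) ≤ N) (hS : ∑ i ∈ T, (w i)⁻¹ ≤ S) :
    HasSplit w T 1 N S :=
  ⟨hw, ∅, T, by simp, by simp, by simp, hN, hS⟩

theorem of_sieve_le {b : ℝ} (hb : 1 < b) (hw : ∀ i ∈ T, b ≤ w i) {r : ℕ} (hr : T.card ≤ r) :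
    HasSplit w T 1 r (r * b⁻¹) := by
  have hr' : (T.card : ℝ) ≤ r := by exact_mod_cast hr
  refine of_sieve (fun i hi => hb.trans_le (hw i hi)) hr' ?_
  have h := Finset.sum_le_card_nsmul T (fun i => (w i)⁻¹) b⁻¹
    fun i hi => inv_anti₀ (by linarith) (hw i hi)
  rw [nsmul_eq_mul] at h
  exact h.trans (mul_le_mul_of_nonneg_right hr' (by positivity))

theorem of_const {b : ℝ} (hb : 1 < b) (hw : ∀ i ∈ T, w i = b) {c u : ℕ} (hc : T.card ≤ c) :
    HasSplit w T ((2 / (1 - b⁻¹)) ^ u) ((c - u : ℕ) : ℝ) ((c - u : ℕ) * b⁻¹) := by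
  classical
  have hb1 := one_le_coreWeight hb
  obtain ⟨C, hCT, hC⟩ := Finset.exists_subset_card_eq (min_le_left T.card u)
  have h1 : HasSplit w C ((2 / (1 - b⁻¹)) ^ u) 0 0 := by
    refine of_core (fun i hi => by rw [hw i (hCT hi)]; exact hb) ?_
    rw [Finset.prod_congr rfl fun i hi => by rw [hw i (hCT hi)], Finset.prod_const, hC]
    exact pow_le_pow_right₀ hb1 (min_le_right _ _)
  have h2 : HasSplit w (T \ C) 1 ((c - u : ℕ) : ℝ) ((c - u : ℕ) * b⁻¹) := by
    refine of_sieve_le hb (fun i hi => (hw i (Finset.mem_sdiff.1 hi).1).ge) ?_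
    rw [Finset.card_sdiff_of_subset hCT, hC]
    omega
  have h3 := h1.union h2 Finset.disjoint_sdiff
  rwa [Finset.union_sdiff_of_subset hCT, mul_one, zero_add, zero_add] at h3

end HasSplit

end Split

section Criterion

variable {Fq F : Type*} [Field Fq] [Field F] [Fintype Fq] [Fintype F] [Algebra Fq F]

theorem exists_of_hasSplit {n M : ℕ} (hn : Module.finrank Fq F = n)
    (hM : M * (Fintype.card Fq - 1) = Fintype.card Fq ^ n - 1) {W₀ N₀ S₀ W₁ N₁ S₁ W₂ N₂ S₂ : ℝ}
    (h₀ : HasSplit (fun ℓ : ℕ => (ℓ : ℝ)) M.primeFactors W₀ N₀ S₀)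
    (h₁ : HasSplit (fun P : Fq[X] => (Fintype.card Fq : ℝ) ^ P.natDegree)
      (traceFactors Fq n) W₁ N₁ S₁)
    (h₂ : HasSplit (fun P : Fq[X] => (Fintype.card Fq : ℝ) ^ P.natDegree)
      (traceFactors Fq n) W₂ N₂ S₂)
    (hS : S₀ + S₁ + S₂ < 1)
    (hlt : 4 * (Fintype.card Fq : ℝ) ^ n * (Fintype.card Fq : ℝ) ^ 4 *
      ((1 + (N₀ + N₁ + N₂)) * (W₀ * W₁ * W₂)) ^ 2 <
      (((Fintype.card Fq : ℝ) ^ n - 1) * (1 - (S₀ + S₁ + S₂))) ^ 2) :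
    ∃ α : F, α ≠ 0 ∧ orderOf α = Fintype.card Fq ^ n - 1 ∧
      orderOf α⁻¹ = Fintype.card Fq ^ n - 1 ∧
      IsKNormal Fq (Fintype.card Fq) n 1 α ∧ IsKNormal Fq (Fintype.card Fq) n 1 α⁻¹ := by
  have hW₀ := h₀.one_le
  have hW₁ := h₁.one_le
  have hW₂ := h₂.one_le
  have hN₀ := h₀.card_nonneg
  have hN₁ := h₁.card_nonneg
  have hN₂ := h₂.card_nonneg
  obtain ⟨hw₀, C₀, D₀, d₀, u₀, p₀, c₀, s₀⟩ := h₀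
  obtain ⟨hw₁, C₁, D₁, d₁, u₁, p₁, c₁, s₁⟩ := h₁
  obtain ⟨-, C₂, D₂, d₂, u₂, p₂, c₂, s₂⟩ := h₂
  have hq1 : (1 : ℝ) < Fintype.card Fq := by exact_mod_cast Fintype.one_lt_card
  have hQ : (1 : ℝ) ≤ (Fintype.card Fq : ℝ) ^ n := one_le_pow₀ hq1.le
  refine exists_of_sieve hn hM d₀ d₁ d₂ u₀ u₁ u₂ ?_
  have hpos₁ : 0 ≤ ∏ P ∈ C₁, 2 / (1 - ((Fintype.card Fq : ℝ) ^ P.natDegree)⁻¹) :=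
    Finset.prod_nonneg fun i hi =>
      zero_le_one.trans (one_le_coreWeight (hw₁ i ((u₁ i).2 (Or.inl hi))))
  have hpos₂ : 0 ≤ ∏ P ∈ C₂, 2 / (1 - ((Fintype.card Fq : ℝ) ^ P.natDegree)⁻¹) :=
    Finset.prod_nonneg fun i hi =>
      zero_le_one.trans (one_le_coreWeight (hw₁ i ((u₂ i).2 (Or.inl hi))))
  have hp : (∏ ℓ ∈ C₀, 2 / (1 - (ℓ : ℝ)⁻¹)) *
      ((∏ P ∈ C₁, 2 / (1 - ((Fintype.card Fq : ℝ) ^ P.natDegree)⁻¹)) *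
      ∏ P ∈ C₂, 2 / (1 - ((Fintype.card Fq : ℝ) ^ P.natDegree)⁻¹)) ≤ W₀ * W₁ * W₂ := by
    rw [mul_assoc]
    exact mul_le_mul p₀ (mul_le_mul p₁ p₂ hpos₂ (by linarith)) (mul_nonneg hpos₁ hpos₂)
      (by linarith)
  have hsq : 2 * √((Fintype.card Fq : ℝ) ^ n) * (Fintype.card Fq : ℝ) ^ 2 *
      ((1 + (N₀ + N₁ + N₂)) * (W₀ * W₁ * W₂)) <
      ((Fintype.card Fq : ℝ) ^ n - 1) * (1 - (S₀ + S₁ + S₂)) := by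
    refine lt_of_pow_lt_pow_left₀ 2 (mul_nonneg (by linarith) (by linarith)) ?_
    refine lt_of_eq_of_lt ?_ hlt
    have := Real.sq_sqrt (zero_le_one.trans hQ)
    linear_combination 4 * (Fintype.card Fq : ℝ) ^ 4 *
      ((1 + (N₀ + N₁ + N₂)) * (W₀ * W₁ * W₂)) ^ 2 * this
  refine lt_of_le_of_lt ?_ (hsq.trans_le ?_)
  · rw [mul_assoc (2 * _ * _)]
    refine mul_le_mul_of_nonneg_left (mul_le_mul (by linarith) hp ?_ (by linarith)) (by positivity)
    exact mul_nonneg (Finset.prod_nonneg fun i hi =>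
      zero_le_one.trans (one_le_coreWeight (hw₀ i ((u₀ i).2 (Or.inl hi))))) (mul_nonneg hpos₁ hpos₂)
  · exact mul_le_mul_of_nonneg_left (by linarith) (by linarith)

/-- The irreducible factors of degree at most `T` are split degree by degree, those of larger
degree are sieved. -/
theorem hasSplit_traceFactors {n : ℕ} (hn : n ≠ 0) (u : ℕ → ℕ) (T : ℕ) :
    HasSplit (fun P : Fq[X] => (Fintype.card Fq : ℝ) ^ P.natDegree) (traceFactors Fq n)
      (∏ d ∈ Finset.range T, (2 / (1 - ((Fintype.card Fq : ℝ) ^ (d + 1))⁻¹)) ^ u d)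
      (∑ d ∈ Finset.range T, ((factorBound (Fintype.card Fq) n (d + 1) - u d : ℕ) : ℝ) +
        ((n - 1) / (T + 1) : ℕ))
      (∑ d ∈ Finset.range T, (factorBound (Fintype.card Fq) n (d + 1) - u d : ℕ) *
        ((Fintype.card Fq : ℝ) ^ (d + 1))⁻¹ +
        ((n - 1) / (T + 1) : ℕ) * ((Fintype.card Fq : ℝ) ^ (T + 1))⁻¹) := by
  classical
  have hq1 : (1 : ℝ) < Fintype.card Fq := by exact_mod_cast Fintype.one_lt_card
  have hle : HasSplit (fun P : Fq[X] => (Fintype.card Fq : ℝ) ^ P.natDegree)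
      {P ∈ traceFactors Fq n | P.natDegree ≤ T}
      (∏ d ∈ Finset.range T, (2 / (1 - ((Fintype.card Fq : ℝ) ^ (d + 1))⁻¹)) ^ u d)
      (∑ d ∈ Finset.range T, ((factorBound (Fintype.card Fq) n (d + 1) - u d : ℕ) : ℝ))
      (∑ d ∈ Finset.range T, (factorBound (Fintype.card Fq) n (d + 1) - u d : ℕ) *
        ((Fintype.card Fq : ℝ) ^ (d + 1))⁻¹) := by
    induction T with
    | zero =>
      have h0 : {P ∈ traceFactors Fq n | P.natDegree ≤ 0} = ∅ := by
        rw [Finset.filter_eq_empty_iff]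
        intro P hP
        have := natDegree_pos_of_mem_traceFactors hn hP
        omega
      rw [h0]
      simpa using HasSplit.of_core (W := 1) (w := fun P : Fq[X] =>
        (Fintype.card Fq : ℝ) ^ P.natDegree) (T := ∅) (by simp) (by simp)
    | succ T ih =>
      have h1 : {P ∈ traceFactors Fq n | P.natDegree ≤ T + 1} =
          {P ∈ traceFactors Fq n | P.natDegree ≤ T} ∪ traceFactorsOfDegree Fq n (T + 1) := by
        rw [traceFactorsOfDegree, ← Finset.filter_or]
        exact Finset.filter_congr fun P _ => by omega
      rw [h1, Finset.prod_range_succ, Finset.sum_range_succ, Finset.sum_range_succ]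
      refine ih.union (HasSplit.of_const (one_lt_pow₀ hq1 (Nat.succ_ne_zero T)) (fun P hP => ?_)
        (card_traceFactorsOfDegree_le hn (Nat.succ_ne_zero T))) ?_
      · rw [(Finset.mem_filter.1 hP).2]
      · rw [Finset.disjoint_left]
        intro P hP hP'
        have h2 := (Finset.mem_filter.1 hP).2
        have h3 := (Finset.mem_filter.1 hP').2
        omega
  have hgt : HasSplit (fun P : Fq[X] => (Fintype.card Fq : ℝ) ^ P.natDegree)
      {P ∈ traceFactors Fq n | T < P.natDegree} 1 ((n - 1) / (T + 1) : ℕ)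
      (((n - 1) / (T + 1) : ℕ) * ((Fintype.card Fq : ℝ) ^ (T + 1))⁻¹) :=
    HasSplit.of_sieve_le (one_lt_pow₀ hq1 (Nat.succ_ne_zero T))
      (fun P hP => pow_le_pow_right₀ hq1.le (Finset.mem_filter.1 hP).2)
      (card_filter_lt_natDegree_le hn T)
  have h := hle.union hgt (by
    rw [Finset.disjoint_left]
    intro P hP hP'
    have h2 := (Finset.mem_filter.1 hP).2
    have h3 := (Finset.mem_filter.1 hP').2
    omega)
  rw [mul_one] at h
  convert h using 1
  rw [← Finset.filter_or, Finset.filter_true_of_mem fun P _ => le_or_gt _ _]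

end Criterion

/-! ### Prime factors -/

section Primes

theorem one_lt_of_mem_primeFactors {M ℓ : ℕ} (h : ℓ ∈ M.primeFactors) : (1 : ℝ) < ℓ := by
  exact_mod_cast (Nat.prime_of_mem_primeFactors h).one_lt

theorem pow_card_mul_prod_primeFactors_le {M B : ℕ} (hM : M ≠ 0) :
    B ^ ({ℓ ∈ M.primeFactors | B ≤ ℓ}).card * ∏ ℓ ∈ M.primeFactors with ℓ < B, ℓ ≤ M := by
  refine le_trans ?_ (Nat.le_of_dvd (Nat.pos_of_ne_zero hM) (Nat.prod_primeFactors_dvd M))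
  rw [← Finset.prod_filter_mul_prod_filter_not M.primeFactors (B ≤ ·)]
  simp only [not_le]
  exact Nat.mul_le_mul_right _ (Finset.pow_card_le_prod _ _ _ fun ℓ hℓ => (Finset.mem_filter.1 hℓ).2)

/-- The primes from `B` on are sieved. -/
theorem hasSplit_primeFactors {M B r : ℕ} (hM : M ≠ 0) (hB : 1 < B) {W N S : ℝ}
    (hsmall : HasSplit (fun ℓ : ℕ => (ℓ : ℝ)) {ℓ ∈ M.primeFactors | ℓ < B} W N S)
    (hr : M < B ^ (r + 1) * ∏ ℓ ∈ M.primeFactors with ℓ < B, ℓ) :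
    HasSplit (fun ℓ : ℕ => (ℓ : ℝ)) M.primeFactors W (N + r) (S + r * (B : ℝ)⁻¹) := by
  have hcard : ({ℓ ∈ M.primeFactors | B ≤ ℓ}).card ≤ r := by
    have h1 := (pow_card_mul_prod_primeFactors_le (B := B) hM).trans_lt hr
    have h2 := (Nat.pow_lt_pow_iff_right hB).1 (lt_of_mul_lt_mul_right h1 (Nat.zero_le _))
    omega
  have hlarge : HasSplit (fun ℓ : ℕ => (ℓ : ℝ)) {ℓ ∈ M.primeFactors | B ≤ ℓ} 1 r
      (r * (B : ℝ)⁻¹) :=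
    HasSplit.of_sieve_le (by exact_mod_cast hB)
      (fun ℓ hℓ => by exact_mod_cast (Finset.mem_filter.1 hℓ).2) hcard
  have h := hsmall.union hlarge (by
    rw [Finset.disjoint_left]
    intro P hP hP'
    have h2 := (Finset.mem_filter.1 hP).2
    have h3 := (Finset.mem_filter.1 hP').2
    omega)
  rw [mul_one] at h
  convert h using 1
  rw [← Finset.filter_or, Finset.filter_true_of_mem fun P _ => lt_or_ge _ _]

end Primes

/-! ### A computable form of the criterion -/

/-- The conclusion of the main theorem for the extension `F / Fq`. -/
def HasPrimitiveOneNormalPair (Fq F : Type*) [Field Fq] [Field F] [Algebra Fq F]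
    (q n : ℕ) : Prop :=
  ∃ α : F, α ≠ 0 ∧ orderOf α = q ^ n - 1 ∧ orderOf α⁻¹ = q ^ n - 1 ∧
    IsKNormal Fq q n 1 α ∧ IsKNormal Fq q n 1 α⁻¹

/-- Integer data certifying a split: the product of the core weights is at most `num / den`, the
sieved part has at most `cnt` elements, and its sum of reciprocals is at most `sig / 2 ^ 40`. -/
structure SplitData where
  num : ℕ
  den : ℕ
  cnt : ℕ
  sig : ℕ

namespace SplitData

def mul (a b : SplitData) : SplitData :=
  ⟨a.num * b.num, a.den * b.den, a.cnt + b.cnt, a.sig + b.sig⟩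

def Valid {ι : Type*} (s : SplitData) (w : ι → ℝ) (T : Finset ι) : Prop :=
  0 < s.den ∧ HasSplit w T ((s.num : ℝ) / s.den) s.cnt ((s.sig : ℝ) / 2 ^ 40)

theorem Valid.union {ι : Type*} [DecidableEq ι] {a b : SplitData} {w : ι → ℝ} {T T' : Finset ι}
    (ha : a.Valid w T) (hb : b.Valid w T') (hd : Disjoint T T') : (a.mul b).Valid w (T ∪ T') := by
  refine ⟨Nat.mul_pos ha.1 hb.1, ?_⟩
  have := ha.2.union hb.2 hd
  rw [div_mul_div_comm, ← add_div] at this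
  simpa [mul] using this

end SplitData

theorem inv_le_two_pow_forty_div {a : ℕ} (ha : 0 < a) :
    ((a : ℝ))⁻¹ ≤ ((2 ^ 40 / a + 1 : ℕ) : ℝ) / 2 ^ 40 := by
  have h1 : (2 ^ 40 : ℕ) < a * (2 ^ 40 / a + 1) := Nat.lt_mul_div_succ _ ha
  have h2 : (2 ^ 40 : ℝ) < a * ((2 ^ 40 / a + 1 : ℕ) : ℝ) := by exact_mod_cast h1
  have ha' : (0 : ℝ) < a := by exact_mod_cast ha
  rw [le_div_iff₀ (by positivity), inv_mul_le_iff₀ ha']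
  exact h2.le

/-- The primes below `128`. -/
def trialPrimes : List ℕ :=
  [2, 3, 5, 7, 11, 13, 17, 19, 23, 29, 31, 37, 41, 43, 47, 53, 59, 61, 67, 71, 73, 79, 83, 89, 97,
    101, 103, 107, 109, 113, 127]

theorem prime_of_mem_trialPrimes {ℓ : ℕ} (h : ℓ ∈ trialPrimes) : ℓ.Prime := by
  have : ∀ ℓ ∈ trialPrimes, ℓ.Prime := by norm_num [trialPrimes]
  exact this ℓ h

theorem mem_trialPrimes {ℓ : ℕ} (h : ℓ.Prime) (hlt : ℓ < 128) : ℓ ∈ trialPrimes := by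
  have : ∀ ℓ < 128, ℓ ∈ trialPrimes ∨ ℓ < 2 ∨ ∃ d ∈ [2, 3, 5, 7, 11], d ∣ ℓ ∧ d < ℓ := by decide
  obtain h1 | h1 | ⟨d, hd, h1, h2⟩ := this ℓ hlt
  · exact h1
  · exact absurd h.two_le (by omega)
  · rcases (Nat.dvd_prime h).1 h1 with rfl | rfl
    · simp at hd
    · omega

def smallPrimeData (M L : ℕ) : List ℕ → SplitData
  | [] => ⟨1, 1, 0, 0⟩
  | ℓ :: l => cond ((M % ℓ).beq 0)
      (cond (ℓ.ble L) (.mul ⟨2 * ℓ, ℓ - 1, 0, 0⟩ (smallPrimeData M L l))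
        (.mul ⟨1, 1, 1, 2 ^ 40 / ℓ + 1⟩ (smallPrimeData M L l)))
      (smallPrimeData M L l)

def smallPrimePart (M : ℕ) : List ℕ → ℕ
  | [] => 1
  | ℓ :: l => cond ((M % ℓ).beq 0) (ℓ * smallPrimePart M l) (smallPrimePart M l)

theorem filter_mem_cons_primeFactors {M ℓ : ℕ} {l : List ℕ} (hM : M ≠ 0) (hℓ : ℓ.Prime) :
    {x ∈ M.primeFactors | x ∈ ℓ :: l} =
      if ℓ ∣ M then {ℓ} ∪ {x ∈ M.primeFactors | x ∈ l} else {x ∈ M.primeFactors | x ∈ l} := by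
  ext x
  split_ifs with h <;>
    simp only [Finset.mem_filter, Nat.mem_primeFactors, List.mem_cons, Finset.mem_union,
      Finset.mem_singleton]
  · constructor
    · tauto
    · rintro (rfl | h')
      · exact ⟨⟨hℓ, h, hM⟩, Or.inl rfl⟩
      · tauto
  · constructor
    · rintro ⟨h1, rfl | h2⟩
      · exact absurd h1.2.1 h
      · exact ⟨h1, h2⟩
    · tauto

theorem smallPrimePart_eq {M : ℕ} (hM : M ≠ 0) {l : List ℕ} (hl : ∀ ℓ ∈ l, ℓ.Prime)
    (hnd : l.Nodup) : smallPrimePart M l = ∏ x ∈ M.primeFactors with x ∈ l, x := by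
  induction l with
  | nil => simp [smallPrimePart]
  | cons ℓ l ih =>
    rw [List.nodup_cons] at hnd
    rw [filter_mem_cons_primeFactors hM (hl ℓ List.mem_cons_self), smallPrimePart,
      ih (fun x hx => hl x (List.mem_cons_of_mem _ hx)) hnd.2]
    by_cases h : ℓ ∣ M
    · rw [if_pos h, Nat.mod_eq_zero_of_dvd h, Finset.prod_union, Finset.prod_singleton]
      · rfl
      · simp [hnd.1]
    · have : (M % ℓ).beq 0 = false := by
        rw [← Bool.not_eq_true, Nat.beq_eq]
        exact fun h' => h (Nat.dvd_of_mod_eq_zero h')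
      rw [if_neg h, this]
      rfl

theorem valid_smallPrimeData {M : ℕ} (hM : M ≠ 0) (L : ℕ) {l : List ℕ} (hl : ∀ ℓ ∈ l, ℓ.Prime)
    (hnd : l.Nodup) : (smallPrimeData M L l).Valid (fun ℓ : ℕ => (ℓ : ℝ))
      {x ∈ M.primeFactors | x ∈ l} := by
  induction l with
  | nil =>
    refine ⟨one_pos, ?_⟩
    simpa [smallPrimeData] using HasSplit.of_core (W := 1) (w := fun ℓ : ℕ => (ℓ : ℝ)) (T := ∅)
      (by simp) (by simp)
  | cons ℓ l ih =>
    rw [List.nodup_cons] at hnd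
    have hp := hl ℓ List.mem_cons_self
    have hp1 : (1 : ℝ) < ℓ := by exact_mod_cast hp.one_lt
    replace ih := ih (fun x hx => hl x (List.mem_cons_of_mem _ hx)) hnd.2
    rw [filter_mem_cons_primeFactors hM hp, smallPrimeData]
    by_cases h : ℓ ∣ M
    · rw [if_pos h, Nat.mod_eq_zero_of_dvd h]
      have hdisj : Disjoint {ℓ} {x ∈ M.primeFactors | x ∈ l} := by simp [hnd.1]
      cases ℓ.ble L
      · refine SplitData.Valid.union ⟨one_pos, ?_⟩ ih hdisj
        refine (HasSplit.of_sieve (N := 1) (S := (ℓ : ℝ)⁻¹) (by simpa using hp1) (by simp)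
          (by simp)).mono (by simp) (by simp) (inv_le_two_pow_forty_div hp.pos)
      · refine SplitData.Valid.union ⟨Nat.sub_pos_of_lt hp.one_lt, ?_⟩ ih hdisj
        refine (HasSplit.of_core (W := 2 / (1 - (ℓ : ℝ)⁻¹)) (by simpa using hp1) (by simp)).mono ?_
          (by simp) (by simp)
        rw [coreWeight_eq hp1]
        push_cast [hp.one_le]
        rfl
    · have : (M % ℓ).beq 0 = false := by
        rw [← Bool.not_eq_true, Nat.beq_eq]
        exact fun h' => h (Nat.dvd_of_mod_eq_zero h')
      rw [if_neg h, this]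
      exact ih

/-- Data for the prime factors of `M`: those up to `L` are in the core. -/
def primeData (M L : ℕ) : SplitData :=
  .mul (smallPrimeData M L trialPrimes)
    ⟨1, 1, (M / smallPrimePart M trialPrimes).log2 / 7,
      (M / smallPrimePart M trialPrimes).log2 / 7 * 2 ^ 33⟩

theorem valid_primeData {M : ℕ} (hM : M ≠ 0) (L : ℕ) :
    (primeData M L).Valid (fun ℓ : ℕ => (ℓ : ℝ)) M.primeFactors := by
  have hl : ∀ ℓ ∈ trialPrimes, ℓ.Prime := fun _ => prime_of_mem_trialPrimes
  have hnd : trialPrimes.Nodup := by decide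
  have hfilter : {x ∈ M.primeFactors | x ∈ trialPrimes} = {x ∈ M.primeFactors | x < 128} := by
    refine Finset.filter_congr fun x hx => ⟨fun h => ?_,
      mem_trialPrimes (Nat.prime_of_mem_primeFactors hx)⟩
    have : ∀ x ∈ trialPrimes, x < 128 := by decide
    exact this x h
  have h := valid_smallPrimeData hM L hl hnd
  have hP := smallPrimePart_eq hM hl hnd
  rw [hfilter] at h hP
  have hpos : 0 < smallPrimePart M trialPrimes := by
    rw [hP]
    exact Finset.prod_pos fun x hx => (Nat.prime_of_mem_primeFactors (Finset.mem_filter.1 hx).1).pos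
  refine ⟨by simpa [primeData, SplitData.mul] using h.1, ?_⟩
  have h2 := hasSplit_primeFactors (B := 128)
    (r := (M / smallPrimePart M trialPrimes).log2 / 7) hM (by norm_num) h.2 (by
      rw [← hP]
      have h3 : M / smallPrimePart M trialPrimes <
          128 ^ ((M / smallPrimePart M trialPrimes).log2 / 7 + 1) := by
        refine Nat.lt_log2_self.trans_le ?_
        rw [show 128 = 2 ^ 7 by norm_num, ← pow_mul]
        exact Nat.pow_le_pow_right (by norm_num) (by omega)
      exact (Nat.div_lt_iff_lt_mul hpos).1 h3)
  refine h2.mono (by simp [primeData, SplitData.mul]) (by simp [primeData, SplitData.mul]) ?_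
  simp only [primeData, SplitData.mul]
  push_cast
  rw [add_div]
  refine add_le_add le_rfl (le_of_eq ?_)
  ring

/-- Data for the irreducible factors of degree at most `T`; the core consists of `v` factors of
degree `1` and of all factors of degree between `2` and `t`. -/
def factorData (q n v t : ℕ) : ℕ → SplitData
  | 0 => ⟨1, 1, 0, 0⟩
  | d + 1 => .mul (factorData q n v t d)
      ((fun c u => ⟨(2 * q ^ (d + 1)) ^ u, (q ^ (d + 1) - 1) ^ u, c - u,
        (c - u) * (2 ^ 40 / q ^ (d + 1) + 1)⟩ : ℕ → ℕ → SplitData)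
        (factorBound q n (d + 1))
        (min (factorBound q n (d + 1)) (cond (d.beq 0) v (cond (d.blt t) 1000 0))))

/-- Data for all irreducible factors of `1 + X + ⋯ + X ^ (n - 1)`. -/
def sideData (q n v t T : ℕ) : SplitData :=
  .mul (factorData q n v t T)
    ⟨1, 1, (n - 1) / (T + 1), (n - 1) / (T + 1) * (2 ^ 40 / q ^ (T + 1) + 1)⟩

theorem valid_sideData {Fq : Type*} [Field Fq] [Fintype Fq] {n : ℕ} (hn : n ≠ 0) (v t T : ℕ) :
    (sideData (Fintype.card Fq) n v t T).Valid
      (fun P : Fq[X] => (Fintype.card Fq : ℝ) ^ P.natDegree) (traceFactors Fq n) := by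
  set q := Fintype.card Fq with hq
  have hq1 : 1 < q := Fintype.one_lt_card
  have hqd : ∀ d, 1 < q ^ (d + 1) := fun d => Nat.one_lt_pow (Nat.succ_ne_zero d) hq1
  set u : ℕ → ℕ := fun d =>
    min (factorBound q n (d + 1)) (cond (d.beq 0) v (cond (d.blt t) 1000 0)) with hu
  have hsig : ∀ a b : ℕ, (a : ℝ) * ((q : ℝ) ^ (b + 1))⁻¹ ≤
      ((a * (2 ^ 40 / q ^ (b + 1) + 1) : ℕ) : ℝ) / 2 ^ 40 := by
    intro a b
    rw [Nat.cast_mul, mul_div_assoc]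
    refine mul_le_mul_of_nonneg_left ?_ (Nat.cast_nonneg _)
    exact_mod_cast inv_le_two_pow_forty_div (zero_lt_one.trans (hqd b))
  have key : ∀ T : ℕ, 0 < (factorData q n v t T).den ∧
      ∏ d ∈ Finset.range T, (2 / (1 - ((q : ℝ) ^ (d + 1))⁻¹)) ^ u d =
        ((factorData q n v t T).num : ℝ) / (factorData q n v t T).den ∧
      ∑ d ∈ Finset.range T, ((factorBound q n (d + 1) - u d : ℕ) : ℝ) =
        (factorData q n v t T).cnt ∧
      ∑ d ∈ Finset.range T, (factorBound q n (d + 1) - u d : ℕ) * ((q : ℝ) ^ (d + 1))⁻¹ ≤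
        ((factorData q n v t T).sig : ℝ) / 2 ^ 40 := by
    intro T
    induction T with
    | zero => simp [factorData]
    | succ d ih =>
      obtain ⟨h1, h2, h3, h4⟩ := ih
      have hd : (1 : ℝ) < (q : ℝ) ^ (d + 1) := by exact_mod_cast hqd d
      rw [Finset.prod_range_succ, Finset.sum_range_succ, Finset.sum_range_succ, h2, h3]
      refine ⟨Nat.mul_pos h1 (Nat.pow_pos (Nat.sub_pos_of_lt (hqd d))), ?_, ?_, ?_⟩
      · rw [coreWeight_eq hd, div_pow, div_mul_div_comm]
        simp only [factorData, SplitData.mul]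
        push_cast [(hqd d).le]
        rfl
      · simp only [factorData, SplitData.mul]
        push_cast
        rfl
      · simp only [factorData, SplitData.mul]
        rw [Nat.cast_add, add_div]
        exact add_le_add h4 (hsig _ d)
  obtain ⟨h1, h2, h3, h4⟩ := key T
  have h := hasSplit_traceFactors (Fq := Fq) hn u T
  rw [← hq, h2, h3] at h
  refine ⟨by simpa [sideData, SplitData.mul] using h1, h.mono ?_ ?_ ?_⟩
  · simp [sideData, SplitData.mul]
  · simp [sideData, SplitData.mul]
  · simp only [sideData, SplitData.mul]
    rw [Nat.cast_add, add_div]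
    exact add_le_add h4 (hsig _ T)

/-- The criterion for a given split, with trial division of `M = (q ^ n - 1) / (q - 1)`. -/
def sieveCheck (q n M L v₁ t₁ v₂ t₂ T : ℕ) : Bool :=
  (fun s : SplitData => Nat.blt (4 * q ^ n * q ^ 4 * ((1 + s.cnt) * s.num * 2 ^ 40) ^ 2)
    (((q ^ n - 1) * s.den * (2 ^ 40 - s.sig)) ^ 2))
    (.mul (primeData M L) (.mul (sideData q n v₁ t₁ T) (sideData q n v₂ t₂ T)))

/-- The criterion for a given split, with all the primes in the core. -/
def weightCheck (q n M v₁ t₁ v₂ t₂ T : ℕ) : Bool :=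
  (fun s : SplitData => Nat.blt
    ((4 * q ^ n * q ^ 4 * ((1 + s.cnt) * s.num * 2 ^ 40) ^ 2) ^ 7 * (2 ^ 78 * M) ^ 2)
    (((q ^ n - 1) * s.den * (2 ^ 40 - s.sig)) ^ 14))
    (.mul (sideData q n v₁ t₁ T) (sideData q n v₂ t₂ T))

theorem one_sub_sum_sig_eq {a b c e : ℕ} (he : e = 2 ^ 40 - (a + (b + c))) (he0 : 0 < e) :
    1 - ((a : ℝ) / 2 ^ 40 + b / 2 ^ 40 + c / 2 ^ 40) = e / 2 ^ 40 := by
  have h1 : e + (a + (b + c)) = 2 ^ 40 := by omega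
  have h2 : (e : ℝ) + (a + (b + c)) = 2 ^ 40 := by exact_mod_cast h1
  rw [← add_div, ← add_div, eq_div_iff (by positivity), sub_mul, div_mul_cancel₀ _ (by positivity)]
  linarith

/-- With all primes in the core, the weight is at most `2 ^ (78 / 7) * M ^ (1 / 7)`. -/
theorem exists_hasSplit_primeFactors_weight {M : ℕ} (hM : M ≠ 0) :
    ∃ W : ℝ, HasSplit (fun ℓ : ℕ => (ℓ : ℝ)) M.primeFactors W 0 0 ∧ W ^ 7 ≤ 2 ^ 78 * M := by
  refine ⟨_, HasSplit.of_core (fun ℓ => one_lt_of_mem_primeFactors) le_rfl, ?_⟩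
  rw [← Finset.prod_pow]
  set A : Finset ℕ := insert 131 trialPrimes.toFinset with hA
  set κ : ℕ → ℝ := fun ℓ => if ℓ ∈ A then (2 * ℓ / (ℓ - 1)) ^ 7 / ℓ else 1 with hκ
  have hprime : ∀ ℓ ∈ A, ℓ.Prime ∧ ℓ < 132 := by
    have h1 : ∀ ℓ ∈ trialPrimes, ℓ < 132 := by decide
    intro ℓ hℓ
    rw [hA, Finset.mem_insert, List.mem_toFinset] at hℓ
    rcases hℓ with rfl | hℓ
    · norm_num
    · exact ⟨prime_of_mem_trialPrimes hℓ, h1 ℓ hℓ⟩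
  have hf : ∀ ℓ ∈ M.primeFactors, (2 / (1 - (ℓ : ℝ)⁻¹)) ^ 7 ≤ κ ℓ * ℓ := by
    intro ℓ hℓ
    have h1 := one_lt_of_mem_primeFactors hℓ
    rw [coreWeight_eq h1, hκ]
    dsimp only
    split_ifs with h
    · rw [div_mul_cancel₀ _ (by linarith)]
    · have hp := Nat.prime_of_mem_primeFactors hℓ
      have h137 : 137 ≤ ℓ := by
        by_contra hlt
        rw [hA, Finset.mem_insert, List.mem_toFinset] at h
        have h128 : 128 ≤ ℓ := by
          by_contra h'
          exact h (Or.inr (mem_trialPrimes hp (by omega)))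
        interval_cases ℓ <;> first | exact h (Or.inl rfl) | norm_num at hp
      have h2 : (137 : ℝ) ≤ ℓ := by exact_mod_cast h137
      have h3 : 2 * (ℓ : ℝ) / (ℓ - 1) ≤ 137 / 68 := by
        rw [div_le_div_iff₀ (by linarith) (by norm_num)]
        linarith
      rw [one_mul]
      calc (2 * (ℓ : ℝ) / (ℓ - 1)) ^ 7 ≤ (137 / 68) ^ 7 :=
            pow_le_pow_left₀ (div_nonneg (by linarith) (by linarith)) h3 7
        _ ≤ 137 := by norm_num
        _ ≤ ℓ := h2
  have hκ1 : ∀ ℓ ∈ A, 1 ≤ κ ℓ := by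
    intro ℓ hℓ
    obtain ⟨hp, hlt⟩ := hprime ℓ hℓ
    have h1 : (1 : ℝ) < ℓ := by exact_mod_cast hp.one_lt
    have h2 : (ℓ : ℝ) ≤ 131 := by exact_mod_cast Nat.lt_succ_iff.1 hlt
    have h3 : (131 / 65 : ℝ) ≤ 2 * ℓ / (ℓ - 1) := by
      rw [div_le_div_iff₀ (by norm_num) (by linarith)]
      linarith
    simp only [hκ, if_pos hℓ]
    rw [le_div_iff₀ (by linarith), one_mul]
    calc (ℓ : ℝ) ≤ 131 := h2
      _ ≤ (131 / 65) ^ 7 := by norm_num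
      _ ≤ _ := pow_le_pow_left₀ (by norm_num) h3 7
  have hκM : ∏ ℓ ∈ M.primeFactors, κ ℓ ≤ ∏ ℓ ∈ A, κ ℓ := by
    rw [← Finset.prod_filter_mul_prod_filter_not M.primeFactors (· ∈ A),
      Finset.prod_eq_one (s := {ℓ ∈ M.primeFactors | ℓ ∉ A}) fun ℓ hℓ =>
        if_neg (Finset.mem_filter.1 hℓ).2, mul_one]
    have hsub : {ℓ ∈ M.primeFactors | ℓ ∈ A} ⊆ A := fun ℓ hℓ => (Finset.mem_filter.1 hℓ).2
    refine Finset.prod_le_prod_of_subset_of_one_le hsub (fun ℓ hℓ => ?_) fun ℓ hℓ _ => hκ1 ℓ hℓ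
    exact zero_le_one.trans (hκ1 ℓ (hsub hℓ))
  have hκA : ∏ ℓ ∈ A, κ ℓ ≤ 2 ^ 78 := by
    rw [Finset.prod_congr rfl fun ℓ hℓ => if_pos hℓ, hA]
    have h131 : 131 ∉ trialPrimes.toFinset := by decide
    rw [Finset.prod_insert h131, List.prod_toFinset _ (by decide)]
    norm_num [trialPrimes]
  have hprod : ∏ ℓ ∈ M.primeFactors, (ℓ : ℝ) ≤ M := by
    rw [← Nat.cast_prod]
    exact_mod_cast Nat.le_of_dvd (Nat.pos_of_ne_zero hM) (Nat.prod_primeFactors_dvd M)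
  calc ∏ ℓ ∈ M.primeFactors, (2 / (1 - (ℓ : ℝ)⁻¹)) ^ 7
      ≤ ∏ ℓ ∈ M.primeFactors, (κ ℓ * ℓ) := by
        refine Finset.prod_le_prod (fun ℓ hℓ => ?_) hf
        exact pow_nonneg (zero_le_one.trans (one_le_coreWeight (one_lt_of_mem_primeFactors hℓ))) 7
    _ = (∏ ℓ ∈ M.primeFactors, κ ℓ) * ∏ ℓ ∈ M.primeFactors, (ℓ : ℝ) := Finset.prod_mul_distrib
    _ ≤ 2 ^ 78 * M := mul_le_mul (hκM.trans hκA) hprod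
        (Finset.prod_nonneg fun _ _ => Nat.cast_nonneg _) (by positivity)

theorem sq_lt_sq_of_weight {A c x W K t d B e : ℝ} (hA : 0 ≤ A) (ht : 0 < t) (hd : 0 < d)
    (hW0 : 0 ≤ W) (hW : W ^ 7 ≤ K) (h : (A * (c * x * t) ^ 2) ^ 7 * K ^ 2 < (B * d * e) ^ 14) :
    A * (c * (W * (x / d))) ^ 2 < (B * (e / t)) ^ 2 := by
  refine lt_of_pow_lt_pow_left₀ 7 (by positivity) (lt_of_mul_lt_mul_right (a := (d * t) ^ 14) ?_
    (by positivity))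
  have h1 : (A * (c * x * t) ^ 2) ^ 7 * (W ^ 7) ^ 2 ≤ (A * (c * x * t) ^ 2) ^ 7 * K ^ 2 := by
    gcongr
  refine lt_of_eq_of_lt ?_ (h1.trans_lt (h.trans_eq ?_))
  · field_simp
  · field_simp

section Sieving

variable {Fq F : Type*} [Field Fq] [Field F] [Fintype Fq] [Fintype F] [Algebra Fq F]

theorem exists_of_sieveCheck {n M : ℕ} (hn : Module.finrank Fq F = n)
    (hM : M * (Fintype.card Fq - 1) = Fintype.card Fq ^ n - 1) {L v₁ t₁ v₂ t₂ T : ℕ}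
    (h : sieveCheck (Fintype.card Fq) n M L v₁ t₁ v₂ t₂ T = true) :
    HasPrimitiveOneNormalPair Fq F (Fintype.card Fq) n := by
  have hn0 : n ≠ 0 := hn ▸ Module.finrank_pos.ne'
  have hQ : 1 < Fintype.card Fq ^ n := Nat.one_lt_pow hn0 Fintype.one_lt_card
  have hM0 : M ≠ 0 := by
    rintro rfl
    omega
  have h₀ := valid_primeData hM0 L
  have h₁ := valid_sideData (Fq := Fq) hn0 v₁ t₁ T
  have h₂ := valid_sideData (Fq := Fq) hn0 v₂ t₂ T
  unfold sieveCheck at h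
  generalize primeData M L = s₀ at *
  generalize sideData _ n v₁ t₁ T = s₁ at *
  generalize sideData _ n v₂ t₂ T = s₂ at *
  simp only [SplitData.mul] at h
  rw [Nat.blt_eq] at h
  obtain ⟨e, he⟩ : ∃ e, e = 2 ^ 40 - (s₀.sig + (s₁.sig + s₂.sig)) := ⟨_, rfl⟩
  rw [← he] at h
  have he0 : 0 < e := Nat.pos_of_ne_zero fun h0 => by simp [h0] at h
  have heS := one_sub_sum_sig_eq he he0
  have he0' : (0 : ℝ) < e := by exact_mod_cast he0
  refine exists_of_hasSplit hn hM h₀.2 h₁.2 h₂.2 (sub_pos.1 (heS ▸ by positivity)) ?_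
  rw [heS]
  have hd₀ : (0 : ℝ) < s₀.den := by exact_mod_cast h₀.1
  have hd₁ : (0 : ℝ) < s₁.den := by exact_mod_cast h₁.1
  have hd₂ : (0 : ℝ) < s₂.den := by exact_mod_cast h₂.1
  have hR := (Nat.cast_lt (α := ℝ)).2 h
  push_cast [hQ.le] at hR
  have hden : (0 : ℝ) < (s₀.den * (s₁.den * s₂.den) * 2 ^ 40) ^ 2 := by positivity
  refine lt_of_mul_lt_mul_right ?_ hden.le
  refine lt_of_eq_of_lt ?_ (hR.trans_eq ?_)
  · field_simp
    ring
  · field_simp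

theorem exists_of_weightCheck {n M : ℕ} (hn : Module.finrank Fq F = n)
    (hM : M * (Fintype.card Fq - 1) = Fintype.card Fq ^ n - 1) {v₁ t₁ v₂ t₂ T : ℕ}
    (h : weightCheck (Fintype.card Fq) n M v₁ t₁ v₂ t₂ T = true) :
    HasPrimitiveOneNormalPair Fq F (Fintype.card Fq) n := by
  have hn0 : n ≠ 0 := hn ▸ Module.finrank_pos.ne'
  have hQ : 1 < Fintype.card Fq ^ n := Nat.one_lt_pow hn0 Fintype.one_lt_card
  have hM0 : M ≠ 0 := by
    rintro rfl
    omega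
  obtain ⟨W, hW, hWM⟩ := exists_hasSplit_primeFactors_weight hM0
  have h₁ := valid_sideData (Fq := Fq) hn0 v₁ t₁ T
  have h₂ := valid_sideData (Fq := Fq) hn0 v₂ t₂ T
  unfold weightCheck at h
  generalize sideData _ n v₁ t₁ T = s₁ at *
  generalize sideData _ n v₂ t₂ T = s₂ at *
  simp only [SplitData.mul] at h
  rw [Nat.blt_eq] at h
  obtain ⟨e, he⟩ : ∃ e, e = 2 ^ 40 - (0 + (s₁.sig + s₂.sig)) := ⟨_, rfl⟩
  rw [← zero_add (s₁.sig + s₂.sig), ← he] at h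
  have he0 : 0 < e := Nat.pos_of_ne_zero fun h0 => by simp [h0] at h
  have heS := one_sub_sum_sig_eq he he0
  rw [Nat.cast_zero, zero_div] at heS
  have he0' : (0 : ℝ) < e := by exact_mod_cast he0
  refine exists_of_hasSplit hn hM hW h₁.2 h₂.2 (sub_pos.1 (heS ▸ by positivity)) ?_
  rw [heS]
  have hd₁ : (0 : ℝ) < s₁.den := by exact_mod_cast h₁.1
  have hd₂ : (0 : ℝ) < s₂.den := by exact_mod_cast h₂.1
  have hW1 := hW.one_le
  have hR := (Nat.cast_lt (α := ℝ)).2 h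
  push_cast [hQ.le] at hR
  refine lt_of_eq_of_lt ?_ (sq_lt_sq_of_weight (t := 2 ^ 40) (A := 4 * (Fintype.card Fq : ℝ) ^ n *
    (Fintype.card Fq : ℝ) ^ 4) (c := 1 + (s₁.cnt + s₂.cnt)) (x := s₁.num * s₂.num)
    (d := s₁.den * s₂.den) (by positivity) (by positivity) (by positivity) (by linarith) hWM ?_)
  · field_simp
    ring
  · norm_num
    exact hR

end Sieving

/-! ### Large values of `q` -/

section Large

variable {Fq F : Type*} [Field Fq] [Field F] [Fintype Fq] [Fintype F] [Algebra Fq F]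

theorem hasSplit_traceFactors_sieve {n : ℕ} (hn : n ≠ 0) :
    HasSplit (fun P : Fq[X] => (Fintype.card Fq : ℝ) ^ P.natDegree) (traceFactors Fq n)
      1 (n - 1 : ℕ) ((n - 1 : ℕ) / (Fintype.card Fq : ℝ)) := by
  simpa [div_eq_mul_inv] using hasSplit_traceFactors (Fq := Fq) hn (fun _ => 0) 0

theorem exists_of_sieved_factors {n M : ℕ} (hn : Module.finrank Fq F = n)
    (hM : M * (Fintype.card Fq - 1) = Fintype.card Fq ^ n - 1) {W N S s : ℝ}
    (h₀ : HasSplit (fun ℓ : ℕ => (ℓ : ℝ)) M.primeFactors W N S) (hn7 : 7 ≤ n)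
    (hq : 264 ≤ Fintype.card Fq)
    (hs : S + 2 * ((n - 1 : ℕ) / (Fintype.card Fq : ℝ)) ≤ s) (hs1 : s < 1)
    (h : 4.01 * (Fintype.card Fq : ℝ) ^ 4 * ((1 + (N + 2 * (n - 1 : ℕ))) * W) ^ 2 <
      (Fintype.card Fq : ℝ) ^ n * (1 - s) ^ 2) :
    HasPrimitiveOneNormalPair Fq F (Fintype.card Fq) n := by
  have hside := hasSplit_traceFactors_sieve (Fq := Fq) (n := n) (by omega)
  have hq' : (264 : ℝ) ≤ Fintype.card Fq := by exact_mod_cast hq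
  have hQ : (1000 : ℝ) ≤ (Fintype.card Fq : ℝ) ^ n :=
    calc (1000 : ℝ) ≤ 264 ^ 2 := by norm_num
      _ ≤ (Fintype.card Fq : ℝ) ^ 2 := by gcongr
      _ ≤ _ := pow_le_pow_right₀ (by linarith) (by omega)
  refine exists_of_hasSplit hn hM h₀ hside hside (by linarith) ?_
  set Q := (Fintype.card Fq : ℝ) ^ n
  set A := (Fintype.card Fq : ℝ) ^ 4 * ((1 + (N + 2 * (n - 1 : ℕ))) * W) ^ 2 with hA
  have hA0 : 0 ≤ A := by positivity
  have h1 : ((Q - 1) * (1 - s)) ^ 2 ≤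
      ((Q - 1) * (1 - (S + (n - 1 : ℕ) / (Fintype.card Fq : ℝ) +
        (n - 1 : ℕ) / (Fintype.card Fq : ℝ)))) ^ 2 := by
    refine pow_le_pow_left₀ (mul_nonneg (by linarith) (by linarith)) ?_ 2
    exact mul_le_mul_of_nonneg_left (by linarith) (by linarith)
  refine lt_of_lt_of_le ?_ h1
  have h2 : 4.01 * A < Q * (1 - s) ^ 2 := by rw [hA]; linarith
  have h3 : 4 * Q * A < ((Q - 1) * (1 - s)) ^ 2 := by
    have h4 : 4 * Q ^ 2 ≤ 4.01 * (Q - 1) ^ 2 := by nlinarith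
    have h5 : Q * (4.01 * A) < Q * (Q * (1 - s) ^ 2) := mul_lt_mul_of_pos_left h2 (by linarith)
    have h6 : 4 * Q ^ 2 * (1 - s) ^ 2 ≤ 4.01 * (Q - 1) ^ 2 * (1 - s) ^ 2 := by gcongr
    nlinarith
  refine lt_of_eq_of_lt ?_ h3
  rw [hA]
  ring

theorem cast_mul_le_of_mul_sub_one_eq {q n M : ℕ} (hq : 264 ≤ q) (hM : M * (q - 1) = q ^ n - 1) :
    (M : ℝ) * q ≤ 1.004 * (q : ℝ) ^ n := by
  have h1 : ((M * (q - 1) : ℕ) : ℝ) = ((q ^ n - 1 : ℕ) : ℝ) := by rw [hM]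
  push_cast [show 1 ≤ q by omega, Nat.one_le_pow n q (by omega)] at h1
  have hq' : (264 : ℝ) ≤ q := by exact_mod_cast hq
  have hM0 : (0 : ℝ) ≤ M := Nat.cast_nonneg _
  nlinarith

theorem exists_of_le_pow {n : ℕ} (hn : Module.finrank Fq F = n) (hn7 : 7 ≤ n) (hn35 : n ≤ 35)
    (hq : 264 ≤ Fintype.card Fq)
    (h : 2 ^ 157 * (8 * (2 * n - 1) ^ 2) ^ 7 ≤ Fintype.card Fq ^ (5 * n - 26)) :
    HasPrimitiveOneNormalPair Fq F (Fintype.card Fq) n := by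
  obtain ⟨M, hM⟩ : ∃ M, M * (Fintype.card Fq - 1) = Fintype.card Fq ^ n - 1 := by
    obtain ⟨M, hM⟩ := Nat.sub_dvd_pow_sub_pow (Fintype.card Fq) 1 n
    exact ⟨M, by rw [mul_comm, ← hM, one_pow]⟩
  have hQ : 1 < Fintype.card Fq ^ n := Nat.one_lt_pow (by omega) Fintype.one_lt_card
  have hM0 : M ≠ 0 := by
    rintro rfl
    omega
  have hMq := cast_mul_le_of_mul_sub_one_eq hq hM
  obtain ⟨W, hW, hWM⟩ := exists_hasSplit_primeFactors_weight hM0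
  have hW1 := hW.one_le
  have hq' : (264 : ℝ) ≤ Fintype.card Fq := by exact_mod_cast hq
  have hn' : ((n - 1 : ℕ) : ℝ) ≤ 34 := by
    have : n - 1 ≤ 34 := by omega
    exact_mod_cast this
  refine exists_of_sieved_factors hn hM hW hn7 hq (s := 0.26) ?_ (by norm_num) ?_
  · rw [zero_add, ← mul_div_assoc, div_le_iff₀ (by linarith)]
    linarith
  have hc : ((2 * n - 1 : ℕ) : ℝ) = 1 + (0 + 2 * (n - 1 : ℕ)) := by
    push_cast [show 1 ≤ n by omega, show 1 ≤ 2 * n by omega]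
    ring
  have h' : (2 : ℝ) ^ 157 * (8 * ((2 * n - 1 : ℕ) : ℝ) ^ 2) ^ 7 ≤
      (Fintype.card Fq : ℝ) ^ (5 * n - 26) := by exact_mod_cast h
  have hpow : (Fintype.card Fq : ℝ) ^ (5 * n - 26) * (Fintype.card Fq : ℝ) ^ 26 =
      ((Fintype.card Fq : ℝ) ^ n) ^ 5 := by
    rw [← pow_add, ← pow_mul]
    congr 1
    omega
  have hc1 : (0 : ℝ) < ((2 * n - 1 : ℕ) : ℝ) := by
    have : 0 < 2 * n - 1 := by omega
    exact_mod_cast this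
  rw [← hc]
  have hM00 : (0 : ℝ) ≤ M := Nat.cast_nonneg _
  generalize ((2 * n - 1 : ℕ) : ℝ) = c at *
  generalize (Fintype.card Fq : ℝ) ^ (5 * n - 26) = R at *
  have hQ0 : (0 : ℝ) < (Fintype.card Fq : ℝ) ^ n := by positivity
  generalize (Fintype.card Fq : ℝ) ^ n = Q at *
  generalize (Fintype.card Fq : ℝ) = q at *
  refine lt_of_pow_lt_pow_left₀ 7 (by positivity) (lt_of_mul_lt_mul_right (a := q ^ 2) ?_
    (by positivity))
  calc (4.01 * q ^ 4 * (c * W) ^ 2) ^ 7 * q ^ 2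
      = 4.01 ^ 7 * (c ^ 2) ^ 7 * q ^ 28 * q ^ 2 * (W ^ 7) ^ 2 := by ring
    _ ≤ 4.01 ^ 7 * (c ^ 2) ^ 7 * q ^ 28 * q ^ 2 * (2 ^ 78 * M) ^ 2 := by gcongr
    _ = 4.01 ^ 7 * (c ^ 2) ^ 7 * q ^ 28 * 2 ^ 156 * (M * q) ^ 2 := by ring
    _ ≤ 4.01 ^ 7 * (c ^ 2) ^ 7 * q ^ 28 * 2 ^ 156 * (1.004 * Q) ^ 2 := by gcongr
    _ = (4.01 ^ 7 * 1.004 ^ 2 * 2 ^ 156) * ((c ^ 2) ^ 7 * q ^ 28 * Q ^ 2) := by ring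
    _ < (2 ^ 157 * 8 ^ 7 * (1 - 0.26) ^ 14) * ((c ^ 2) ^ 7 * q ^ 28 * Q ^ 2) := by
        refine mul_lt_mul_of_pos_right ?_ (by positivity)
        norm_num
    _ = (2 ^ 157 * (8 * c ^ 2) ^ 7) * ((1 - 0.26) ^ 14 * q ^ 28 * Q ^ 2) := by ring
    _ ≤ R * ((1 - 0.26) ^ 14 * q ^ 28 * Q ^ 2) := by gcongr
    _ = (R * q ^ 26) * ((1 - 0.26) ^ 14 * q ^ 2 * Q ^ 2) := by ring
    _ = Q ^ 5 * ((1 - 0.26) ^ 14 * q ^ 2 * Q ^ 2) := by rw [hpow]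
    _ = (Q * (1 - 0.26) ^ 2) ^ 7 * q ^ 2 := by ring

theorem prod_coreWeight_le_of_subset {A B : Finset ℕ} (hAB : A ⊆ B) (hB : ∀ ℓ ∈ B, 1 < ℓ) :
    ∏ ℓ ∈ A, 2 / (1 - (ℓ : ℝ)⁻¹) ≤ ∏ ℓ ∈ B, 2 / (1 - (ℓ : ℝ)⁻¹) := by
  have h : ∀ ℓ ∈ B, (1 : ℝ) ≤ 2 / (1 - (ℓ : ℝ)⁻¹) := fun ℓ hℓ =>
    one_le_coreWeight (by exact_mod_cast hB ℓ hℓ)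
  exact Finset.prod_le_prod_of_subset_of_one_le hAB
    (fun ℓ hℓ => zero_le_one.trans (h ℓ (hAB hℓ))) fun ℓ hℓ _ => h ℓ hℓ

theorem hasSplit_primeFactors_core {M r : ℕ} (hM : M ≠ 0) (hr : M < 32 ^ (r + 1)) :
    HasSplit (fun ℓ : ℕ => (ℓ : ℝ)) M.primeFactors 13400 r (r / 32) := by
  have hcore : HasSplit (fun ℓ : ℕ => (ℓ : ℝ)) {ℓ ∈ M.primeFactors | ℓ < 32} 13400 0 0 := by
    refine HasSplit.of_core
      (fun ℓ hℓ => one_lt_of_mem_primeFactors (Finset.mem_filter.1 hℓ).1) ?_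
    refine (prod_coreWeight_le_of_subset (B := {2, 3, 5, 7, 11, 13, 17, 19, 23, 29, 31}) ?_
      (by decide)).trans (by norm_num)
    intro ℓ hℓ
    obtain ⟨h1, h2⟩ := Finset.mem_filter.1 hℓ
    have h3 := mem_trialPrimes (Nat.prime_of_mem_primeFactors h1) (by omega)
    have h4 : ∀ ℓ ∈ trialPrimes, ℓ < 32 →
        ℓ ∈ ({2, 3, 5, 7, 11, 13, 17, 19, 23, 29, 31} : Finset ℕ) := by decide
    exact h4 ℓ h3 h2
  refine (hasSplit_primeFactors (B := 32) (r := r) hM (by norm_num) hcore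
    (hr.trans_le ?_)).mono le_rfl (by simp) ?_
  · refine Nat.le_mul_of_pos_right _ (Finset.prod_pos fun x hx => ?_)
    exact (Nat.prime_of_mem_primeFactors (Finset.mem_filter.1 hx).1).pos
  · rw [zero_add, div_eq_mul_inv]
    norm_num

theorem lt_of_mul_sub_one_eq {q n M B : ℕ} (hq : 2 ≤ q) (hn : n ≠ 0)
    (hM : M * (q - 1) = q ^ n - 1) (hB : 2 * q ^ (n - 1) ≤ B) : M < B := by
  refine lt_of_lt_of_le (lt_of_mul_lt_mul_right (a := q - 1) ?_ (Nat.zero_le _)) hB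
  obtain ⟨m, rfl⟩ := Nat.exists_eq_succ_of_ne_zero hn
  obtain ⟨k, rfl⟩ := Nat.exists_eq_add_of_le' hq
  have hpos : 0 < (k + 2) ^ m := by positivity
  rw [hM, Nat.succ_sub_one, pow_succ, show k + 2 - 1 = k + 1 by omega]
  have : 2 * (k + 2) ^ m * (k + 1) = (k + 2) ^ m * (k + 2) + (k + 2) ^ m * k := by ring
  have h0 : 0 < (k + 2) ^ m * (k + 2) := by positivity
  omega

theorem exists_of_core_lt {n r : ℕ} (hn : Module.finrank Fq F = n) (hn7 : 7 ≤ n)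
    (hq : 264 ≤ Fintype.card Fq) (hr : 2 * Fintype.card Fq ^ (n - 1) ≤ 32 ^ (r + 1)) {s : ℝ}
    (hs1 : s < 1) (hs : (r : ℝ) / 32 + 2 * ((n - 1 : ℕ) / (Fintype.card Fq : ℝ)) ≤ s)
    (h : 4.01 * ((1 + (r + 2 * (n - 1 : ℕ))) * 13400) ^ 2 <
      (Fintype.card Fq : ℝ) ^ (n - 4) * (1 - s) ^ 2) :
    HasPrimitiveOneNormalPair Fq F (Fintype.card Fq) n := by
  obtain ⟨M, hM⟩ : ∃ M, M * (Fintype.card Fq - 1) = Fintype.card Fq ^ n - 1 := by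
    obtain ⟨M, hM⟩ := Nat.sub_dvd_pow_sub_pow (Fintype.card Fq) 1 n
    exact ⟨M, by rw [mul_comm, ← hM, one_pow]⟩
  have hQ : 1 < Fintype.card Fq ^ n := Nat.one_lt_pow (by omega) Fintype.one_lt_card
  have hM0 : M ≠ 0 := by
    rintro rfl
    omega
  have hsplit := hasSplit_primeFactors_core hM0 (lt_of_mul_sub_one_eq (by omega) (by omega) hM hr)
  refine exists_of_sieved_factors hn hM hsplit hn7 hq hs hs1 ?_
  have hq' : (0 : ℝ) < (Fintype.card Fq : ℝ) ^ 4 := by positivity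
  have hpow : (Fintype.card Fq : ℝ) ^ n =
      (Fintype.card Fq : ℝ) ^ 4 * (Fintype.card Fq : ℝ) ^ (n - 4) := by
    rw [← pow_add]
    congr 1
    omega
  rw [hpow, mul_assoc ((Fintype.card Fq : ℝ) ^ 4), mul_comm (4.01 : ℝ), mul_assoc]
  exact mul_lt_mul_of_pos_left h hq'

theorem eq_or_modEq_of_prime_dvd {p q ℓ M n : ℕ} (hp : p.Prime) (hℓ : ℓ.Prime) (hn : n = p)
    (hM : M * (q - 1) = q ^ n - 1) (hq : 2 ≤ q) (hdvd : ℓ ∣ M) : ℓ = p ∨ ℓ % p = 1 := by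
  subst hn
  have : Fact ℓ.Prime := ⟨hℓ⟩
  have : Fact n.Prime := ⟨hp⟩
  have hMs : M = ∑ i ∈ Finset.range n, q ^ i := by
    have h1 := Nat.geomSum_eq hq n
    have h2 : 0 < q - 1 := by omega
    rw [h1, ← hM, Nat.mul_div_cancel _ h2]
  have hz : ((M : ℕ) : ZMod ℓ) = 0 := (ZMod.natCast_eq_zero_iff _ _).2 hdvd
  rw [hMs] at hz
  push_cast at hz
  have hpow : (q : ZMod ℓ) ^ n = 1 := by
    have := geom_sum_mul (q : ZMod ℓ) n
    rw [hz, zero_mul] at this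
    exact (sub_eq_zero.1 this.symm)
  by_cases h1 : (q : ZMod ℓ) = 1
  · left
    rw [h1] at hz
    simp only [one_pow, Finset.sum_const, Finset.card_range, nsmul_eq_mul, mul_one] at hz
    exact (Nat.prime_dvd_prime_iff_eq hℓ hp).1 ((ZMod.natCast_eq_zero_iff _ _).1 hz)
  · right
    have hord := orderOf_eq_prime hpow h1
    have hq0 : (q : ZMod ℓ) ≠ 0 := by
      intro h0
      rw [h0, zero_pow hp.ne_zero] at hpow
      exact zero_ne_one hpow
    have h2 := ZMod.orderOf_dvd_card_sub_one hq0
    rw [hord] at h2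
    obtain ⟨k, hk⟩ := h2
    have h3 := hℓ.two_le
    rw [show ℓ = 1 + n * k by omega, Nat.add_mul_mod_self_left, Nat.mod_eq_of_lt hp.one_lt]

theorem exists_of_finrank_eq_seven (hn : Module.finrank Fq F = 7)
    (hq : 264 ≤ Fintype.card Fq) (hq' : Fintype.card Fq ≤ 2 ^ 26) :
    HasPrimitiveOneNormalPair Fq F (Fintype.card Fq) 7 := by
  obtain ⟨M, hM⟩ : ∃ M, M * (Fintype.card Fq - 1) = Fintype.card Fq ^ 7 - 1 := by
    obtain ⟨M, hM⟩ := Nat.sub_dvd_pow_sub_pow (Fintype.card Fq) 1 7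
    exact ⟨M, by rw [mul_comm, ← hM, one_pow]⟩
  have hQ : 1 < Fintype.card Fq ^ 7 := Nat.one_lt_pow (by omega) Fintype.one_lt_card
  have hM0 : M ≠ 0 := by
    rintro rfl
    omega
  have hMlt : M < 64 ^ 27 := by
    refine lt_of_mul_sub_one_eq (by omega) (by omega) hM ?_
    calc 2 * Fintype.card Fq ^ (7 - 1) ≤ 2 * (2 ^ 26) ^ (7 - 1) := by gcongr
      _ ≤ 64 ^ 27 := by norm_num
  have hsub : {ℓ ∈ M.primeFactors | ℓ < 64} ⊆ ({7, 29, 43} : Finset ℕ) := by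
    intro ℓ hℓ
    obtain ⟨h1, h2⟩ := Finset.mem_filter.1 hℓ
    have hp := Nat.prime_of_mem_primeFactors h1
    have h3 := mem_trialPrimes hp (by omega)
    have h4 := eq_or_modEq_of_prime_dvd (by norm_num : Nat.Prime 7) hp rfl hM (by omega)
      (Nat.dvd_of_mem_primeFactors h1)
    have h5 : ∀ ℓ ∈ trialPrimes, ℓ < 64 → (ℓ = 7 ∨ ℓ % 7 = 1) →
        ℓ ∈ ({7, 29, 43} : Finset ℕ) := by decide
    exact h5 ℓ h3 h2 h4
  have hsmall : HasSplit (fun ℓ : ℕ => (ℓ : ℝ)) {ℓ ∈ M.primeFactors | ℓ < 64} 1 3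
      (7⁻¹ + (29⁻¹ + 43⁻¹)) := by
    refine HasSplit.of_sieve
      (fun ℓ hℓ => one_lt_of_mem_primeFactors (Finset.mem_filter.1 hℓ).1) ?_ ?_
    · exact_mod_cast (Finset.card_le_card hsub).trans (by decide)
    · refine (Finset.sum_le_sum_of_subset_of_nonneg hsub fun ℓ _ _ => by positivity).trans
        (le_of_eq ?_)
      simp
  have hsplit := hasSplit_primeFactors (B := 64) (r := 26) hM0 (by norm_num) hsmall
    (hMlt.trans_le (Nat.le_mul_of_pos_right _ (Finset.prod_pos fun x hx =>
      (Nat.prime_of_mem_primeFactors (Finset.mem_filter.1 hx).1).pos)))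
  have hq264 : (264 : ℝ) ≤ Fintype.card Fq := by exact_mod_cast hq
  refine exists_of_sieved_factors hn hM hsplit le_rfl hq (s := 0.66) ?_ (by norm_num) ?_
  · have h1 : ((7 - 1 : ℕ) : ℝ) / (Fintype.card Fq : ℝ) ≤ 6 / 264 := by
      rw [show ((7 - 1 : ℕ) : ℝ) = 6 by norm_num]
      exact div_le_div_of_nonneg_left (by norm_num) (by norm_num) hq264
    norm_num at h1 ⊢
    linarith
  · have hpow : (Fintype.card Fq : ℝ) ^ 7 = (Fintype.card Fq : ℝ) ^ 4 * (Fintype.card Fq : ℝ) ^ 3 :=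
      by rw [← pow_add]
    have h3 : (264 : ℝ) ^ 3 ≤ (Fintype.card Fq : ℝ) ^ 3 := by gcongr
    have h4 : (0 : ℝ) < (Fintype.card Fq : ℝ) ^ 4 := by positivity
    rw [hpow, mul_assoc ((Fintype.card Fq : ℝ) ^ 4), mul_comm (4.01 : ℝ), mul_assoc]
    refine mul_lt_mul_of_pos_left ?_ h4
    norm_num at h3 ⊢
    linarith

theorem exists_of_core_le {n r q₀ q₁ : ℕ} (hn : Module.finrank Fq F = n) (hn7 : 7 ≤ n)
    (hq₀ : 264 ≤ q₀) (hq : q₀ ≤ Fintype.card Fq) (hq₁ : Fintype.card Fq ≤ q₁)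
    (hr : 2 * q₁ ^ (n - 1) ≤ 32 ^ (r + 1)) {s : ℝ}
    (hs1 : s < 1) (hs : (r : ℝ) / 32 + 2 * ((n - 1 : ℕ) / (q₀ : ℝ)) ≤ s)
    (h : 4.01 * ((1 + (r + 2 * (n - 1 : ℕ))) * 13400) ^ 2 < (q₀ : ℝ) ^ (n - 4) * (1 - s) ^ 2) :
    HasPrimitiveOneNormalPair Fq F (Fintype.card Fq) n := by
  have h0 : (0 : ℝ) < q₀ := by exact_mod_cast (by omega : 0 < q₀)
  have h1 : (q₀ : ℝ) ≤ Fintype.card Fq := by exact_mod_cast hq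
  refine exists_of_core_lt (r := r) hn hn7 (hq₀.trans hq) (le_trans ?_ hr) hs1 (le_trans ?_ hs)
    (h.trans_le ?_)
  · gcongr
  · gcongr
  · gcongr

theorem le_pow_of_le {a q q₀ k : ℕ} (h : q₀ ≤ q) (ha : a ≤ q₀ ^ k) : a ≤ q ^ k :=
  ha.trans (Nat.pow_le_pow_left h k)

theorem exists_of_finrank_le {n : ℕ} (hn : Module.finrank Fq F = n) (hn7 : 7 ≤ n) (hn35 : n ≤ 35)
    (hq : 264 ≤ Fintype.card Fq) (hq8 : n = 8 → 1950 ≤ Fintype.card Fq)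
    (hq9 : n = 9 → 400 ≤ Fintype.card Fq) :
    HasPrimitiveOneNormalPair Fq F (Fintype.card Fq) n := by
  by_cases h12 : 12 ≤ n
  · refine exists_of_le_pow hn hn7 hn35 hq (le_pow_of_le hq ?_)
    clear hn hq8 hq9
    interval_cases n <;> norm_num
  obtain rfl | rfl | rfl | rfl | rfl : n = 7 ∨ n = 8 ∨ n = 9 ∨ n = 10 ∨ n = 11 := by omega
  · rcases le_total (Fintype.card Fq) (2 ^ 26) with h | h
    · exact exists_of_finrank_eq_seven hn hq h
    · exact exists_of_le_pow hn hn7 hn35 hq (le_pow_of_le h (by norm_num))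
  · rcases le_total (Fintype.card Fq) (2 ^ 17) with h | h
    · exact exists_of_core_le (r := 23) (s := 0.73) hn hn7 (by norm_num) (hq8 rfl) h (by norm_num)
        (by norm_num) (by norm_num) (by norm_num)
    · exact exists_of_le_pow hn hn7 hn35 hq (le_pow_of_le h (by norm_num))
  · rcases le_total (Fintype.card Fq) (2 ^ 13) with h | h
    · exact exists_of_core_le (r := 20) (s := 0.67) hn hn7 (by norm_num) (hq9 rfl) h (by norm_num)
        (by norm_num) (by norm_num) (by norm_num)
    · exact exists_of_le_pow hn hn7 hn35 hq (le_pow_of_le h (by norm_num))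
  · rcases le_total (Fintype.card Fq) 1000 with h | h
    · exact exists_of_core_le (r := 18) (s := 0.631) hn hn7 le_rfl hq h (by norm_num)
        (by norm_num) (by norm_num) (by norm_num)
    · exact exists_of_le_pow hn hn7 hn35 hq (le_pow_of_le h (by norm_num))
  · rcases le_total (Fintype.card Fq) 1000 with h | h
    · exact exists_of_core_le (r := 20) (s := 0.702) hn hn7 le_rfl hq h (by norm_num)
        (by norm_num) (by norm_num) (by norm_num)
    · exact exists_of_le_pow hn hn7 hn35 hq (le_pow_of_le h (by norm_num))

end Large

/-! ### Large values of `n` -/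

/-- The factor by which the eighth power of the weight of a polynomial of degree `d` may exceed
`q ^ d`. -/
def weightExcess (q d : ℕ) : ℝ :=
  if q ^ d < 264 then (2 / (1 - ((q : ℝ) ^ d)⁻¹)) ^ 8 / (q : ℝ) ^ d else 1

theorem coreWeight_pow_eight_le {q d : ℕ} (hq : 2 ≤ q) (hd : d ≠ 0) :
    (2 / (1 - ((q : ℝ) ^ d)⁻¹)) ^ 8 ≤ (q : ℝ) ^ d * weightExcess q d := by
  have h1 : (1 : ℝ) < (q : ℝ) ^ d := by exact_mod_cast Nat.one_lt_pow hd hq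
  unfold weightExcess
  split_ifs with h
  · rw [mul_div_cancel₀ _ (by positivity)]
  · have h2 : (264 : ℝ) ≤ (q : ℝ) ^ d := by exact_mod_cast not_lt.1 h
    calc (2 / (1 - ((q : ℝ) ^ d)⁻¹)) ^ 8 ≤ (2 / (1 - (264 : ℝ)⁻¹)) ^ 8 :=
          pow_le_pow_left₀ (zero_le_one.trans (one_le_coreWeight h1))
            (coreWeight_anti (by norm_num) h2) 8
      _ ≤ 264 := by norm_num
      _ ≤ (q : ℝ) ^ d * 1 := by linarith

theorem one_le_weightExcess {q d : ℕ} (hq : 2 ≤ q) (hd : d ≠ 0) : 1 ≤ weightExcess q d := by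
  have h1 : (1 : ℝ) < (q : ℝ) ^ d := by exact_mod_cast Nat.one_lt_pow hd hq
  unfold weightExcess
  split_ifs with h
  · have h2 : (q : ℝ) ^ d ≤ 263 := by exact_mod_cast Nat.lt_succ_iff.1 h
    rw [le_div_iff₀ (by positivity), one_mul]
    calc (q : ℝ) ^ d ≤ 263 := h2
      _ ≤ (2 / (1 - (263 : ℝ)⁻¹)) ^ 8 := by norm_num
      _ ≤ _ := pow_le_pow_left₀ (by norm_num) (coreWeight_anti h1 h2) 8
  · rfl

/-- A bound for the number of irreducible polynomials of degree `d`, independent of `n`. -/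
def degreeBound (q d : ℕ) : ℕ :=
  cond (d.beq 1) (q - 1) ((q ^ d - 2) / d)

theorem factorBound_le_degreeBound {q n d : ℕ} (hq : 2 ≤ q) (hd : d ≠ 0) :
    factorBound q n d ≤ degreeBound q d := by
  have hq1 : 0 < q - 1 := by omega
  unfold factorBound degreeBound
  split_ifs with h1
  · subst h1
    exact (Nat.sub_le _ _).trans (Nat.gcd_le_right _ hq1)
  · subst h1
    exact (Nat.sub_le _ _).trans (Nat.gcd_le_right _ hq1)
  all_goals
    have hb : d.beq 1 = false := by
      rw [← Bool.not_eq_true, Nat.beq_eq]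
      exact h1
    rw [hb, cond_false]
    refine Nat.div_le_div_right ?_
    have h3 : 1 < q ^ d := Nat.one_lt_pow hd hq
    have h4 := Nat.gcd_le_right (n := q ^ d - 1) n (by omega)
    have h5 := Nat.gcd_pos_of_pos_right n hq1
    omega

def excessNum (q : ℕ) : ℕ → ℕ
  | 0 => 1
  | d + 1 => excessNum q d *
      cond ((q ^ (d + 1)).blt 264) ((2 * q ^ (d + 1)) ^ (8 * degreeBound q (d + 1))) 1

def excessDen (q : ℕ) : ℕ → ℕ
  | 0 => 1
  | d + 1 => excessDen q d *
      cond ((q ^ (d + 1)).blt 264)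
        (((q ^ (d + 1) - 1) ^ 8 * q ^ (d + 1)) ^ degreeBound q (d + 1)) 1

theorem prod_weightExcess_eq {q : ℕ} (hq : 2 ≤ q) (T : ℕ) :
    0 < excessDen q T ∧ ∏ d ∈ Finset.Ico 1 (T + 1), weightExcess q d ^ degreeBound q d =
      (excessNum q T : ℝ) / excessDen q T := by
  induction T with
  | zero => simp [excessNum, excessDen]
  | succ d ih =>
    have h1 : 1 < q ^ (d + 1) := Nat.one_lt_pow (Nat.succ_ne_zero d) hq
    have h1' : (1 : ℝ) < (q : ℝ) ^ (d + 1) := by exact_mod_cast h1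
    rw [Finset.prod_Ico_succ_top (by omega), ih.2, excessNum, excessDen, weightExcess]
    by_cases h : q ^ (d + 1) < 264
    · have hb : (q ^ (d + 1)).blt 264 = true := by rwa [Nat.blt_eq]
      rw [hb, if_pos h, cond_true, cond_true]
      refine ⟨Nat.mul_pos ih.1 (Nat.pow_pos (Nat.mul_pos (Nat.pow_pos (by omega)) (by omega))), ?_⟩
      rw [coreWeight_eq h1', div_pow _ _ 8, div_div, div_pow, div_mul_div_comm, ← pow_mul]
      push_cast [h1.le]
      rfl
    · have hb : (q ^ (d + 1)).blt 264 = false := by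
        rw [← Bool.not_eq_true, Nat.blt_eq]
        exact h
      rw [hb, if_neg h, cond_false, cond_false]
      simpa using ih.1

section Asymptotic

variable {Fq F : Type*} [Field Fq] [Field F] [Fintype Fq] [Fintype F] [Algebra Fq F]

theorem prod_coreWeight_traceFactors_pow_le {n : ℕ} (hn : n ≠ 0) :
    (∏ P ∈ traceFactors Fq n, 2 / (1 - ((Fintype.card Fq : ℝ) ^ P.natDegree)⁻¹)) ^ 8 ≤
      (Fintype.card Fq : ℝ) ^ (n - 1) *
        ((excessNum (Fintype.card Fq) 8 : ℝ) / excessDen (Fintype.card Fq) 8) := by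
  have hq : 2 ≤ Fintype.card Fq := Fintype.one_lt_card
  have hq1 : (1 : ℝ) ≤ Fintype.card Fq := by exact_mod_cast (by omega : 1 ≤ Fintype.card Fq)
  have hdeg : ∀ P ∈ traceFactors Fq n, P.natDegree ≠ 0 := fun P hP =>
    (natDegree_pos_of_mem_traceFactors hn hP).ne'
  have h1 : ∏ P ∈ traceFactors Fq n, (Fintype.card Fq : ℝ) ^ P.natDegree ≤
      (Fintype.card Fq : ℝ) ^ (n - 1) := by
    rw [Finset.prod_pow_eq_pow_sum]
    exact pow_le_pow_right₀ hq1 (sum_natDegree_traceFactors_le hn)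
  have h2 : ∏ P ∈ traceFactors Fq n, weightExcess (Fintype.card Fq) P.natDegree ≤
      (excessNum (Fintype.card Fq) 8 : ℝ) / excessDen (Fintype.card Fq) 8 := by
    rw [← (prod_weightExcess_eq hq 8).2,
      ← Finset.prod_filter_mul_prod_filter_not _ fun P : Fq[X] => P.natDegree ∈ Finset.Ico 1 (8 + 1),
      Finset.prod_eq_one (s := {P ∈ traceFactors Fq n | P.natDegree ∉ Finset.Ico 1 (8 + 1)}),
      mul_one, ← Finset.prod_fiberwise_of_maps_to (t := Finset.Ico 1 (8 + 1))
        (g := fun P : Fq[X] => P.natDegree) (fun P hP => (Finset.mem_filter.1 hP).2)]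
    · refine Finset.prod_le_prod (fun d hd => Finset.prod_nonneg fun P hP => ?_) fun d hd => ?_
      · simp only [Finset.mem_filter] at hP
        exact zero_le_one.trans (one_le_weightExcess hq (hdeg P hP.1.1))
      · have hd0 : d ≠ 0 := (Nat.pos_of_ne_zero (by simp at hd; omega)).ne'
        rw [Finset.prod_congr rfl (g := fun _ => weightExcess (Fintype.card Fq) d)
          fun P hP => by rw [(Finset.mem_filter.1 hP).2], Finset.prod_const]
        refine pow_le_pow_right₀ (one_le_weightExcess hq hd0) ?_
        refine ((Finset.card_le_card fun P hP => ?_).trans (card_traceFactorsOfDegree_le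
          (Fq := Fq) hn hd0)).trans (factorBound_le_degreeBound hq hd0)
        simp only [Finset.mem_filter] at hP
        exact Finset.mem_filter.2 ⟨hP.1.1, hP.2⟩
    · intro P hP
      obtain ⟨h3, h4⟩ := Finset.mem_filter.1 hP
      have h5 := hdeg P h3
      have h6 : 9 ≤ P.natDegree := by
        rw [Finset.mem_Ico] at h4
        omega
      refine if_neg (not_lt.2 ?_)
      calc 264 ≤ 2 ^ 9 := by norm_num
        _ ≤ Fintype.card Fq ^ 9 := Nat.pow_le_pow_left hq 9
        _ ≤ _ := Nat.pow_le_pow_right (by omega) h6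
  rw [← Finset.prod_pow]
  calc ∏ P ∈ traceFactors Fq n, (2 / (1 - ((Fintype.card Fq : ℝ) ^ P.natDegree)⁻¹)) ^ 8
      ≤ ∏ P ∈ traceFactors Fq n, ((Fintype.card Fq : ℝ) ^ P.natDegree *
          weightExcess (Fintype.card Fq) P.natDegree) := by
        refine Finset.prod_le_prod (fun P hP => (even_two_mul 4).pow_nonneg _) fun P hP => ?_
        exact coreWeight_pow_eight_le hq (hdeg P hP)
    _ ≤ _ := by
        rw [Finset.prod_mul_distrib]
        refine mul_le_mul h1 h2 (Finset.prod_nonneg fun P hP => ?_) (by positivity)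
        exact zero_le_one.trans (one_le_weightExcess hq (hdeg P hP))

/-- A condition ensuring the criterion, with everything in the core, for all `n ≥ N`. -/
def asymptoticCheck (q N : ℕ) : Bool :=
  Nat.blt (2 ^ 689 * q ^ 90 * excessNum q 8 ^ 14) (q ^ (6 * N) * excessDen q 8 ^ 14)

theorem mul_sq_lt_sq_of_pow_le {q Q R W V M K A B : ℝ} (hQ : Q = R * q) (hQ' : 128 ≤ Q)
    (hR : 0 < R) (hq : 0 < q) (hW : 0 ≤ W) (hWM : W ^ 7 ≤ K * M) (hM : M ≤ 2 * R)
    (hK : 0 ≤ K) (hVA : V ^ 8 ≤ R * (A / B)) (hB : 0 < B)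
    (h : 2 * 4 ^ 28 * (2 * K) ^ 8 * q ^ 90 * A ^ 14 < Q ^ 6 * B ^ 14) :
    4 * Q * q ^ 4 * (W * V * V) ^ 2 < (Q - 1) ^ 2 := by
  have h1 : Q ^ 56 ≤ 2 * (Q - 1) ^ 56 := by
    have h2 : 127 / 128 * Q ≤ Q - 1 := by linarith
    have h3 : (127 / 128 * Q) ^ 56 ≤ (Q - 1) ^ 56 := pow_le_pow_left₀ (by linarith) h2 56
    rw [mul_pow] at h3
    have h4 : (1 / 2 : ℝ) * Q ^ 56 ≤ (127 / 128) ^ 56 * Q ^ 56 := by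
      refine mul_le_mul_of_nonneg_right (by norm_num) (by positivity)
    linarith
  have h5 : W ^ 7 ≤ K * (2 * R) := hWM.trans (mul_le_mul_of_nonneg_left hM hK)
  refine lt_of_pow_lt_pow_left₀ 28 (by positivity) (lt_of_mul_lt_mul_right (a := 2 * B ^ 14) ?_
    (by positivity))
  calc (4 * Q * q ^ 4 * (W * V * V) ^ 2) ^ 28 * (2 * B ^ 14)
      = 4 ^ 28 * Q ^ 28 * q ^ 112 * (W ^ 7) ^ 8 * (V ^ 8) ^ 14 * (2 * B ^ 14) := by ring
    _ ≤ 4 ^ 28 * Q ^ 28 * q ^ 112 * (K * (2 * R)) ^ 8 * (R * (A / B)) ^ 14 * (2 * B ^ 14) := by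
        gcongr
    _ = 2 * 4 ^ 28 * (2 * K) ^ 8 * q ^ 90 * A ^ 14 * (Q ^ 28 * (R * q) ^ 22) := by
        rw [mul_pow R (A / B), div_pow]
        field_simp
    _ = 2 * 4 ^ 28 * (2 * K) ^ 8 * q ^ 90 * A ^ 14 * Q ^ 50 := by
        rw [← hQ]
        ring
    _ < Q ^ 6 * B ^ 14 * Q ^ 50 := mul_lt_mul_of_pos_right h (by positivity)
    _ = B ^ 14 * Q ^ 56 := by ring
    _ ≤ B ^ 14 * (2 * (Q - 1) ^ 56) := by gcongr
    _ = ((Q - 1) ^ 2) ^ 28 * (2 * B ^ 14) := by ring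

set_option exponentiation.threshold 1000 in
theorem exists_of_asymptoticCheck {n N : ℕ} (hn : Module.finrank Fq F = n) (hn7 : 7 ≤ n)
    (hN : N ≤ n) (h : asymptoticCheck (Fintype.card Fq) N = true) :
    HasPrimitiveOneNormalPair Fq F (Fintype.card Fq) n := by
  have hq : 2 ≤ Fintype.card Fq := Fintype.one_lt_card
  have hn0 : n ≠ 0 := by omega
  obtain ⟨M, hM⟩ : ∃ M, M * (Fintype.card Fq - 1) = Fintype.card Fq ^ n - 1 := by
    obtain ⟨M, hM⟩ := Nat.sub_dvd_pow_sub_pow (Fintype.card Fq) 1 n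
    exact ⟨M, by rw [mul_comm, ← hM, one_pow]⟩
  have hQ : 1 < Fintype.card Fq ^ n := Nat.one_lt_pow hn0 Fintype.one_lt_card
  have hM0 : M ≠ 0 := by
    rintro rfl
    omega
  have hMlt : M < 2 * Fintype.card Fq ^ (n - 1) := lt_of_mul_sub_one_eq hq hn0 hM le_rfl
  obtain ⟨W, hW, hWM⟩ := exists_hasSplit_primeFactors_weight hM0
  have hV := prod_coreWeight_traceFactors_pow_le (Fq := Fq) hn0
  have hside : HasSplit (fun P : Fq[X] => (Fintype.card Fq : ℝ) ^ P.natDegree) (traceFactors Fq n)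
      (∏ P ∈ traceFactors Fq n, 2 / (1 - ((Fintype.card Fq : ℝ) ^ P.natDegree)⁻¹)) 0 0 := by
    refine HasSplit.of_core (fun P hP => ?_) le_rfl
    exact_mod_cast Nat.one_lt_pow (natDegree_pos_of_mem_traceFactors hn0 hP).ne' hq
  have hW1 := hW.one_le
  refine exists_of_hasSplit hn hM hW hside hside (by norm_num) ?_
  obtain ⟨hden, -⟩ := prod_weightExcess_eq hq 8
  rw [asymptoticCheck, Nat.blt_eq] at h
  replace h : 2 ^ 689 * Fintype.card Fq ^ 90 * excessNum (Fintype.card Fq) 8 ^ 14 <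
      Fintype.card Fq ^ (6 * n) * excessDen (Fintype.card Fq) 8 ^ 14 :=
    h.trans_le (Nat.mul_le_mul_right _ (Nat.pow_le_pow_right (by omega) (by omega)))
  have hR := (Nat.cast_lt (α := ℝ)).2 h
  push_cast at hR
  have hM' : (M : ℝ) ≤ 2 * (Fintype.card Fq : ℝ) ^ (n - 1) := by exact_mod_cast hMlt.le
  have hpow : (Fintype.card Fq : ℝ) ^ n =
      (Fintype.card Fq : ℝ) ^ (n - 1) * (Fintype.card Fq : ℝ) := by
    rw [← pow_succ]
    congr 1
    omega
  have hQ128 : (128 : ℝ) ≤ (Fintype.card Fq : ℝ) ^ n := by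
    have : 128 ≤ Fintype.card Fq ^ n :=
      calc 128 = 2 ^ 7 := by norm_num
        _ ≤ Fintype.card Fq ^ 7 := Nat.pow_le_pow_left hq 7
        _ ≤ _ := Nat.pow_le_pow_right (by omega) hn7
    exact_mod_cast this
  have hq0 : (0 : ℝ) < Fintype.card Fq := by exact_mod_cast (by omega : 0 < Fintype.card Fq)
  have hd0 : (0 : ℝ) < excessDen (Fintype.card Fq) 8 := by exact_mod_cast hden
  simp only [add_zero, sub_zero, mul_one, one_mul]
  refine mul_sq_lt_sq_of_pow_le hpow hQ128 (by positivity) hq0 (by linarith) hWM hM'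
    (by positivity) hV hd0 ?_
  rw [← pow_mul, mul_comm n]
  refine lt_of_eq_of_lt ?_ hR
  norm_num

end Asymptotic

/-! ### Verification of the criterion for small parameters -/

/-- Tries the criterion for several splits. -/
def pairCheckAux (q n M : ℕ) : Bool :=
  weightCheck q n M 0 0 0 0 1 ||
    (sieveCheck q n M 7 1000 3 1000 1 8 || (sieveCheck q n M 13 0 0 0 0 8 ||
    (sieveCheck q n M 31 1000 4 1000 3 8 || (sieveCheck q n M 7 1000 1 0 0 8 ||
    (sieveCheck q n M 2 0 0 0 0 8 || (sieveCheck q n M 2 1000 1 1000 1 8 ||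
    (sieveCheck q n M 13 1000 1 1000 1 8 || (sieveCheck q n M 3 12 0 12 0 8 ||
    (sieveCheck q n M 7 15 0 14 0 8 || (sieveCheck q n M 3 20 0 19 0 8 ||
    (sieveCheck q n M 5 21 0 20 0 8 || sieveCheck q n M 3 30 0 30 0 8)))))))))))

def pairCheck (q n : ℕ) : Bool := pairCheckAux q n ((q ^ n - 1) / (q - 1))

/-- Recognises integers below `2 ^ 11` that are not prime powers. -/
def notPrimePow (q : ℕ) : Bool :=
  trialPrimes.any fun ℓ => (q % ℓ).beq 0 && !(ℓ ^ 11 % q).beq 0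

theorem notPrimePow_eq_false {q : ℕ} (hq : IsPrimePow q) (hlt : q < 2 ^ 11) :
    notPrimePow q = false := by
  obtain ⟨p, k, hp, hk, rfl⟩ := hq
  replace hp := hp.nat_prime
  rw [notPrimePow, List.any_eq_false]
  intro ℓ hℓ h
  rw [Bool.and_eq_true, Nat.beq_eq] at h
  obtain ⟨h1, h2⟩ := h
  have hpl := (Nat.prime_dvd_prime_iff_eq (prime_of_mem_trialPrimes hℓ) hp).1
    ((prime_of_mem_trialPrimes hℓ).dvd_of_dvd_pow (Nat.dvd_of_mod_eq_zero h1))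
  subst hpl
  have hk11 : k ≤ 11 := by
    by_contra hlt'
    have h3 : 2 ^ 11 ≤ 2 ^ k := Nat.pow_le_pow_right (by norm_num) (by omega)
    have h4 : 2 ^ k ≤ ℓ ^ k := Nat.pow_le_pow_left hp.two_le k
    omega
  rw [Nat.mod_eq_zero_of_dvd (pow_dvd_pow ℓ hk11)] at h2
  exact absurd h2 (by decide)

/-- The pairs `(q, n)` treated by exhibiting an element. -/
def exceptionalPairs : List (ℕ × List ℕ) :=
  [(2, [7, 8, 9, 10, 11, 12, 14, 15, 16, 18, 20, 21, 22, 24, 28, 30]),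
    (3, [7, 8, 9, 10, 12, 14, 16, 18, 24]),
    (4, [7, 8, 9, 10, 12, 15, 18]),
    (5, [7, 8, 10, 12, 16, 24]),
    (7, [7, 8, 9, 12]),
    (8, [7, 8, 14]),
    (9, [8, 10, 12, 16]),
    (11, [8, 10]),
    (13, [8, 12]),
    (16, [15]),
    (17, [8, 16]),
    (19, [18]),
    (23, [8]),
    (25, [8]),
    (29, [8])]

def isExceptional (q n : ℕ) : Bool :=
  exceptionalPairs.any fun x => x.1.beq q && x.2.any n.beq

/-- The criterion with everything in the core applies for `n` at least this bound. -/
def asymptoticBound (q : ℕ) : ℕ :=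
  cond (q.ble 2) 400 (cond (q.ble 3) 252 (cond (q.ble 5) 200 (cond (q.ble 13) 145
    (cond (q.ble 150) 90 74))))

def degreeLoop (q : ℕ) : ℕ → Bool
  | 0 => true
  | n + 1 => (n.ble 6 || (isExceptional q n || pairCheck q n)) && degreeLoop q n

/-- Checks all prime powers `q` with `a ≤ q < a + k`. -/
def fieldLoop (a : ℕ) : ℕ → Bool
  | 0 => true
  | k + 1 => (notPrimePow (a + k) || (asymptoticCheck (a + k) (asymptoticBound (a + k)) &&
      degreeLoop (a + k) (asymptoticBound (a + k)))) && fieldLoop a k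

/-- Checks a fixed `n` for all prime powers `q` with `a ≤ q < a + k`. -/
def fixedDegreeLoop (n a : ℕ) : ℕ → Bool
  | 0 => true
  | k + 1 => (notPrimePow (a + k) || pairCheck (a + k) n) && fixedDegreeLoop n a k

set_option exponentiation.threshold 1000 in
theorem asymptoticCheck_of_le {q : ℕ} (hq : 264 ≤ q) : asymptoticCheck q 36 = true := by
  have hlt : ∀ d, ¬ q ^ (d + 1) < 264 := fun d =>
    not_lt.2 (hq.trans (Nat.le_self_pow (Nat.succ_ne_zero d) q))
  have hblt : ∀ d, (q ^ (d + 1)).blt 264 = false := fun d => by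
    rw [← Bool.not_eq_true, Nat.blt_eq]
    exact hlt d
  have hnum : ∀ T, excessNum q T = 1 := fun T => by
    induction T with
    | zero => rfl
    | succ d ih => rw [excessNum, ih, hblt, cond_false]
  have hden : ∀ T, excessDen q T = 1 := fun T => by
    induction T with
    | zero => rfl
    | succ d ih => rw [excessDen, ih, hblt, cond_false]
  rw [asymptoticCheck, Nat.blt_eq, hnum, hden, one_pow, mul_one, mul_one,
    show 6 * 36 = 126 + 90 by norm_num, pow_add]
  refine Nat.mul_lt_mul_of_pos_right ?_ (Nat.pow_pos (by omega))
  calc 2 ^ 689 < 2 ^ (8 * 126) := Nat.pow_lt_pow_right (by norm_num) (by norm_num)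
    _ = (2 ^ 8) ^ 126 := pow_mul _ _ _
    _ ≤ q ^ 126 := Nat.pow_le_pow_left (by omega) _

theorem fieldLoop_two : fieldLoop 2 30 = true := by decide +kernel

theorem fieldLoop_thirtyTwo : fieldLoop 32 232 = true := by decide +kernel

theorem fixedDegreeLoop_eight : fixedDegreeLoop 8 264 1686 = true := by decide +kernel

theorem fixedDegreeLoop_nine : fixedDegreeLoop 9 264 136 = true := by decide +kernel

theorem degreeLoop_spec {q N n : ℕ} (h : degreeLoop q N = true) (hn : n < N) (hn7 : 7 ≤ n) :
    isExceptional q n = true ∨ pairCheck q n = true := by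
  induction N with
  | zero => omega
  | succ m ih =>
    rw [degreeLoop, Bool.and_eq_true, Bool.or_eq_true, Bool.or_eq_true, Nat.ble_eq] at h
    rcases Nat.lt_succ_iff_lt_or_eq.1 hn with h' | rfl
    · exact ih h.2 h'
    · exact h.1.resolve_left (by omega)

theorem fieldLoop_spec {a k q : ℕ} (h : fieldLoop a k = true) (ha : a ≤ q) (hq : q < a + k)
    (hpp : notPrimePow q = false) :
    asymptoticCheck q (asymptoticBound q) = true ∧ degreeLoop q (asymptoticBound q) = true := by
  induction k with
  | zero => omega
  | succ m ih =>
    rw [fieldLoop, Bool.and_eq_true, Bool.or_eq_true, Bool.and_eq_true] at h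
    rcases (by omega : q < a + m ∨ q = a + m) with h' | rfl
    · exact ih h.2 h'
    · exact h.1.resolve_left (by simp [hpp])

theorem fixedDegreeLoop_spec {n a k q : ℕ} (h : fixedDegreeLoop n a k = true) (ha : a ≤ q)
    (hq : q < a + k) (hpp : notPrimePow q = false) : pairCheck q n = true := by
  induction k with
  | zero => omega
  | succ m ih =>
    rw [fixedDegreeLoop, Bool.and_eq_true, Bool.or_eq_true] at h
    rcases (by omega : q < a + m ∨ q = a + m) with h' | rfl
    · exact ih h.2 h'
    · exact h.1.resolve_left (by simp [hpp])

section NonExceptional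

variable {Fq F : Type*} [Field Fq] [Field F] [Fintype Fq] [Fintype F] [Algebra Fq F]

theorem exists_of_pairCheck {n : ℕ} (hn : Module.finrank Fq F = n)
    (h : pairCheck (Fintype.card Fq) n = true) :
    HasPrimitiveOneNormalPair Fq F (Fintype.card Fq) n := by
  have hM : (Fintype.card Fq ^ n - 1) / (Fintype.card Fq - 1) * (Fintype.card Fq - 1) =
      Fintype.card Fq ^ n - 1 := by
    refine Nat.div_mul_cancel ?_
    simpa using Nat.sub_dvd_pow_sub_pow (Fintype.card Fq) 1 n
  unfold pairCheck at h
  generalize (Fintype.card Fq ^ n - 1) / (Fintype.card Fq - 1) = M at *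
  simp only [pairCheckAux, Bool.or_eq_true] at h
  rcases h with h | h | h | h | h | h | h | h | h | h | h | h | h
  · exact exists_of_weightCheck hn hM h
  all_goals exact exists_of_sieveCheck hn hM h

/-- The sieve settles all but finitely many pairs `(q, n)`. -/
theorem exists_of_not_isExceptional {n : ℕ} (hn : Module.finrank Fq F = n) (hn7 : 7 ≤ n)
    (hex : isExceptional (Fintype.card Fq) n = false) :
    HasPrimitiveOneNormalPair Fq F (Fintype.card Fq) n := by
  have hpp : IsPrimePow (Fintype.card Fq) := FiniteField.isPrimePow_card Fq
  have hq2 : 2 ≤ Fintype.card Fq := Fintype.one_lt_card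
  by_cases hq : 264 ≤ Fintype.card Fq
  · by_cases h8 : n = 8 ∧ Fintype.card Fq < 1950
    · obtain ⟨rfl, h8⟩ := h8
      exact exists_of_pairCheck hn (fixedDegreeLoop_spec fixedDegreeLoop_eight hq h8
        (notPrimePow_eq_false hpp (by omega)))
    by_cases h9 : n = 9 ∧ Fintype.card Fq < 400
    · obtain ⟨rfl, h9⟩ := h9
      exact exists_of_pairCheck hn (fixedDegreeLoop_spec fixedDegreeLoop_nine hq h9
        (notPrimePow_eq_false hpp (by omega)))
    by_cases h35 : n ≤ 35
    · exact exists_of_finrank_le hn hn7 h35 hq (by omega) (by omega)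
    · exact exists_of_asymptoticCheck hn hn7 (by omega : 36 ≤ n)
        (asymptoticCheck_of_le hq)
  · have hpp' := notPrimePow_eq_false hpp (by omega)
    have h : asymptoticCheck (Fintype.card Fq) (asymptoticBound (Fintype.card Fq)) = true ∧
        degreeLoop (Fintype.card Fq) (asymptoticBound (Fintype.card Fq)) = true := by
      by_cases h32 : Fintype.card Fq < 32
      · exact fieldLoop_spec fieldLoop_two hq2 (by omega) hpp'
      · exact fieldLoop_spec fieldLoop_thirtyTwo (by omega) (by omega) hpp'
    by_cases hN : n < asymptoticBound (Fintype.card Fq)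
    · refine exists_of_pairCheck hn ((degreeLoop_spec h.2 hN hn7).resolve_left ?_)
      simp [hex]
    · exact exists_of_asymptoticCheck hn hn7 (not_lt.1 hN) h.1

end NonExceptional

/-! ### Packed arithmetic in finite fields

Elements `P(θ)` of a ring of characteristic `p` are represented by the natural number `P(2 ^ w)`,
where `P` has small natural coefficients. -/

/-- Constants of the packed arithmetic for a ring of characteristic `p` with an element `θ` such
that `θ ^ m = a(θ)`, where `a` has the coefficients `poly`: coefficients occupy `w` bits and are
at most `cap`; reduction modulo `p` multiplies by an approximation of `2 ^ shift / p`. -/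
structure Packing where
  p : ℕ
  m : ℕ
  poly : List ℕ
  cap : ℕ
  w : ℕ
  shift : ℕ

/-- `x` is the value at `2 ^ w` and `v` the value at `θ` of a polynomial of degree at most `d` with
natural coefficients of sum at most `b`. -/
def Represents {R : Type*} [CommSemiring R] (w : ℕ) (θ : R) (d b x : ℕ) (v : R) : Prop :=
  ∃ P : ℕ[X], P.natDegree ≤ d ∧ P.eval 1 ≤ b ∧ P.eval (2 ^ w) = x ∧ aeval θ P = v

namespace Represents

variable {R : Type*} [CommSemiring R] {w : ℕ} {θ : R} {d d' b b' x x' : ℕ} {v v' : R}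

theorem mono (h : Represents w θ d b x v) (hd : d ≤ d') (hb : b ≤ b') :
    Represents w θ d' b' x v := by
  obtain ⟨P, h1, h2, h3⟩ := h
  exact ⟨P, h1.trans hd, h2.trans hb, h3⟩

theorem natCast (c : ℕ) : Represents w θ 0 c c (c : R) :=
  ⟨C c, by simp, by simp, by simp, by simp⟩

theorem add (h : Represents w θ d b x v) (h' : Represents w θ d b' x' v') :
    Represents w θ d (b + b') (x + x') (v + v') := by
  obtain ⟨P, h1, h2, h3, h4⟩ := h
  obtain ⟨P', h1', h2', h3', h4'⟩ := h'
  exact ⟨P + P', natDegree_add_le_of_degree_le h1 h1', by rw [eval_add]; omega,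
    by rw [eval_add, h3, h3'], by rw [map_add, h4, h4']⟩

theorem mul (h : Represents w θ d b x v) (h' : Represents w θ d' b' x' v') :
    Represents w θ (d + d') (b * b') (x * x') (v * v') := by
  obtain ⟨P, h1, h2, h3, h4⟩ := h
  obtain ⟨P', h1', h2', h3', h4'⟩ := h'
  exact ⟨P * P', natDegree_mul_le.trans (add_le_add h1 h1'),
    by rw [eval_mul]; exact Nat.mul_le_mul h2 h2',
    by rw [eval_mul, h3, h3'], by rw [map_mul, h4, h4']⟩

theorem cons (c : ℕ) (h : Represents w θ d b x v) :
    Represents w θ (d + 1) (c + b) (c + 2 ^ w * x) (c + θ * v) := by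
  obtain ⟨P, h1, h2, h3, h4⟩ := h
  refine ⟨C c + X * P, ?_, by simpa using h2, by simp [h3], by simp [h4]⟩
  refine natDegree_add_le_of_degree_le (by simp) (natDegree_mul_le.trans ?_)
  have := natDegree_X_le (R := ℕ)
  omega

/-- The lowest coefficient can be split off. -/
theorem uncons (h : Represents w θ d b x v) : ∃ c b' x' v', Represents w θ (d - 1) b' x' v' ∧
    c + b' ≤ b ∧ x = c + 2 ^ w * x' ∧ v = c + θ * v' ∧ (d = 0 → x' = 0 ∧ v' = 0) := by
  obtain ⟨P, h1, h2, h3, h4⟩ := h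
  have hP := X_mul_divX_add P
  refine ⟨P.coeff 0, P.divX.eval 1, P.divX.eval (2 ^ w), aeval θ P.divX,
    ⟨P.divX, ?_, le_rfl, rfl, rfl⟩, ?_, ?_, ?_, ?_⟩
  · rw [natDegree_divX_eq_natDegree_tsub_one]
    omega
  · rw [← hP] at h2
    simp only [eval_add, eval_mul, eval_X, eval_C] at h2
    omega
  · rw [← hP] at h3
    simp only [eval_add, eval_mul, eval_X, eval_C] at h3
    omega
  · rw [← h4]
    conv_lhs => rw [← hP]
    simp [add_comm]
  · rintro rfl
    rw [divX_eq_zero_iff.2 (eq_C_of_natDegree_le_zero h1)]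
    simp

theorem eq_zero (h : Represents w θ d b 0 v) : v = 0 := by
  obtain ⟨P, -, -, h3, h4⟩ := h
  suffices P = 0 by rw [← h4, this, map_zero]
  ext i
  rw [eval_eq_sum_range] at h3
  by_contra hi
  have hmem : i ∈ Finset.range (P.natDegree + 1) :=
    Finset.mem_range.2 (Nat.lt_succ_of_le (le_natDegree_of_ne_zero hi))
  have := (Finset.sum_eq_zero_iff_of_nonneg fun _ _ => Nat.zero_le _).1 h3 i hmem
  simp at this
  exact hi this

theorem lt (h : Represents w θ d b x v) (hb : b < 2 ^ w) : x < 2 ^ (w * (d + 1)) := by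
  induction d generalizing b x v with
  | zero =>
    obtain ⟨c, b', x', v', -, hb', rfl, -, h0⟩ := h.uncons
    rw [(h0 rfl).1]
    simpa using by omega
  | succ d ih =>
    obtain ⟨c, b', x', v', h', hb', rfl, -, -⟩ := h.uncons
    have := ih h' (by omega)
    calc c + 2 ^ w * x' < 2 ^ w * (x' + 1) := by rw [mul_add]; omega
      _ ≤ 2 ^ w * 2 ^ (w * (d + 1)) := Nat.mul_le_mul_left _ this
      _ = 2 ^ (w * (d + 1 + 1)) := by rw [← pow_add]; ring_nf

/-- Splitting at the coefficient of `θ ^ (m + 1)`. -/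
theorem split (m : ℕ) (h : Represents w θ d b x v) (hb : b < 2 ^ w) :
    ∃ b₁ b₂ v₁ v₂, b₁ + b₂ ≤ b ∧ Represents w θ m b₁ (x % 2 ^ (w * (m + 1))) v₁ ∧
      Represents w θ (d - (m + 1)) b₂ (x / 2 ^ (w * (m + 1))) v₂ ∧ v = v₁ + θ ^ (m + 1) * v₂ := by
  suffices H : ∃ b₁ b₂ x₁ x₂ v₁ v₂, b₁ + b₂ ≤ b ∧ Represents w θ m b₁ x₁ v₁ ∧
      Represents w θ (d - (m + 1)) b₂ x₂ v₂ ∧ x = x₁ + 2 ^ (w * (m + 1)) * x₂ ∧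
      v = v₁ + θ ^ (m + 1) * v₂ by
    obtain ⟨b₁, b₂, x₁, x₂, v₁, v₂, h1, h2, h3, h4, h5⟩ := H
    have hlt := h2.lt (by omega)
    have hmod : x % 2 ^ (w * (m + 1)) = x₁ := by
      rw [h4, Nat.add_mul_mod_self_left, Nat.mod_eq_of_lt hlt]
    have hdiv : x / 2 ^ (w * (m + 1)) = x₂ := by
      rw [h4, Nat.add_mul_div_left _ _ (by positivity), Nat.div_eq_of_lt hlt, zero_add]
    exact ⟨b₁, b₂, v₁, v₂, h1, hmod ▸ h2, hdiv ▸ h3, h5⟩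
  clear hb
  induction m generalizing d b x v with
  | zero =>
    obtain ⟨c, b', x', v', h', hb', rfl, rfl, -⟩ := h.uncons
    exact ⟨c, b', c, x', c, v', hb', natCast c, h', by simp, by simp⟩
  | succ m ih =>
    obtain ⟨c, b', x', v', h', hb', rfl, rfl, -⟩ := h.uncons
    obtain ⟨b₁, b₂, x₁, x₂, v₁, v₂, h1, h2, h3, rfl, rfl⟩ := ih h'
    refine ⟨c + b₁, b₂, c + 2 ^ w * x₁, x₂, c + θ * v₁, v₂, by omega, h2.cons c, ?_, ?_, ?_⟩
    · rwa [show d - (m + 1 + 1) = d - 1 - (m + 1) by omega]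
    · rw [mul_add w (m + 1), pow_add, mul_one]
      ring
    · ring

end Represents

/-- `2 ^ s - 1` repeated at the first `k` multiples of `w` bits. -/
def laneMask (w s : ℕ) : ℕ → ℕ
  | 0 => 0
  | k + 1 => (2 ^ s - 1) + 2 ^ w * laneMask w s k

theorem Nat.add_mul_land_add_mul {w a b : ℕ} (ha : a < 2 ^ w) (hb : b < 2 ^ w) (c d : ℕ) :
    (a + 2 ^ w * c) &&& (b + 2 ^ w * d) = (a &&& b) + 2 ^ w * (c &&& d) := by
  have h : a &&& b < 2 ^ w := Nat.and_lt_two_pow a hb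
  refine Nat.eq_of_testBit_eq fun i => ?_
  rw [Nat.testBit_and, add_comm a, add_comm b, add_comm (a &&& b), Nat.testBit_two_pow_mul_add _ ha,
    Nat.testBit_two_pow_mul_add _ hb, Nat.testBit_two_pow_mul_add _ h]
  split_ifs <;> simp

/-- Division by `p` through a multiplication and a shift. -/
theorem Nat.mul_div_two_pow_eq_div {p s c : ℕ} (hp : 0 < p) (hc : c * p < 2 ^ s) :
    c * (2 ^ s / p + 1) / 2 ^ s = c / p := by
  set μ := 2 ^ s / p + 1 with hμ
  have h1 : p * μ = 2 ^ s + (p - 2 ^ s % p) := by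
    have := Nat.div_add_mod (2 ^ s) p
    have := Nat.mod_lt (2 ^ s) hp
    rw [hμ, mul_add]
    omega
  set r := p - 2 ^ s % p with hr
  have hrp : r ≤ p := Nat.sub_le _ _
  have hct := Nat.div_add_mod c p
  have ht := Nat.mod_lt c hp
  set z := c / p
  set t := c % p
  have h2 : c * μ = z * r + t * μ + 2 ^ s * z := by
    rw [← hct]
    calc (p * z + t) * μ = (p * μ) * z + t * μ := by ring
      _ = _ := by rw [h1]; ring
  have h3 : z * r + t * μ < 2 ^ s := by
    refine lt_of_mul_lt_mul_left (a := p) ?_ (Nat.zero_le p)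
    calc p * (z * r + t * μ) = r * (p * z + t) + t * 2 ^ s := by
          rw [mul_add, mul_left_comm p t, h1]; ring
      _ = r * c + t * 2 ^ s := by rw [hct]
      _ ≤ c * p + (p - 1) * 2 ^ s := by
          refine add_le_add ?_ (Nat.mul_le_mul_right _ (by omega))
          rw [mul_comm]
          exact Nat.mul_le_mul_left _ hrp
      _ < 2 ^ s + (p - 1) * 2 ^ s := by omega
      _ = p * 2 ^ s := by
          obtain ⟨p, rfl⟩ : ∃ p', p = p' + 1 := ⟨p - 1, by omega⟩
          rw [Nat.add_sub_cancel]
          ring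
  rw [h2, Nat.add_mul_div_left _ _ (by positivity), Nat.div_eq_of_lt h3, zero_add]

namespace Packing

/-- Reduces all coefficients modulo `p`. -/
def reduce (K : Packing) (x : ℕ) : ℕ :=
  x - K.p * ((x * (2 ^ K.shift / K.p + 1) -
    ((x * (2 ^ K.shift / K.p + 1)) &&& laneMask K.w K.shift K.m)) / 2 ^ K.shift)

theorem represents_reduce_aux {R : Type*} [CommRing R] {p w s d b x : ℕ} {θ v : R}
    (hpR : (p : R) = 0) (hp : 0 < p) (hs : s ≤ w) (hbs : b * p < 2 ^ s)
    (hbw : b * (2 ^ s / p + 1) < 2 ^ w) (h : Represents w θ d b x v) :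
    ∃ y z, x * (2 ^ s / p + 1) - ((x * (2 ^ s / p + 1)) &&& laneMask w s (d + 1)) = 2 ^ s * z ∧
      x = y + p * z ∧ Represents w θ d ((d + 1) * (p - 1)) y v := by
  have hlane : ∀ c, c ≤ b → c * (2 ^ s / p + 1) < 2 ^ w ∧
      c * (2 ^ s / p + 1) - ((c * (2 ^ s / p + 1)) &&& (2 ^ s - 1)) = 2 ^ s * (c / p) := by
    intro c hc
    refine ⟨(Nat.mul_le_mul_right _ hc).trans_lt hbw, ?_⟩
    rw [Nat.and_two_pow_sub_one_eq_mod, ← Nat.mul_div_two_pow_eq_div hp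
      ((Nat.mul_le_mul_right _ hc).trans_lt hbs)]
    have := Nat.div_add_mod (c * (2 ^ s / p + 1)) (2 ^ s)
    omega
  have hmask : 2 ^ s - 1 < 2 ^ w := by
    have : 2 ^ s ≤ 2 ^ w := Nat.pow_le_pow_right (by norm_num) hs
    have : 0 < 2 ^ s := by positivity
    omega
  have hmod : ∀ c, c % p ≤ p - 1 := fun c => Nat.le_sub_one_of_lt (Nat.mod_lt c hp)
  have hcast : ∀ c : ℕ, ((c % p : ℕ) : R) = c := by
    intro c
    conv_rhs => rw [← Nat.div_add_mod c p]
    rw [Nat.cast_add, Nat.cast_mul, hpR, zero_mul, zero_add]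
  induction d generalizing b x v with
  | zero =>
    obtain ⟨c, b', x', v', -, hb', rfl, rfl, h0⟩ := h.uncons
    obtain ⟨rfl, rfl⟩ := h0 rfl
    refine ⟨c % p, c / p, ?_, ?_, ?_⟩
    · simpa [laneMask] using (hlane c (by omega)).2
    · simpa using (Nat.mod_add_div c p).symm
    · have := (Represents.natCast (w := w) (θ := θ) (c % p)).mono le_rfl
        ((hmod c).trans (Nat.one_mul _).ge)
      simpa [hcast] using this
  | succ d ih =>
    obtain ⟨c, b', x', v', h', hb', rfl, rfl, -⟩ := h.uncons
    have hb'' : b' ≤ b := by omega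
    obtain ⟨y, z, h1, h2, h3⟩ := ih ((Nat.mul_le_mul_right _ hb'').trans_lt hbs)
      ((Nat.mul_le_mul_right _ hb'').trans_lt hbw) h' (fun c hc => hlane c (hc.trans hb''))
    obtain ⟨hc1, hc2⟩ := hlane c (by omega)
    refine ⟨c % p + 2 ^ w * y, c / p + 2 ^ w * z, ?_, ?_, ?_⟩
    · rw [add_mul, mul_assoc (2 ^ w), laneMask, Nat.add_mul_land_add_mul hc1 hmask, mul_add (2 ^ s),
        ← hc2, mul_left_comm (2 ^ s) (2 ^ w), ← h1, Nat.mul_sub]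
      have := Nat.and_le_left (n := c * (2 ^ s / p + 1)) (m := 2 ^ s - 1)
      have := Nat.mul_le_mul_left (2 ^ w) (Nat.and_le_left (n := x' * (2 ^ s / p + 1))
        (m := laneMask w s (d + 1)))
      omega
    · conv_lhs => rw [h2, ← Nat.mod_add_div c p]
      ring
    · have := (h3.cons (c % p)).mono (b' := (d + 1 + 1) * (p - 1)) le_rfl
        (by rw [add_mul (d + 1), one_mul, add_comm]; exact Nat.add_le_add_left (hmod c) _)
      rwa [hcast] at this

end Packing
/-- The polynomial with the given coefficients. -/
def listPoly : List ℕ → ℕ[X]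
  | [] => 0
  | c :: l => C c + X * listPoly l

theorem natDegree_listPoly (l : List ℕ) : (listPoly l).natDegree ≤ l.length - 1 := by
  induction l with
  | nil => simp [listPoly]
  | cons c l ih =>
    cases l with
    | nil => simp [listPoly]
    | cons c' l =>
      rw [listPoly]
      refine natDegree_add_le_of_degree_le (by simp) (natDegree_mul_le.trans ?_)
      have := natDegree_X_le (R := ℕ)
      simp only [List.length_cons] at ih ⊢
      omega

/-- The list `l` read in base `2 ^ w`. -/
def pack (w : ℕ) : List ℕ → ℕ
  | [] => 0
  | c :: l => c + 2 ^ w * pack w l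

theorem represents_pack {R : Type*} [CommSemiring R] (w : ℕ) (θ : R) (l : List ℕ) :
    Represents w θ (l.length - 1) l.sum (pack w l) (aeval θ (listPoly l)) := by
  refine ⟨listPoly l, natDegree_listPoly l, ?_, ?_, rfl⟩
  · induction l with
    | nil => simp [listPoly]
    | cons c l ih => simpa [listPoly] using ih
  · induction l with
    | nil => simp [listPoly, pack]
    | cons c l ih => simp [listPoly, pack, ih]

/-- The last `k` digits of `x` in base `p`. -/
def lowDigits (p : ℕ) : ℕ → ℕ → List ℕ
  | 0, _ => []
  | k + 1, x => x % p :: lowDigits p k (x / p)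

theorem length_lowDigits (p k x : ℕ) : (lowDigits p k x).length = k := by
  induction k generalizing x with
  | zero => rfl
  | succ k ih => rw [lowDigits, List.length_cons, ih]

theorem sum_lowDigits {p : ℕ} (hp : 0 < p) (k x : ℕ) :
    (lowDigits p k x).sum ≤ k * (p - 1) := by
  induction k generalizing x with
  | zero => simp [lowDigits]
  | succ k ih =>
    rw [lowDigits, List.sum_cons, add_mul, one_mul, add_comm]
    exact add_le_add (ih _) (Nat.le_sub_one_of_lt (Nat.mod_lt x hp))

namespace Packing

/-- Replaces `θ ^ m` by `a(θ)` once. -/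
def fold (K : Packing) (x : ℕ) : ℕ :=
  x % 2 ^ (K.w * K.m) + pack K.w K.poly * (x / 2 ^ (K.w * K.m))

def normalize (K : Packing) (x : ℕ) : ℕ := K.reduce (K.fold (K.fold x))

def mulMod (K : Packing) (x y : ℕ) : ℕ := K.normalize (x * y)

/-- `x ^ e` for `e < 2 ^ k`. -/
def powMod (K : Packing) : ℕ → ℕ → ℕ → ℕ
  | 0, _, _ => 1
  | k + 1, x, e => cond ((e % 2).beq 0) (K.powMod k (K.mulMod x x) (e / 2))
      (K.mulMod x (K.powMod k (K.mulMod x x) (e / 2)))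

def encode (K : Packing) (x : ℕ) : ℕ := pack K.w (lowDigits K.p K.m x)

def isZero (K : Packing) (x : ℕ) : Bool := (K.reduce x).beq 0

def isOne (K : Packing) (x : ℕ) : Bool := K.isZero (x + (K.p - 1))

/-- The inequalities ensuring that no coefficient overflows. -/
def isValid (K : Packing) : Bool :=
  Nat.ble 2 K.p && (Nat.ble 2 K.m && (K.shift.ble K.w && ((K.cap * K.p).blt (2 ^ K.shift) &&
    ((K.cap * (2 ^ K.shift / K.p + 1)).blt (2 ^ K.w) &&
    ((2 * (K.poly.length - 1)).ble (K.m + 1) && (Nat.ble 1 K.poly.sum &&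
    ((K.m * (K.p - 1) * (K.m * (K.p - 1)) * K.poly.sum * K.poly.sum).ble K.cap &&
    (K.m * (K.p - 1) + (K.p - 1)).ble K.cap)))))))

/-- `x` is a reduced representative of `v`. -/
def Rep {R : Type*} [CommSemiring R] (K : Packing) (θ : R) (x : ℕ) (v : R) : Prop :=
  Represents K.w θ (K.m - 1) (K.m * (K.p - 1)) x v

/-- The element with representative `K.encode x`. -/
def decode {R : Type*} [CommSemiring R] (K : Packing) (θ : R) (x : ℕ) : R :=
  aeval θ (listPoly (lowDigits K.p K.m x))

/-- A ring element `θ` satisfying the relations of the packing `K`. -/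
structure IsRoot {R : Type*} [CommRing R] (K : Packing) (θ : R) : Prop where
  valid : K.isValid = true
  char : (K.p : R) = 0
  root : θ ^ K.m = aeval θ (listPoly K.poly)

namespace IsRoot

variable {R : Type*} [CommRing R] {K : Packing} {θ : R} {d b x y : ℕ} {v u : R}

theorem bounds (hK : K.IsRoot θ) : 2 ≤ K.p ∧ 2 ≤ K.m ∧ K.shift ≤ K.w ∧ K.cap * K.p < 2 ^ K.shift ∧
    K.cap * (2 ^ K.shift / K.p + 1) < 2 ^ K.w ∧ 2 * (K.poly.length - 1) ≤ K.m + 1 ∧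
    1 ≤ K.poly.sum ∧
    K.m * (K.p - 1) * (K.m * (K.p - 1)) * K.poly.sum * K.poly.sum ≤ K.cap ∧
    K.m * (K.p - 1) + (K.p - 1) ≤ K.cap := by
  have := hK.valid
  simp only [isValid, Bool.and_eq_true, Nat.ble_eq, Nat.blt_eq] at this
  exact this

theorem cap_lt (hK : K.IsRoot θ) : K.cap < 2 ^ K.w := by
  obtain ⟨-, -, -, -, h, -⟩ := hK.bounds
  exact (Nat.le_mul_of_pos_right _ (Nat.succ_pos _)).trans_lt h

theorem represents_reduce (hK : K.IsRoot θ) (h : Represents K.w θ (K.m - 1) b x v)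
    (hb : b ≤ K.cap) : K.Rep θ (K.reduce x) v := by
  obtain ⟨h1, h2, h3, h4, h5, -⟩ := hK.bounds
  obtain ⟨y, z, hz, hy, hr⟩ := represents_reduce_aux hK.char (by omega) h3 h4 h5
    (h.mono le_rfl hb)
  rw [Nat.sub_add_cancel (by omega)] at hz hr
  rw [reduce, hz, Nat.mul_div_cancel_left _ (by positivity), hy, Nat.add_sub_cancel]
  exact hr

theorem represents_fold (hK : K.IsRoot θ) (h : Represents K.w θ d b x v) (hb : b ≤ K.cap) :
    Represents K.w θ (max (K.m - 1) (K.poly.length - 1 + (d - K.m))) (b * K.poly.sum)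
      (K.fold x) v := by
  obtain ⟨-, h2, -, -, -, -, ha, -⟩ := hK.bounds
  obtain ⟨b₁, b₂, v₁, v₂, hb', h1, h3, rfl⟩ := h.split (K.m - 1) (hb.trans_lt hK.cap_lt)
  rw [Nat.sub_add_cancel (by omega)] at h1 h3 ⊢
  rw [hK.root]
  refine ((h1.mono (le_max_left _ _) (Nat.le_mul_of_pos_right b₁ ha)).add
    (((represents_pack K.w θ K.poly).mul h3).mono (le_max_right _ _) le_rfl)).mono le_rfl ?_
  rw [mul_comm K.poly.sum, ← add_mul]
  exact Nat.mul_le_mul_right _ hb'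

theorem rep_normalize (hK : K.IsRoot θ) (h : Represents K.w θ (K.m - 1 + (K.m - 1)) b x v)
    (hb : b * K.poly.sum * K.poly.sum ≤ K.cap) : K.Rep θ (K.normalize x) v := by
  obtain ⟨-, h2, -, -, -, h6, ha, -⟩ := hK.bounds
  have hb1 : b * K.poly.sum ≤ K.cap := (Nat.le_mul_of_pos_right _ ha).trans hb
  have hb0 : b ≤ K.cap := (Nat.le_mul_of_pos_right _ ha).trans hb1
  refine hK.represents_reduce ((hK.represents_fold (hK.represents_fold h hb0) hb1).mono ?_ le_rfl)
    hb
  omega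

theorem rep_mulMod (hK : K.IsRoot θ) (h : K.Rep θ x v) (h' : K.Rep θ y u) :
    K.Rep θ (K.mulMod x y) (v * u) :=
  hK.rep_normalize (Represents.mul h h') hK.bounds.2.2.2.2.2.2.2.1

theorem rep_one (hK : K.IsRoot θ) : K.Rep θ 1 (1 : R) := by
  obtain ⟨h1, h2, -⟩ := hK.bounds
  have := (Represents.natCast (w := K.w) (θ := θ) 1).mono (Nat.zero_le (K.m - 1))
    (Nat.mul_pos (by omega : 0 < K.m) (by omega : 0 < K.p - 1))
  rwa [Nat.cast_one] at this

theorem rep_powMod (hK : K.IsRoot θ) {k e : ℕ} (he : e < 2 ^ k) (h : K.Rep θ x v) :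
    K.Rep θ (K.powMod k x e) (v ^ e) := by
  induction k generalizing x v e with
  | zero =>
    obtain rfl : e = 0 := by simpa using he
    simpa [powMod] using hK.rep_one
  | succ k ih =>
    have h2 := ih (e := e / 2) (by rw [pow_succ] at he; omega) (hK.rep_mulMod h h)
    rw [← pow_two, ← pow_mul] at h2
    rw [powMod]
    cases he2 : (e % 2).beq 0 with
    | true =>
      rw [Nat.beq_eq] at he2
      rwa [show 2 * (e / 2) = e by omega] at h2
    | false =>
      have he2' : e % 2 ≠ 0 := fun h0 => by simp [h0] at he2
      have h3 := hK.rep_mulMod h h2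
      rwa [← pow_succ', show 2 * (e / 2) + 1 = e by omega] at h3

theorem rep_encode (hK : K.IsRoot θ) (x : ℕ) : K.Rep θ (K.encode x) (K.decode θ x) := by
  have := represents_pack K.w θ (lowDigits K.p K.m x)
  rw [length_lowDigits] at this
  exact this.mono le_rfl (sum_lowDigits (by have := hK.bounds; omega) _ _)

theorem eq_zero_of_isZero (hK : K.IsRoot θ) (h : Represents K.w θ (K.m - 1) b x v)
    (hb : b ≤ K.cap) (hx : K.isZero x = true) : v = 0 := by
  have h1 := hK.represents_reduce h hb
  rw [isZero, Nat.beq_eq] at hx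
  rw [hx] at h1
  exact Represents.eq_zero h1

theorem rep_sub_one (hK : K.IsRoot θ) (h : K.Rep θ x v) :
    Represents K.w θ (K.m - 1) (K.m * (K.p - 1) + (K.p - 1)) (x + (K.p - 1)) (v - 1) := by
  have h1 := Represents.add h ((Represents.natCast (w := K.w) (θ := θ) (K.p - 1)).mono
    (Nat.zero_le (K.m - 1)) le_rfl)
  have hp := hK.bounds.1
  rwa [Nat.cast_sub (by omega), hK.char, Nat.cast_one, zero_sub, ← sub_eq_add_neg] at h1

theorem eq_one_of_isOne (hK : K.IsRoot θ) (h : K.Rep θ x v) (hx : K.isOne x = true) : v = 1 :=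
  sub_eq_zero.1 (hK.eq_zero_of_isZero (hK.rep_sub_one h) hK.bounds.2.2.2.2.2.2.2.2 hx)

/-- The generator of the ring is recognised through its representative `2 ^ w`. -/
theorem rep_root (hK : K.IsRoot θ) : K.Rep θ (2 ^ K.w) θ := by
  obtain ⟨h1, h2, -⟩ := hK.bounds
  refine ⟨X, natDegree_X_le.trans (by omega), ?_, by simp, by simp⟩
  rw [eval_X]
  exact Nat.mul_pos (by omega : 0 < K.m) (by omega : 0 < K.p - 1)

end IsRoot
end Packing

/-! ### Explicit pairs -/

section Functional

variable {Fq F : Type*} [Field Fq] [Fintype Fq] [Field F] [Algebra Fq F]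

/-- An element `α` of trace zero is `1`-normal if some functional `x ↦ Tr (β x)` vanishes on the
first `n - 2` conjugates of `α` but not on the next one. -/
theorem isKNormal_one_of_functional {n : ℕ} (hn2 : 2 ≤ n) {α β : F}
    (h0 : ∑ k ∈ Finset.range n, α ^ Fintype.card Fq ^ k = 0)
    (h1 : ∀ i < n - 2, ∑ k ∈ Finset.range n,
      β ^ Fintype.card Fq ^ k * α ^ Fintype.card Fq ^ (i + k) = 0)
    (h2 : ∑ k ∈ Finset.range n,
      β ^ Fintype.card Fq ^ k * α ^ Fintype.card Fq ^ (n - 2 + k) = 1) :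
    IsKNormal Fq (Fintype.card Fq) n 1 α := by
  set φ := frobLin Fq F with hφ
  have hφp : ∀ (i : ℕ) (x : F), (φ ^ i) x = x ^ Fintype.card Fq ^ i := frobLin_pow_apply
  set T : F →ₗ[Fq] F := (∑ k ∈ Finset.range n, φ ^ k) ∘ₗ LinearMap.mulLeft Fq β with hT
  have hTα : ∀ i, T ((φ ^ i) α) = ∑ k ∈ Finset.range n,
      β ^ Fintype.card Fq ^ k * α ^ Fintype.card Fq ^ (i + k) := by
    intro i
    rw [hT, LinearMap.comp_apply, LinearMap.sum_apply]
    refine Finset.sum_congr rfl fun k _ => ?_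
    rw [hφp, hφp, LinearMap.mulLeft_apply, mul_pow, ← pow_mul, ← pow_add]
  refine ⟨tracePoly Fq n, ⟨tracePoly_monic (by omega), tracePoly_dvd n, ?_, ?_⟩,
    natDegree_tracePoly (by omega)⟩
  · rw [polyAct_eq_aeval, tracePoly, map_sum, LinearMap.sum_apply, ← h0]
    refine Finset.sum_congr rfl fun k _ => ?_
    rw [map_pow, aeval_X, ← hφ, hφp]
  · intro h' hmon _ hker
    rw [natDegree_tracePoly (by omega)]
    by_contra hlt
    rw [polyAct_eq_aeval, ← hφ] at hker
    set d := h'.natDegree with hd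
    have h3 : T ((φ ^ (n - 2 - d)) (aeval φ h' α)) = 0 := by rw [hker, map_zero, map_zero]
    rw [aeval_eq_sum_range, LinearMap.sum_apply, map_sum, map_sum, Finset.sum_range_succ,
      Finset.sum_eq_zero, zero_add, ← hd] at h3
    · rw [show h'.coeff d = 1 from hmon, one_smul, ← Module.End.mul_apply (φ ^ _), ← pow_add,
        show n - 2 - d + d = n - 2 by omega, hTα, h2] at h3
      exact one_ne_zero h3
    · intro i hi
      rw [Finset.mem_range] at hi
      rw [LinearMap.smul_apply, map_smul, map_smul, ← Module.End.mul_apply (φ ^ _), ← pow_add, hTα,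
        h1 _ (by omega), smul_zero]

end Functional

/-- Data describing a pair: the field is generated by `θ` with `θ ^ (e * n)` given by `poly`, and
elements are given by the integers whose base `p` digits are their coordinates. The elements
`dual` and `dualInv` define the functionals showing that `elt` and `inv` are `1`-normal, and `wit`
is the inverse of the product of all `elt ^ ((q ^ n - 1) / ℓ) - 1` with `ℓ` in `primes`. -/
structure Certificate where
  p : ℕ
  e : ℕ
  n : ℕ
  poly : List ℕ
  primes : List ℕ
  elt : ℕ
  inv : ℕ
  dual : ℕ
  dualInv : ℕ
  wit : ℕ

namespace Certificate

def cap (c : Certificate) : ℕ :=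
  c.n * (c.e * c.n * (c.p - 1) * (c.e * c.n * (c.p - 1)) * c.poly.sum * c.poly.sum)

def packing (c : Certificate) : Packing :=
  ⟨c.p, c.e * c.n, c.poly, c.cap, 2 * ((c.cap * c.p).log2 + 1), (c.cap * c.p).log2 + 1⟩

def q (c : Certificate) : ℕ := c.p ^ c.e

def order (c : Certificate) : ℕ := c.q ^ c.n - 1

def pow (c : Certificate) (x e : ℕ) : ℕ := c.packing.powMod (e.log2 + 1) x e

def conj (c : Certificate) (x i : ℕ) : ℕ := Nat.rec x (fun _ y => c.pow y c.q) i

def traceSum (c : Certificate) (x k : ℕ) : ℕ := Nat.rec 0 (fun i s => s + c.conj x i) k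

def pairing (c : Certificate) (x y i k : ℕ) : ℕ :=
  Nat.rec 0 (fun j s => s + c.conj y j * c.conj x (i + j)) k

def pairingsVanish (c : Certificate) (x y k : ℕ) : Bool :=
  Nat.rec true (fun i b => c.packing.isZero (c.packing.normalize (c.pairing x y i c.n)) && b) k

def isOneNormal (c : Certificate) (x y : ℕ) : Bool :=
  c.packing.isZero (c.traceSum x c.n) && (c.pairingsVanish x y (c.n - 2) &&
    c.packing.isOne (c.packing.normalize (c.pairing x y (c.n - 2) c.n)))

def witnessProd (c : Certificate) (x : ℕ) : List ℕ → ℕ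
  | [] => 1
  | ℓ :: l => c.packing.mulMod (c.packing.reduce (c.pow x (c.order / ℓ) + (c.p - 1)))
      (c.witnessProd x l)

def check (c : Certificate) : Bool :=
  c.packing.isValid && ((c.n * (c.packing.m * (c.p - 1))).ble c.cap && (Nat.ble 2 c.n &&
    (((c.primes.prod ^ (c.order / (c.q - 1)).log2) % (c.order / (c.q - 1))).beq 0 &&
    (c.packing.isOne (c.pow (2 ^ c.packing.w) c.order) &&
    (c.packing.isOne (c.packing.mulMod (c.packing.encode c.elt) (c.packing.encode c.inv)) &&
    (c.packing.isOne (c.packing.mulMod (c.packing.encode c.wit)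
      (c.witnessProd (c.packing.encode c.elt) c.primes)) &&
    (c.isOneNormal (c.packing.encode c.elt) (c.packing.encode c.dual) &&
    c.isOneNormal (c.packing.encode c.inv) (c.packing.encode c.dualInv))))))))

section Soundness

variable {R : Type*} [CommRing R] {c : Certificate} {θ : R} {x y : ℕ} {v u : R}

theorem rep_pow (hK : c.packing.IsRoot θ) (h : c.packing.Rep θ x v) (e : ℕ) :
    c.packing.Rep θ (c.pow x e) (v ^ e) :=
  hK.rep_powMod Nat.lt_log2_self h

theorem rep_conj (hK : c.packing.IsRoot θ) (h : c.packing.Rep θ x v) (i : ℕ) :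
    c.packing.Rep θ (c.conj x i) (v ^ c.q ^ i) := by
  induction i with
  | zero => simpa [conj] using h
  | succ i ih =>
    have := rep_pow hK ih c.q
    rwa [← pow_mul, ← pow_succ] at this

theorem represents_zero (w d : ℕ) (θ : R) : Represents w θ d 0 0 (0 : R) := by
  simpa using (Represents.natCast (w := w) (θ := θ) 0).mono (Nat.zero_le d) le_rfl

theorem represents_traceSum (hK : c.packing.IsRoot θ) (h : c.packing.Rep θ x v) (k : ℕ) :
    Represents c.packing.w θ (c.packing.m - 1) (k * (c.packing.m * (c.p - 1)))
      (c.traceSum x k) (∑ i ∈ Finset.range k, v ^ c.q ^ i) := by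
  induction k with
  | zero => simpa [traceSum] using represents_zero c.packing.w (c.packing.m - 1) θ
  | succ k ih =>
    rw [Finset.sum_range_succ, add_mul, one_mul]
    exact ih.add (rep_conj hK h k)

theorem represents_pairing (hK : c.packing.IsRoot θ) (hx : c.packing.Rep θ x v)
    (hy : c.packing.Rep θ y u) (i k : ℕ) :
    Represents c.packing.w θ (c.packing.m - 1 + (c.packing.m - 1))
      (k * (c.packing.m * (c.p - 1) * (c.packing.m * (c.p - 1))))
      (c.pairing x y i k) (∑ j ∈ Finset.range k, u ^ c.q ^ j * v ^ c.q ^ (i + j)) := by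
  induction k with
  | zero => simpa [pairing] using represents_zero c.packing.w _ θ
  | succ k ih =>
    rw [Finset.sum_range_succ, add_mul, one_mul]
    exact ih.add (Represents.mul (rep_conj hK hy k) (rep_conj hK hx (i + k)))

theorem rep_normalize_pairing (hK : c.packing.IsRoot θ) (hx : c.packing.Rep θ x v)
    (hy : c.packing.Rep θ y u) (i : ℕ) :
    c.packing.Rep θ (c.packing.normalize (c.pairing x y i c.n))
      (∑ j ∈ Finset.range c.n, u ^ c.q ^ j * v ^ c.q ^ (i + j)) :=
  hK.rep_normalize (represents_pairing hK hx hy i c.n) (by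
    simp only [packing, cap, mul_assoc]
    exact le_rfl)

theorem rep_le_cap (hK : c.packing.IsRoot θ) :
    c.packing.m * (c.packing.p - 1) ≤ c.packing.cap :=
  (Nat.le_add_right _ _).trans hK.bounds.2.2.2.2.2.2.2.2

theorem pairingsVanish_spec (hK : c.packing.IsRoot θ) (hx : c.packing.Rep θ x v)
    (hy : c.packing.Rep θ y u) {k : ℕ} (h : c.pairingsVanish x y k = true) :
    ∀ i < k, ∑ j ∈ Finset.range c.n, u ^ c.q ^ j * v ^ c.q ^ (i + j) = 0 := by
  induction k with
  | zero => intro i hi; omega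
  | succ k ih =>
    have h' : (c.packing.isZero (c.packing.normalize (c.pairing x y k c.n)) &&
      c.pairingsVanish x y k) = true := h
    rw [Bool.and_eq_true] at h'
    intro i hi
    rcases Nat.lt_succ_iff_lt_or_eq.1 hi with hlt | rfl
    · exact ih h'.2 i hlt
    · exact hK.eq_zero_of_isZero (rep_normalize_pairing hK hx hy i) (rep_le_cap hK) h'.1

theorem witnessProd_spec (hK : c.packing.IsRoot θ) (hx : c.packing.Rep θ x v) (l : List ℕ) :
    c.packing.Rep θ (c.witnessProd x l) (l.map fun ℓ => v ^ (c.order / ℓ) - 1).prod := by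
  induction l with
  | nil => simpa [witnessProd] using hK.rep_one
  | cons ℓ l ih =>
    rw [List.map_cons, List.prod_cons]
    exact hK.rep_mulMod (hK.represents_reduce (hK.rep_sub_one (rep_pow hK hx _))
      hK.bounds.2.2.2.2.2.2.2.2) ih

end Soundness

/-- The defining polynomial of the field described by a certificate. -/
def minpoly (c : Certificate) (k : Type*) [CommRing k] : k[X] :=
  X ^ c.packing.m - (listPoly c.poly).map (Nat.castRingHom k)

theorem aeval_minpoly (c : Certificate) {k R : Type*} [CommRing k] [CommRing R] [Algebra k R]
    (θ : R) : aeval θ (c.minpoly k) = θ ^ c.packing.m - aeval θ (listPoly c.poly) := by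
  rw [minpoly, map_sub, map_pow, aeval_X, aeval_def (R := k), eval₂_map, aeval_def]
  congr 2
  exact Subsingleton.elim _ _

theorem exists_isRoot (c : Certificate) {F : Type*} [Field F] [Fintype F] (hp : c.p.Prime)
    (hv : c.packing.isValid = true) (hF : Fintype.card F = c.q ^ c.n)
    (h : c.packing.isOne (c.pow (2 ^ c.packing.w) c.order) = true) :
    ∃ θ : F, c.packing.IsRoot θ := by
  have : Fact c.p.Prime := ⟨hp⟩
  have hpF : (c.p : F) = 0 := by
    have h1 : ((Fintype.card F : ℕ) : F) = 0 := FiniteField.cast_card_eq_zero F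
    rw [hF, q, ← pow_mul, Nat.cast_pow] at h1
    exact eq_zero_of_pow_eq_zero h1
  have : CharP F c.p := (CharP.charP_iff_prime_eq_zero hp).2 hpF
  let _ : Algebra (ZMod c.p) F := ZMod.algebra F c.p
  set f := c.minpoly (ZMod c.p) with hf
  have hR : c.packing.IsRoot (AdjoinRoot.root f) := by
    refine ⟨hv, ?_, ?_⟩
    · have h1 := congrArg (AdjoinRoot.of f) (CharP.cast_eq_zero (ZMod c.p) c.p)
      rwa [map_natCast, map_zero] at h1
    · have h1 : aeval (AdjoinRoot.root f) f = 0 := by rw [AdjoinRoot.aeval_eq, AdjoinRoot.mk_self]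
      rw [hf, aeval_minpoly, sub_eq_zero] at h1
      exact h1
  have h1 := hR.eq_one_of_isOne (rep_pow hR hR.rep_root _) h
  have hdvd : f ∣ X ^ c.order - 1 := by
    rw [← AdjoinRoot.mk_eq_zero, map_sub, map_pow, AdjoinRoot.mk_X, h1, map_one, sub_self]
  have hdeg : f.degree ≠ 0 := by
    have h2 := natDegree_map_le (f := Nat.castRingHom (ZMod c.p)) (p := listPoly c.poly)
    have h3 := natDegree_listPoly c.poly
    obtain ⟨-, h4, -, -, -, h5, -⟩ := hR.bounds
    have h6 : c.packing.poly = c.poly := rfl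
    rw [h6] at h5
    have h7 : f.natDegree = c.packing.m := by
      rw [hf, minpoly, natDegree_sub_eq_left_of_natDegree_lt, natDegree_X_pow]
      rw [natDegree_X_pow]
      omega
    intro h0
    rw [natDegree_eq_zero_iff_degree_le_zero.2 h0.le] at h7
    omega
  have hsplit : (f.map (algebraMap (ZMod c.p) F)).Splits := by
    have h3 := FiniteField.splits_X_pow_card_sub_X (K := F) c.p
    rw [Polynomial.map_sub, Polynomial.map_pow, map_X] at h3
    refine h3.of_dvd (FiniteField.X_pow_card_sub_X_ne_zero F Fintype.one_lt_card) ?_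
    have h2 := Polynomial.map_dvd (algebraMap (ZMod c.p) F) hdvd
    rw [Polynomial.map_sub, Polynomial.map_pow, map_X, Polynomial.map_one] at h2
    refine h2.trans ⟨X, ?_⟩
    rw [sub_mul, one_mul, ← pow_succ, order, ← hF, Nat.sub_add_cancel Fintype.card_pos]
  obtain ⟨θ, hθ⟩ := hsplit.exists_eval_eq_zero (by rwa [degree_map])
  refine ⟨θ, hv, hpF, ?_⟩
  rw [eval_map_algebraMap, hf, aeval_minpoly, sub_eq_zero] at hθ
  exact hθ

theorem exists_of_check {Fq F : Type*} [Field Fq] [Fintype Fq] [Field F] [Fintype F] [Algebra Fq F]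
    (c : Certificate) (hp : c.p.Prime) (hl : ∀ ℓ ∈ c.primes, ℓ.Prime) (hc : c.check = true)
    (hq : Fintype.card Fq = c.q) (hn : Module.finrank Fq F = c.n) :
    HasPrimitiveOneNormalPair Fq F (Fintype.card Fq) c.n := by
  have hF : Fintype.card F = c.q ^ c.n := by rw [Module.card_eq_pow_finrank (K := Fq), hq, hn]
  simp only [check, isOneNormal, Bool.and_eq_true] at hc
  obtain ⟨hv, hcap, hn2, hM, hroot, hinv, hwit, ⟨ht, hpv, hpo⟩, ht', hpv', hpo'⟩ := hc
  rw [Nat.ble_eq] at hcap hn2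
  obtain ⟨θ, hK⟩ := c.exists_isRoot (F := F) hp hv hF hroot
  have hrep := hK.rep_encode
  have h1 := hK.eq_one_of_isOne (hK.rep_mulMod (hrep c.elt) (hrep c.inv)) hinv
  have h2 := hK.eq_one_of_isOne (hK.rep_mulMod (hrep c.wit)
    (witnessProd_spec hK (hrep c.elt) c.primes)) hwit
  have hnormal : ∀ x y, c.packing.isZero (c.traceSum (c.packing.encode x) c.n) = true →
      c.pairingsVanish (c.packing.encode x) (c.packing.encode y) (c.n - 2) = true →
      c.packing.isOne (c.packing.normalize (c.pairing (c.packing.encode x) (c.packing.encode y)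
        (c.n - 2) c.n)) = true →
      IsKNormal Fq (Fintype.card Fq) c.n 1 (c.packing.decode θ x) := by
    intro x y hx1 hx2 hx3
    refine isKNormal_one_of_functional (β := c.packing.decode θ y) hn2 ?_ ?_ ?_
    · rw [hq]
      exact hK.eq_zero_of_isZero (represents_traceSum hK (hrep x) c.n) hcap hx1
    · rw [hq]
      exact pairingsVanish_spec hK (hrep x) (hrep y) hx2
    · rw [hq]
      exact hK.eq_one_of_isOne (rep_normalize_pairing hK (hrep x) (hrep y) _) hx3
  set a := c.packing.decode θ c.elt
  set a' := c.packing.decode θ c.inv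
  have hq1 : 1 < c.q := hq ▸ Fintype.one_lt_card
  have hMeq : c.order / (c.q - 1) * (c.q - 1) = c.order :=
    Nat.div_mul_cancel (by simpa [order] using Nat.sub_dvd_pow_sub_pow c.q 1 c.n)
  refine exists_primitive_of_not_mem_range (M := c.order / (c.q - 1))
    (α := ⟨a, a', h1, (mul_comm _ _).trans h1⟩) hn (by rw [hq]; exact hMeq) ?_
    (hnormal _ _ ht hpv hpo) (hnormal _ _ ht' hpv' hpo')
  intro ℓ hℓ hmem
  have hℓp := Nat.prime_of_mem_primeFactors hℓ
  have hℓM := Nat.dvd_of_mem_primeFactors hℓ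
  rw [Nat.beq_eq] at hM
  have hℓmem : ℓ ∈ c.primes := by
    have h3 := hℓp.prime.dvd_of_dvd_pow (hℓM.trans (Nat.dvd_of_mod_eq_zero hM))
    obtain ⟨r, hr, hdvd⟩ := (Prime.dvd_prod_iff hℓp.prime).1 h3
    rwa [(Nat.prime_dvd_prime_iff_eq hℓp (hl r hr)).1 hdvd]
  obtain ⟨g, hg⟩ := hmem
  have hga : a = (g : F) ^ ℓ := by
    have := congrArg Units.val hg
    simpa using this.symm
  have hone : a ^ (c.order / ℓ) - 1 = 0 := by
    rw [hga, ← pow_mul, Nat.mul_div_cancel' (hℓM.trans ⟨_, hMeq.symm⟩), order, ← hF, sub_eq_zero]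
    exact FiniteField.pow_card_sub_one_eq_one _ g.ne_zero
  have hzero : (c.primes.map fun ℓ => a ^ (c.order / ℓ) - 1).prod = 0 :=
    List.prod_eq_zero (List.mem_map.2 ⟨ℓ, hℓmem, hone⟩)
  rw [hzero, mul_zero] at h2
  exact zero_ne_one h2

end Certificate

/-- Certificates for all exceptional pairs. -/
def certificates : List Certificate :=
  [⟨2, 1, 7, [1, 1], [127], 26, 102, 78, 92, 14⟩,
    ⟨2, 1, 8, [1, 0, 1, 1, 1], [3, 5, 17], 204, 133, 40, 38, 103⟩,
    ⟨2, 1, 9, [1, 1], [7, 73], 396, 236, 504, 356, 230⟩,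
    ⟨2, 1, 10, [1, 0, 0, 1], [3, 11, 31], 376, 320, 194, 464, 717⟩,
    ⟨2, 1, 11, [1, 0, 1], [23, 89], 709, 1983, 524, 1150, 1178⟩,
    ⟨2, 1, 12, [1, 0, 0, 1], [3, 5, 7, 13], 2166, 2119, 2914, 3982, 22⟩,
    ⟨2, 1, 14, [1, 0, 0, 0, 0, 1], [3, 43, 127], 2461, 9695, 4802, 7124, 11735⟩,
    ⟨2, 1, 15, [1, 1], [7, 31, 151], 8608, 20466, 2450, 2526, 4748⟩,
    ⟨2, 1, 16, [1, 0, 0, 1, 1, 1], [3, 5, 17, 257], 402, 34746, 29220, 57342, 62061⟩,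
    ⟨2, 1, 18, [1, 0, 0, 1], [3, 7, 19, 73], 211257, 74436, 32874, 165854, 76140⟩,
    ⟨2, 1, 20, [1, 0, 0, 1], [3, 5, 11, 31, 41], 97968, 271468, 760572, 469856, 301683⟩,
    ⟨2, 1, 21, [1, 0, 1], [7, 127, 337], 1316862, 540051, 529702, 2065670, 446620⟩,
    ⟨2, 1, 22, [1, 1], [3, 23, 89, 683], 391928, 1211324, 3647544, 3442326, 68592⟩,
    ⟨2, 1, 24, [1, 1, 0, 1, 1], [3, 5, 7, 13, 17, 241], 15619198, 654635, 14231724, 12955206,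
      11005216⟩,
    ⟨2, 1, 28, [1, 1], [3, 5, 29, 43, 113, 127], 85648553, 3592255, 191056498, 177246610,
      43926995⟩,
    ⟨2, 1, 30, [1, 1], [3, 7, 11, 31, 151, 331], 499592779, 462524202, 638031968, 636404804,
      210718888⟩,
    ⟨3, 1, 7, [1, 0, 2], [1093], 948, 1228, 675, 1383, 1847⟩,
    ⟨3, 1, 8, [1, 0, 1], [2, 5, 41], 2355, 3330, 1944, 1290, 1690⟩,
    ⟨3, 1, 9, [1, 0, 1, 1], [13, 757], 1612, 6742, 3579, 18111, 9046⟩,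
    ⟨3, 1, 10, [2, 0, 1], [2, 11, 61], 43071, 57518, 58320, 57678, 22037⟩,
    ⟨3, 1, 12, [1, 0, 1], [2, 5, 7, 13, 73], 406611, 367084, 68541, 485637, 381537⟩,
    ⟨3, 1, 14, [1, 1], [2, 547, 1093], 753672, 3147394, 3449841, 584337, 1247888⟩,
    ⟨3, 1, 16, [2, 0, 2, 1], [2, 5, 17, 41, 193], 6333749, 26173293, 28451460, 7352760, 35840521⟩,
    ⟨3, 1, 18, [2, 0, 2, 1], [2, 7, 13, 19, 37, 757], 29339422, 160727480, 127347228, 181137282,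
      150943722⟩,
    ⟨3, 1, 24, [1, 0, 0, 0, 1], [2, 5, 7, 13, 41, 73, 6481], 212129356377, 11483118236,
      98006351916, 108817819758, 260620712316⟩,
    ⟨2, 2, 7, [1, 0, 0, 0, 0, 1], [43, 127], 9464, 9221, 2416, 11264, 7624⟩,
    ⟨2, 2, 8, [1, 0, 0, 1, 1, 1], [5, 17, 257], 1963, 10255, 23608, 3574, 33930⟩,
    ⟨2, 2, 9, [1, 0, 0, 1], [3, 7, 19, 73], 86235, 14543, 162940, 22766, 178661⟩,
    ⟨2, 2, 10, [1, 0, 0, 1], [5, 11, 31, 41], 605866, 125219, 194714, 474962, 836348⟩,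
    ⟨2, 2, 12, [1, 1, 0, 1, 1], [3, 5, 7, 13, 17, 241], 1567915, 16452536, 10020034, 624398,
      3192258⟩,
    ⟨2, 2, 15, [1, 1], [3, 7, 11, 31, 151, 331], 208267004, 455749334, 125943828, 443385702,
      893374631⟩,
    ⟨2, 2, 18, [1, 0, 1, 0, 1, 1], [3, 5, 7, 13, 19, 37, 73, 109], 66156493557, 35793400078,
      49401887754, 4287090000, 16605849307⟩,
    ⟨5, 1, 7, [1, 3], [19531], 52093, 31922, 15410, 73350, 45758⟩,
    ⟨5, 1, 8, [2, 1, 1], [2, 3, 13, 313], 360778, 146178, 112995, 386165, 15924⟩,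
    ⟨5, 1, 10, [1, 1, 3], [2, 3, 11, 71, 521], 6655689, 8445131, 5808915, 2321285, 6566090⟩,
    ⟨5, 1, 12, [1, 1], [2, 3, 7, 13, 31, 601], 136890094, 202693383, 231884065, 72218045,
      96733231⟩,
    ⟨5, 1, 16, [4, 1, 4], [2, 3, 13, 17, 313, 11489], 87276833236, 53684439882, 85925426040,
      55626114570, 138300056515⟩,
    ⟨5, 1, 24, [3, 0, 2, 2], [2, 3, 7, 13, 31, 313, 601, 390001], 14170021088048613,
      22988962697425662, 50889864570041890, 20004047278695560, 18388067615971784⟩,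
    ⟨7, 1, 7, [1, 1], [29, 4733], 73205, 102410, 599368, 216209, 400125⟩,
    ⟨7, 1, 8, [1, 1], [2, 5, 1201], 4755002, 2282077, 1454838, 3012905, 3737789⟩,
    ⟨7, 1, 9, [1, 3], [3, 19, 37, 1063], 34370150, 17206725, 19895267, 15976163, 27701846⟩,
    ⟨7, 1, 12, [3, 1, 5], [2, 3, 5, 13, 19, 43, 181], 5351339020, 1393291531, 634758992,
      5353473475, 951704169⟩,
    ⟨2, 3, 7, [1, 0, 1], [7, 127, 337], 989693, 252396, 231154, 372276, 1111498⟩,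
    ⟨2, 3, 8, [1, 1, 0, 1, 1], [3, 5, 13, 17, 241], 15609556, 11627707, 16404308, 3828586,
      8315098⟩,
    ⟨2, 3, 14, [1, 1, 1, 0, 0, 1], [3, 7, 43, 127, 337, 5419], 2719930384959, 1705267721951,
      803007380928, 1042172718298, 1892958271994⟩,
    ⟨3, 2, 8, [2, 0, 2, 1], [2, 5, 17, 41, 193], 18651925, 21734836, 17658183, 29067399, 25790015⟩,
    ⟨3, 2, 10, [2, 1, 0, 2], [2, 5, 11, 61, 1181], 3301560942, 1993114660, 879340566, 381930903,
      3460203133⟩,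
    ⟨3, 2, 12, [1, 0, 0, 0, 1], [2, 5, 7, 13, 41, 73, 6481], 137556748419, 104852255929,
      192444603861, 204452634987, 152413670093⟩,
    ⟨3, 2, 16, [2, 1, 1, 2], [2, 5, 17, 41, 193, 21523361], 1264242204764852, 1173527400522264,
      101660955593607, 59902216026762, 1141581884616187⟩,
    ⟨11, 1, 8, [2, 2], [2, 3, 61, 7321], 209659295, 81058245, 22211145, 96440256, 135689536⟩,
    ⟨11, 1, 10, [2, 1, 1], [2, 3, 5, 3221, 13421], 11769008752, 10041478389, 21215563842,
      21525320003, 22495481758⟩,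
    ⟨13, 1, 8, [1, 1], [2, 5, 7, 17, 14281], 779534557, 663088830, 418397070, 106560038,
      247775581⟩,
    ⟨13, 1, 12, [1, 1], [2, 3, 5, 7, 17, 61, 157, 28393], 346126397422, 3545262304660,
      22566577097415, 2578110035202, 4428845743242⟩,
    ⟨2, 4, 15, [1, 1], [3, 5, 7, 11, 13, 31, 41, 61, 151, 331, 1321], 233351331909440431,
      17211112299544447, 129029567689572958, 131624068096733868, 783089367446015070⟩,
    ⟨17, 1, 8, [2, 3], [2, 3, 5, 29, 41761], 1277682964, 670621159, 5588383514, 4337709443,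
      2748348426⟩,
    ⟨17, 1, 16, [2, 1, 1], [2, 3, 5, 29, 18913, 41761, 184417], 10799882780428922663,
      21892581038249757134, 11853815521906348139, 32356787863267759117, 45230062126488083711⟩,
    ⟨19, 1, 18, [2, 1, 2], [2, 3, 5, 7, 127, 199, 523, 29989, 236377], 82187758443922049633213,
      5429229459597644707610, 16177322823162322064560, 59966060524824658393566,
      93947437624965145588844⟩,
    ⟨23, 1, 8, [1, 4], [2, 3, 5, 53, 139921], 16636943473, 49285936604, 67903035631, 69384893293,
      10773282561⟩,
    ⟨5, 2, 8, [4, 1, 4], [2, 13, 17, 313, 11489], 121042525111, 50190298722, 34236317875,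
      3871826750, 62180581867⟩,
    ⟨29, 1, 8, [1, 1], [2, 3, 5, 421, 353641], 271087472583, 178993143047, 355615295571,
      15252829038, 224450941231⟩]

theorem certificates_check : ∀ c ∈ certificates, c.check = true := by decide +kernel

set_option maxRecDepth 10000 in
theorem certificates_prime : ∀ c ∈ certificates, c.p.Prime ∧ ∀ ℓ ∈ c.primes, ℓ.Prime := by
  simp only [certificates, List.forall_mem_cons, List.not_mem_nil, false_imp_iff, forall_const,
    and_true]
  norm_num

theorem exists_certificate {q n : ℕ} (h : isExceptional q n = true) :
    ∃ c ∈ certificates, c.q = q ∧ c.n = n := by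
  have key : ∀ x ∈ exceptionalPairs, ∀ m ∈ x.2, ∃ c ∈ certificates, c.q = x.1 ∧ c.n = m := by
    decide +kernel
  simp only [isExceptional, List.any_eq_true, Bool.and_eq_true, Nat.beq_eq] at h
  obtain ⟨x, hx, rfl, m, hm, rfl⟩ := h
  exact key x hx _ hm

/-- For every prime power `q` and every `n ≥ 7` there is `α ∈ F_{q^n}^*` such that
both `α` and `α⁻¹` are simultaneously primitive and `1`-normal over `F_q`. -/
theorem exists_primitive_one_normal_pair_of_seven_le
    (q n : ℕ) (hq : IsPrimePow q) (hn : 7 ≤ n)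
    (Fq F : Type*) [Field Fq] [Field F] [Fintype Fq] [Fintype F] [Algebra Fq F]
    (hcard : Fintype.card Fq = q) (hdim : Module.finrank Fq F = n) :
    ∃ α : F, α ≠ 0 ∧ orderOf α = q ^ n - 1 ∧ orderOf α⁻¹ = q ^ n - 1 ∧
      IsKNormal Fq q n 1 α ∧ IsKNormal Fq q n 1 α⁻¹ := by
  subst hcard
  cases hex : isExceptional (Fintype.card Fq) n with
  | false => exact exists_of_not_isExceptional hdim hn hex
  | true =>
    obtain ⟨c, hc, hq', rfl⟩ := exists_certificate hex
    exact c.exists_of_check (certificates_prime c hc).1 (certificates_prime c hc).2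
      (certificates_check c hc) hq'.symm hdim

end
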